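/- Regular flux surfaces are tori: Let U ⊆ ℝ³ be open, p : U → ℝ be C^∞, c ∈ ℝ, and let Λ be a compact connected component of p⁻¹(c) such that ∇p(z) ≠ 0 for every z ∈ Λ. Suppose B : U → ℝ³ is C^∞, nowhere vanishing on Λ, and tangent to Λ, i.e. ⟪B(z), ∇p(z)⟫ = 0 for all z ∈ Λ. Then Λ, with its subspace topology, is homeomorphic to the two-torus (ℝ/ℤ) × (ℝ/ℤ). -/

import Mathlib

noncomputable section

open RealInnerProductSpace

/-- `ℝ³` as a Euclidean space. -/
abbrev R3 : Type := EuclideanSpace ℝ (Fin 3)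

/-- The point `(x, y, z)` of `ℝ³`. -/
def pt (x y z : ℝ) : R3 := !₂[x, y, z]

/-- Divergence of a vector field: the trace of its derivative. -/
def divg (v : R3 → R3) (z : R3) : ℝ :=
  LinearMap.trace ℝ R3 (fderiv ℝ v z).toLinearMap

/-- Cross product on `ℝ³`. -/
def cross3 (u v : R3) : R3 :=
  pt (u 1 * v 2 - u 2 * v 1) (u 2 * v 0 - u 0 * v 2) (u 0 * v 1 - u 1 * v 0)

/-- Standard basis vectors of `ℝ³`. -/
def e3 (i : Fin 3) : R3 := EuclideanSpace.single i 1

/-- Curl of a vector field on `ℝ³`. -/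
def curl (v : R3 → R3) (z : R3) : R3 :=
  pt (fderiv ℝ v z (e3 1) 2 - fderiv ℝ v z (e3 2) 1)
     (fderiv ℝ v z (e3 2) 0 - fderiv ℝ v z (e3 0) 2)
     (fderiv ℝ v z (e3 0) 1 - fderiv ℝ v z (e3 1) 0)

/-- The Hessian of `p` at `z`, as a bilinear form. -/
def hess (p : R3 → ℝ) (z : R3) (u v : R3) : ℝ :=
  (iteratedFDeriv ℝ 2 p z) ![u, v]

/-- `γ` is the image of a periodic integral curve of `B` lying in `U`. -/
def IsPeriodicOrbit (U : Set R3) (B : R3 → R3) (γ : Set R3) : Prop :=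
  ∃ (c : ℝ → R3) (T : ℝ), 0 < T ∧ (∀ t, c t ∈ U) ∧
    (∀ t, c (t + T) = c t) ∧ (∀ t, HasDerivAt c (B (c t)) t) ∧ Set.range c = γ

/-- An integrable magnetic field `(B, J, p)` on an open set `U ⊆ ℝ³`. -/
structure IntegrableMagneticField (U : Set R3) (B J : R3 → R3) (p : R3 → ℝ) : Prop where
  isOpen_U : IsOpen U
  smooth_B : ContDiffOn ℝ (⊤ : ℕ∞) B U
  smooth_J : ContDiffOn ℝ (⊤ : ℕ∞) J U
  smooth_p : ContDiffOn ℝ (⊤ : ℕ∞) p U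
  B_ne_zero : ∀ z ∈ U, B z ≠ 0
  div_B : ∀ z ∈ U, divg B z = 0
  div_J : ∀ z ∈ U, divg J z = 0
  hamiltonian : ∀ z ∈ U, cross3 (J z) (B z) = gradient p z

/-- A nondegenerate elliptic magnetic axis: a compact image of a periodic integral
curve of `B` on which `∇p = 0` and the Hessian of `p`, restricted to the plane
orthogonal to `B`, is positive or negative definite. -/
def IsNondegenerateEllipticAxis (U : Set R3) (B : R3 → R3) (p : R3 → ℝ)
    (γ : Set R3) : Prop :=
  IsCompact γ ∧ γ ⊆ U ∧ IsPeriodicOrbit U B γ ∧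
  (∀ z ∈ γ, gradient p z = 0) ∧
  ∀ z ∈ γ,
    (∀ u : R3, u ≠ 0 → ⟪u, B z⟫ = 0 → 0 < hess p z u u) ∨
    (∀ u : R3, u ≠ 0 → ⟪u, B z⟫ = 0 → hess p z u u < 0)

/-- The solid cylinder `D_r × ℝ = {(x,y,φ) : x² + y² < r²}` in `ℝ³`. -/
def Dset (r : ℝ) : Set R3 := {q | (q 0) ^ 2 + (q 1) ^ 2 < r ^ 2}

section Flows

open Set Filter Topology Metric
open scoped NNReal

variable {E : Type*} [NormedAddCommGroup E] [NormedSpace ℝ E]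

/-- `φ` is a global flow of the vector field `v`. -/
structure IsFlow (v : E → E) (φ : ℝ → E → E) : Prop where
  zero : ∀ x, φ 0 x = x
  deriv : ∀ x t, HasDerivAt (fun s => φ s x) (v (φ t x)) t

theorem exists_global_solution [CompleteSpace E] {v : E → E} {K L : ℝ≥0}
    (hK : LipschitzWith K v) (hL : ∀ x, ‖v x‖ ≤ L) (x : E) :
    ∃ α : ℝ → E, α 0 = x ∧ ∀ t, HasDerivAt α (v (α t)) t := by
  have key : ∀ n : ℕ, ∃ α : ℝ → E, α 0 = x ∧
      ∀ t ∈ Ioo (-(n + 1 : ℝ)) (n + 1), HasDerivAt α (v (α t)) t := by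
    intro n
    have h0 : (0 : ℝ) ∈ Icc (-(n + 1 : ℝ)) (n + 1) := by
      constructor <;> linarith [(Nat.cast_nonneg n : (0 : ℝ) ≤ n)]
    have hpl : IsPicardLindelof (fun _ => v) (⟨0, h0⟩ : Icc (-(n + 1 : ℝ)) (n + 1)) x
        (L * (n + 1)) 0 L K :=
      { lipschitzOnWith := fun _ _ => hK.lipschitzOnWith
        continuousOn := fun _ _ => continuousOn_const
        norm_le := fun _ _ y _ => hL y
        mul_max_le := by simp }
    obtain ⟨α, h1, h2⟩ := hpl.exists_eq_forall_mem_Icc_hasDerivWithinAt₀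
    exact ⟨α, h1, fun t ht => (h2 t (Ioo_subset_Icc_self ht)).hasDerivAt (Icc_mem_nhds ht.1 ht.2)⟩
  choose α h0 hα using key
  have agree : ∀ m n : ℕ, m ≤ n → EqOn (α m) (α n) (Ioo (-(m + 1 : ℝ)) (m + 1)) := by
    intro m n hmn
    have hmn' : (m : ℝ) ≤ n := by exact_mod_cast hmn
    refine ODE_solution_unique_of_mem_Ioo (v := fun _ => v) (s := fun _ => univ) (t₀ := 0) (K := K)
      (fun _ _ => hK.lipschitzOnWith) ?_ (fun t ht => ⟨hα m t ht, trivial⟩)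
      (fun t ht => ⟨hα n t ?_, trivial⟩) (by rw [h0, h0])
    · constructor <;> linarith [(Nat.cast_nonneg m : (0 : ℝ) ≤ m)]
    · exact ⟨by linarith [ht.1], by linarith [ht.2]⟩
  have loc : ∀ (n : ℕ) t, t ∈ Ioo (-(n + 1 : ℝ)) (n + 1) → α ⌈|t|⌉₊ t = α n t := by
    intro n t ht
    have h1 : |t| ≤ ⌈|t|⌉₊ := Nat.le_ceil _
    have h2 : t ∈ Ioo (-((⌈|t|⌉₊ : ℝ) + 1)) ((⌈|t|⌉₊ : ℝ) + 1) := by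
      rw [abs_le] at h1
      exact ⟨by linarith, by linarith⟩
    rcases le_total n ⌈|t|⌉₊ with h | h
    · exact (agree _ _ h ht).symm
    · exact agree _ _ h h2
  refine ⟨fun t => α ⌈|t|⌉₊ t, by simp [h0], fun t => ?_⟩
  have ht : t ∈ Ioo (-((⌈|t|⌉₊ : ℝ) + 1)) ((⌈|t|⌉₊ : ℝ) + 1) := by
    have h1 : |t| ≤ ⌈|t|⌉₊ := Nat.le_ceil _
    rw [abs_le] at h1
    exact ⟨by linarith, by linarith⟩
  refine (hα _ t ht).congr_of_eventuallyEq ?_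
  filter_upwards [isOpen_Ioo.mem_nhds ht] with s hs
  exact loc _ s hs

theorem exists_isFlow [CompleteSpace E] {v : E → E} {K L : ℝ≥0}
    (hK : LipschitzWith K v) (hL : ∀ x, ‖v x‖ ≤ L) : ∃ φ, IsFlow v φ := by
  choose α h0 h1 using exists_global_solution hK hL
  exact ⟨fun t x => α x t, h0, h1⟩

/-- A two-sided Grönwall inequality with a convenient right-hand side. -/
theorem norm_le_of_deriv_bound {y y' : ℝ → E} {T K δ ε : ℝ} (hK : 0 ≤ K) (hε : 0 ≤ ε)
    (hy : ∀ t, |t| ≤ T → HasDerivAt y (y' t) t) (h0 : ‖y 0‖ ≤ δ)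
    (hb : ∀ t, |t| ≤ T → ‖y' t‖ ≤ K * ‖y t‖ + ε) :
    ∀ t, |t| ≤ T → ‖y t‖ ≤ (δ + ε * |t|) * Real.exp (K * |t|) := by
  have hδ : 0 ≤ δ := (norm_nonneg _).trans h0
  have bound : ∀ t, 0 ≤ t → gronwallBound δ K ε t ≤ (δ + ε * t) * Real.exp (K * t) := by
    intro t ht
    rcases hK.eq_or_lt with rfl | hK
    · simp [gronwallBound_K0]
    · rw [gronwallBound_of_K_ne_0 hK.ne']
      have h1 : Real.exp (K * t) - 1 ≤ K * t * Real.exp (K * t) := by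
        have := Real.add_one_le_exp (-(K * t))
        have h2 : Real.exp (-(K * t)) * Real.exp (K * t) = 1 := by
          rw [← Real.exp_add]; simp
        nlinarith [Real.exp_pos (K * t)]
      have h3 : ε / K * (Real.exp (K * t) - 1) ≤ ε / K * (K * t * Real.exp (K * t)) := by gcongr
      have h4 : ε / K * (K * t * Real.exp (K * t)) = ε * t * Real.exp (K * t) := by
        field_simp
      simp only
      linarith
  have pos : ∀ {y y' : ℝ → E}, (∀ t, |t| ≤ T → HasDerivAt y (y' t) t) → ‖y 0‖ ≤ δ →
      (∀ t, |t| ≤ T → ‖y' t‖ ≤ K * ‖y t‖ + ε) → ∀ t, 0 ≤ t → t ≤ T →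
      ‖y t‖ ≤ (δ + ε * t) * Real.exp (K * t) := by
    intro y y' hy h0 hb t ht htT
    have := norm_le_gronwallBound_of_norm_deriv_right_le (f := y) (f' := y') (a := 0) (b := T)
      (fun s hs => (hy s (by rw [abs_of_nonneg hs.1]; exact hs.2)).continuousAt.continuousWithinAt)
      (fun s hs => (hy s (by rw [abs_of_nonneg hs.1]; exact hs.2.le)).hasDerivWithinAt) h0
      (fun s hs => hb s (by rw [abs_of_nonneg hs.1]; exact hs.2.le)) t ⟨ht, htT⟩
    rw [sub_zero] at this
    exact this.trans (bound t ht)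
  intro t ht
  rcases le_total 0 t with h | h
  · rw [abs_of_nonneg h] at ht ⊢
    exact pos hy h0 hb t h ht
  · rw [abs_of_nonpos h] at ht ⊢
    have := pos (y := fun s => y (-s)) (y' := fun s => -y' (-s))
      (fun s hs => by
        have := (hy (-s) (by rwa [abs_neg])).scomp s (hasDerivAt_neg s)
        simpa [Function.comp_def] using this)
      (by simpa using h0) (fun s hs => by simpa using hb (-s) (by rwa [abs_neg])) (-t)
      (by linarith) ht
    simpa using this

namespace IsFlow

variable {v : E → E} {φ : ℝ → E → E} {K : ℝ≥0}

theorem eq_of_hasDerivAt (hφ : IsFlow v φ) (hK : LipschitzWith K v) {γ : ℝ → E}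
    (hγ : ∀ t, HasDerivAt γ (v (γ t)) t) (t : ℝ) : γ t = φ t (γ 0) := by
  have := ODE_solution_unique_univ (v := fun _ => v) (s := fun _ => univ) (t₀ := 0) (K := K)
    (fun _ => hK.lipschitzOnWith) (fun t => ⟨hγ t, trivial⟩)
    (fun t => ⟨hφ.deriv (γ 0) t, trivial⟩) (by simp [hφ.zero])
  exact congrFun this t

theorem add (hφ : IsFlow v φ) (hK : LipschitzWith K v) (s t : ℝ) (x : E) :
    φ (s + t) x = φ s (φ t x) := by
  have := hφ.eq_of_hasDerivAt hK (γ := fun s => φ (s + t) x)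
    (fun s => (hφ.deriv x (s + t)).comp_add_const s t) s
  simpa using this

theorem continuous_time (hφ : IsFlow v φ) (x : E) : Continuous fun t => φ t x :=
  continuous_iff_continuousAt.2 fun t => (hφ.deriv x t).continuousAt

theorem norm_sub_le (hφ : IsFlow v φ) (hK : LipschitzWith K v) (t : ℝ) (x y : E) :
    ‖φ t x - φ t y‖ ≤ ‖x - y‖ * Real.exp (K * |t|) := by
  have := norm_le_of_deriv_bound (y := fun t => φ t x - φ t y)
    (y' := fun t => v (φ t x) - v (φ t y)) (T := |t|) (K := K) (δ := ‖x - y‖) (ε := 0)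
    K.2 le_rfl (fun s _ => (hφ.deriv x s).sub (hφ.deriv y s)) (by simp [hφ.zero])
    (fun s _ => by simpa using hK.norm_sub_le _ _) t le_rfl
  simpa using this

theorem continuous (hφ : IsFlow v φ) (hK : LipschitzWith K v) :
    Continuous fun q : ℝ × E => φ q.1 q.2 := by
  rw [continuous_iff_continuousAt]
  rintro ⟨t, x⟩
  rw [ContinuousAt, tendsto_iff_norm_sub_tendsto_zero]
  have h1 : Tendsto (fun q : ℝ × E => ‖q.2 - x‖ * Real.exp (K * |q.1|) + ‖φ q.1 x - φ t x‖)
      (𝓝 (t, x)) (𝓝 0) := by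
    have : Continuous fun q : ℝ × E =>
        ‖q.2 - x‖ * Real.exp (K * |q.1|) + ‖φ q.1 x - φ t x‖ := by
      have h := (hφ.continuous_time x).comp (continuous_fst (X := ℝ) (Y := E))
      refine Continuous.add (by fun_prop) (h.sub continuous_const).norm
    simpa using this.tendsto (t, x)
  refine squeeze_zero (fun _ => norm_nonneg _) (fun q => ?_) h1
  calc ‖φ q.1 q.2 - φ t x‖ ≤ ‖φ q.1 q.2 - φ q.1 x‖ + ‖φ q.1 x - φ t x‖ := norm_sub_le_norm_sub_add_norm_sub _ _ _
    _ ≤ _ := by gcongr; exact hφ.norm_sub_le hK _ _ _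

theorem continuous_space (hφ : IsFlow v φ) (hK : LipschitzWith K v) (t : ℝ) :
    Continuous (φ t) :=
  (hφ.continuous hK).comp (by fun_prop : Continuous fun x : E => (t, x))

theorem hasStrictFDerivAt (hφ : IsFlow v φ) (hK : LipschitzWith K v) (x₀ : E) :
    HasStrictFDerivAt (fun q : ℝ × E => φ q.1 q.2)
      ((ContinuousLinearMap.fst ℝ ℝ E).smulRight (v x₀) + ContinuousLinearMap.snd ℝ ℝ E)
      (0, x₀) := by
  rw [hasStrictFDerivAt_iff_isLittleO, Asymptotics.isLittleO_iff]
  intro c hc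
  have hcont : Tendsto (fun q : ℝ × E => ‖v (φ q.1 q.2) - v x₀‖) (𝓝 (0, x₀)) (𝓝 0) := by
    have : Continuous fun q : ℝ × E => ‖v (φ q.1 q.2) - v x₀‖ :=
      ((hK.continuous.comp (hφ.continuous hK)).sub continuous_const).norm
    simpa [hφ.zero] using this.tendsto (0, x₀)
  have hev : ∀ᶠ q : ℝ × E in 𝓝 (0, x₀), ‖v (φ q.1 q.2) - v x₀‖ < c / 2 :=
    hcont.eventually (gt_mem_nhds (by positivity))
  have hK2 : ∀ᶠ t : ℝ in 𝓝 0, K * Real.exp (K * |t|) * |t| < c / 2 := by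
    have : Continuous fun t : ℝ => K * Real.exp (K * |t|) * |t| := by fun_prop
    have h := this.tendsto 0
    simp only [abs_zero, mul_zero] at h
    exact h.eventually (gt_mem_nhds (by positivity))
  obtain ⟨δ, hδ, hball⟩ := Metric.eventually_nhds_iff_ball.1
    (hev.and ((continuous_fst (X := ℝ) (Y := E)).tendsto (0, x₀) |>.eventually hK2))
  have hU : ball ((0 : ℝ), x₀) δ ×ˢ ball ((0 : ℝ), x₀) δ ∈ 𝓝 (((0 : ℝ), x₀), ((0 : ℝ), x₀)) :=
    prod_mem_nhds (ball_mem_nhds _ hδ) (ball_mem_nhds _ hδ)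
  filter_upwards [hU]
  rintro ⟨⟨t, x⟩, ⟨t', x'⟩⟩ ⟨h1, h2⟩
  simp only at h1 h2
  have a1 : ‖(φ t x - x - t • v x₀) - (φ t' x - x - t' • v x₀)‖ ≤ c / 2 * |t - t'| := by
    have := (convex_ball (0 : ℝ) δ).norm_image_sub_le_of_norm_hasDerivWithin_le (𝕜 := ℝ)
      (f := fun s => φ s x - x - s • v x₀) (f' := fun s => v (φ s x) - v x₀) (C := c / 2)
      (x := t') (y := t)
      (fun s _ => by
        have := ((hφ.deriv x s).sub_const x).fun_sub ((hasDerivAt_id s).smul_const (v x₀))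
        simpa using! this.hasDerivWithinAt)
      (fun s hs => by
        have hm : (s, x) ∈ ball ((0 : ℝ), x₀) δ := by
          rw [← ball_prod_same] at h1 ⊢
          exact ⟨hs, h1.2⟩
        exact (hball _ hm).1.le)
      (by rw [← ball_prod_same] at h2; exact h2.1) (by rw [← ball_prod_same] at h1; exact h1.1)
    simpa using! this
  have a2 : ‖(φ t' x - x) - (φ t' x' - x')‖ ≤ c / 2 * ‖x - x'‖ := by
    have h := (convex_closedBall (0 : ℝ) |t'|).norm_image_sub_le_of_norm_hasDerivWithin_le (𝕜 := ℝ)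
      (f := fun s => (φ s x - x) - (φ s x' - x')) (f' := fun s => v (φ s x) - v (φ s x'))
      (C := K * Real.exp (K * |t'|) * ‖x - x'‖) (x := 0) (y := t')
      (fun s _ => (((hφ.deriv x s).sub_const x).sub
        ((hφ.deriv x' s).sub_const x')).hasDerivWithinAt)
      (fun s hs => by
        have hs' : |s| ≤ |t'| := by simpa using hs
        calc ‖v (φ s x) - v (φ s x')‖ ≤ K * ‖φ s x - φ s x'‖ := hK.norm_sub_le _ _
          _ ≤ K * (‖x - x'‖ * Real.exp (K * |s|)) := by gcongr; exact hφ.norm_sub_le hK _ _ _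
          _ ≤ K * (‖x - x'‖ * Real.exp (K * |t'|)) := by gcongr
          _ = _ := by ring)
      (by simp) (by simp)
    simp only [hφ.zero, sub_self, sub_zero, Real.norm_eq_abs] at h
    have h3 := (hball _ h2).2
    simp only at h3
    calc _ ≤ _ := h
      _ = (K * Real.exp (K * |t'|) * |t'|) * ‖x - x'‖ := by ring
      _ ≤ _ := by gcongr
  have e : φ t x - φ t' x' - ((ContinuousLinearMap.fst ℝ ℝ E).smulRight (v x₀) +
      ContinuousLinearMap.snd ℝ ℝ E) ((t, x) - (t', x')) =
      ((φ t x - x - t • v x₀) - (φ t' x - x - t' • v x₀)) + ((φ t' x - x) - (φ t' x' - x')) := by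
    simp [sub_smul]; abel
  simp only [e]
  calc _ ≤ c / 2 * |t - t'| + c / 2 * ‖x - x'‖ := (norm_add_le _ _).trans (add_le_add a1 a2)
    _ ≤ c / 2 * ‖(t, x) - (t', x')‖ + c / 2 * ‖(t, x) - (t', x')‖ := by
      gcongr
      · exact norm_fst_le ((t, x) - (t', x'))
      · exact norm_snd_le ((t, x) - (t', x'))
    _ = _ := by ring

end IsFlow

end Flows

section FlowDerivative

open Set Filter Topology Metric
open scoped NNReal

variable {E : Type*} [NormedAddCommGroup E] [NormedSpace ℝ E]

theorem norm_taylor_le {F : Type*} [NormedAddCommGroup F] [NormedSpace ℝ F] {v : E → F} {K : ℝ≥0}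
    (hd : Differentiable ℝ v) (hK : LipschitzWith K (fderiv ℝ v)) (a b : E) :
    ‖v b - v a - fderiv ℝ v a (b - a)‖ ≤ K * ‖b - a‖ ^ 2 := by
  have := (convex_closedBall a ‖b - a‖).norm_image_sub_le_of_norm_fderiv_le' (𝕜 := ℝ)
    (f := v) (φ := fderiv ℝ v a) (C := K * ‖b - a‖) (x := a) (y := b) (fun x _ => hd x)
    (fun x hx => (hK.norm_sub_le x a).trans (by
      gcongr; rw [mem_closedBall, dist_eq_norm] at hx; exact hx))
    (by simp) (by simp [dist_eq_norm])
  calc _ ≤ _ := this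
    _ = _ := by ring

/-- The flow of a `C²` field depends differentiably on the initial point for small times. -/
theorem IsFlow.exists_fderiv [CompleteSpace E] {v : E → E} {φ : ℝ → E → E} {K K' : ℝ≥0}
    (hφ : IsFlow v φ) (hK : LipschitzWith K v) (hd : Differentiable ℝ v)
    (hK' : LipschitzWith K' (fderiv ℝ v)) :
    ∃ (T : ℝ) (J : ℝ → E → E →L[ℝ] E), 0 < T ∧ T ≤ 1 ∧ K * T ≤ 1 / 4 ∧ ∀ t, |t| ≤ T →
      (∀ x, HasFDerivAt (φ t) (J t x) x ∧ ‖J t x - ContinuousLinearMap.id ℝ E‖ ≤ 2 * K * |t|) ∧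
      Continuous (J t) := by
  set A := fderiv ℝ v with hAdef
  have hA : ∀ x, ‖A x‖ ≤ K := fun x => norm_fderiv_le_of_lipschitz ℝ hK
  have hK0 : (0 : ℝ) ≤ K := K.2
  set T' : ℝ := 1 / (2 * (K + 1)) with hT'
  have hT'0 : 0 < T' := by positivity
  have hKT' : 2 * K * T' ≤ 1 := by
    rw [hT', mul_one_div, div_le_one (by positivity)]; linarith
  have hT'1 : T' ≤ 1 := by
    rw [hT', div_le_one (by positivity)]; linarith
  have h0 : (0 : ℝ) ∈ Icc (-T') T' := ⟨by linarith, hT'0.le⟩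
  have key : ∀ x, ∃ J : ℝ → E →L[ℝ] E, J 0 = ContinuousLinearMap.id ℝ E ∧
      ∀ t ∈ Icc (-T') T', HasDerivWithinAt J ((A (φ t x)).comp (J t)) (Icc (-T') T') t := by
    intro x
    have hpl : IsPicardLindelof (fun t M => (A (φ t x)).comp M) (⟨0, h0⟩ : Icc (-T') T')
        (ContinuousLinearMap.id ℝ E) 1 0 (2 * K) K :=
      { lipschitzOnWith := fun t _ => by
          refine LipschitzWith.lipschitzOnWith (LipschitzWith.of_dist_le_mul fun M M' => ?_)
          rw [dist_eq_norm, dist_eq_norm, ← ContinuousLinearMap.comp_sub]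
          exact (ContinuousLinearMap.opNorm_comp_le _ _).trans (by gcongr; exact hA _)
        continuousOn := fun M _ => by
          have h := hK'.continuous.comp (hφ.continuous_time x)
          exact (h.clm_comp continuous_const).continuousOn
        norm_le := fun t _ M hM => by
          have h1 : ‖M‖ ≤ 2 := by
            have h2 : ‖M - ContinuousLinearMap.id ℝ E‖ ≤ 1 := by
              simpa [dist_eq_norm] using hM
            have h3 := norm_le_norm_add_norm_sub' M (ContinuousLinearMap.id ℝ E)
            have h4 := ContinuousLinearMap.norm_id_le (𝕜 := ℝ) (E := E)
            linarith
          refine (ContinuousLinearMap.opNorm_comp_le _ _).trans ?_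
          have := mul_le_mul (hA (φ t x)) h1 (norm_nonneg _) hK0
          push_cast; linarith
        mul_max_le := by
          simpa using hKT' }
    exact hpl.exists_eq_forall_mem_Icc_hasDerivWithinAt₀
  choose J' hJ0 hJ' using key
  set T : ℝ := T' / 2 with hTdef
  have hTT : T < T' := by rw [hTdef]; linarith
  have hJ : ∀ x t, |t| ≤ T → HasDerivAt (J' x) ((A (φ t x)).comp (J' x t)) t := by
    intro x t ht
    have h1 := abs_le.1 ht
    exact (hJ' x t ⟨by linarith, by linarith⟩).hasDerivAt
      (Icc_mem_nhds (by linarith) (by linarith))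
  have hKT : K * T ≤ 1 / 4 := by rw [hTdef]; linarith
  have hexp : ∀ t, |t| ≤ T → Real.exp (K * |t|) ≤ 2 := by
    intro t ht
    have h1 : (K : ℝ) * |t| ≤ 1 / 4 := (mul_le_mul_of_nonneg_left ht hK0).trans hKT
    have h2 : Real.exp (K * |t|) ≤ Real.exp (1 / 4) := Real.exp_le_exp.2 h1
    have h3 := Real.add_one_le_exp (-(1 / 4) : ℝ)
    have h4 : Real.exp (-(1 / 4)) * Real.exp (1 / 4) = 1 := by rw [← Real.exp_add]; simp
    nlinarith [Real.exp_pos (1 / 4)]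
  have hnear : ∀ x t, |t| ≤ T → ‖J' x t - ContinuousLinearMap.id ℝ E‖ ≤ 2 * K * |t| := by
    intro x t ht
    have h := norm_le_of_deriv_bound (y := fun t => J' x t - ContinuousLinearMap.id ℝ E)
      (y' := fun t => (A (φ t x)).comp (J' x t)) (T := T) (K := K) (δ := 0) (ε := K)
      hK0 hK0 (fun s hs => (hJ x s hs).sub_const _) (by simp [hJ0])
      (fun s hs => by
        have e : (A (φ s x)).comp (J' x s) =
            (A (φ s x)).comp (J' x s - ContinuousLinearMap.id ℝ E) + A (φ s x) := by
          ext; simp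
        rw [e]
        refine (norm_add_le _ _).trans (add_le_add ?_ (hA _))
        exact (ContinuousLinearMap.opNorm_comp_le _ _).trans (by gcongr; exact hA _)) t ht
    have h2 := hexp t ht
    have : 0 ≤ (K : ℝ) * |t| := by positivity
    nlinarith
  have hJnorm : ∀ x t, |t| ≤ T → ‖J' x t‖ ≤ 2 := by
    intro x t ht
    have h1 := hnear x t ht
    have h2 := ContinuousLinearMap.norm_id_le (𝕜 := ℝ) (E := E)
    have h3 := norm_le_norm_add_norm_sub' (J' x t) (ContinuousLinearMap.id ℝ E)
    have h4 : (K : ℝ) * |t| ≤ 1 / 4 := (mul_le_mul_of_nonneg_left ht hK0).trans hKT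
    linarith
  refine ⟨T, fun t x => J' x t, by positivity, by rw [hTdef]; linarith, hKT, fun t ht => ⟨fun x => ⟨?_, hnear x t ht⟩, ?_⟩⟩
  · have hquad : ∀ z, ‖φ t z - φ t x - J' x t (z - x)‖ ≤ (8 * K' * T) * ‖z - x‖ ^ 2 := by
      intro z
      have h := norm_le_of_deriv_bound (y := fun t => φ t z - φ t x - J' x t (z - x))
        (y' := fun t => v (φ t z) - v (φ t x) - (A (φ t x)).comp (J' x t) (z - x)) (T := T)
        (K := K) (δ := 0) (ε := K' * (‖z - x‖ * 2) ^ 2) hK0 (by positivity)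
        (fun s hs => ((hφ.deriv z s).sub (hφ.deriv x s)).sub
          ((hJ x s hs).clm_apply (hasDerivAt_const s (z - x)) |>.congr_deriv (by simp)))
        (by simp [hJ0, hφ.zero])
        (fun s hs => by
          have e : v (φ s z) - v (φ s x) - (A (φ s x)).comp (J' x s) (z - x) =
              A (φ s x) (φ s z - φ s x - J' x s (z - x)) +
              (v (φ s z) - v (φ s x) - A (φ s x) (φ s z - φ s x)) := by
            simp only [ContinuousLinearMap.comp_apply, map_sub]; abel
          rw [e]
          refine (norm_add_le _ _).trans (add_le_add ?_ ?_)
          · exact ((A (φ s x)).le_opNorm _).trans (by gcongr; exact hA _)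
          · refine (norm_taylor_le hd hK' _ _).trans ?_
            gcongr
            exact (hφ.norm_sub_le hK s z x).trans (by gcongr; exact hexp s hs)) t ht
      refine h.trans ?_
      have h2 := hexp t ht
      rw [zero_add]
      calc _ ≤ K' * (‖z - x‖ * 2) ^ 2 * T * 2 := by gcongr
        _ = _ := by ring
    rw [hasFDerivAt_iff_isLittleO_nhds_zero, Asymptotics.isLittleO_iff]
    intro c hc
    have : Tendsto (fun h : E => (8 * K' * T) * ‖h‖) (𝓝 0) (𝓝 0) := by
      have : Continuous fun h : E => (8 * K' * T) * ‖h‖ := by fun_prop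
      simpa using this.tendsto 0
    filter_upwards [this.eventually (ge_mem_nhds hc)] with h hh
    have := hquad (x + h)
    rw [add_sub_cancel_left] at this
    refine this.trans ?_
    calc _ = (8 * K' * T * ‖h‖) * ‖h‖ := by ring
      _ ≤ _ := by gcongr
  · have hlip : ∀ x z, ‖J' x t - J' z t‖ ≤ (8 * K' * T) * ‖x - z‖ := by
      intro x z
      have h := norm_le_of_deriv_bound (y := fun t => J' x t - J' z t)
        (y' := fun t => (A (φ t x)).comp (J' x t) - (A (φ t z)).comp (J' z t)) (T := T)
        (K := K) (δ := 0) (ε := K' * (‖x - z‖ * 2) * 2) hK0 (by positivity)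
        (fun s hs => (hJ x s hs).sub (hJ z s hs)) (by simp [hJ0])
        (fun s hs => by
          have e : (A (φ s x)).comp (J' x s) - (A (φ s z)).comp (J' z s) =
              (A (φ s x)).comp (J' x s - J' z s) + (A (φ s x) - A (φ s z)).comp (J' z s) := by
            ext; simp
          rw [e]
          refine (norm_add_le _ _).trans (add_le_add ?_ ?_)
          · exact (ContinuousLinearMap.opNorm_comp_le _ _).trans (by gcongr; exact hA _)
          · refine (ContinuousLinearMap.opNorm_comp_le _ _).trans ?_
            gcongr
            · refine (hK'.norm_sub_le _ _).trans ?_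
              gcongr
              exact (hφ.norm_sub_le hK s x z).trans (by gcongr; exact hexp s hs)
            · exact hJnorm z s hs) t ht
      refine h.trans ?_
      have h2 := hexp t ht
      rw [zero_add]
      calc _ ≤ K' * (‖x - z‖ * 2) * 2 * T * 2 := by gcongr
        _ = _ := by ring
    have : LipschitzWith (Real.toNNReal (8 * K' * T)) (fun x => J' x t) :=
      LipschitzWith.of_dist_le_mul fun x z => by
        rw [dist_eq_norm, dist_eq_norm, Real.coe_toNNReal _ (by positivity)]
        exact hlip x z
    exact this.continuous

end FlowDerivative

section WeakLimits

open Set Filter Topology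

variable {H : Type*} [NormedAddCommGroup H] [InnerProductSpace ℝ H] [CompleteSpace H]

theorem exists_weak_subseq_limit [TopologicalSpace.SeparableSpace H] {y : ℕ → H} {C : ℝ}
    (hy : ∀ n, ‖y n‖ ≤ C) :
    ∃ (z : H) (k : ℕ → ℕ), StrictMono k ∧ ∀ q, Tendsto (fun n => ⟪y (k n), q⟫) atTop (𝓝 ⟪z, q⟫) := by
  obtain ⟨ℓ, -, k, hk, hlim⟩ := WeakDual.isSeqCompact_closedBall ℝ H 0 C
    (x := fun n => StrongDual.toWeakDual (InnerProductSpace.toDual ℝ H (y n)))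
    (fun n => by simpa using hy n)
  refine ⟨(InnerProductSpace.toDual ℝ H).symm (WeakDual.toStrongDual ℓ), k, hk, fun q => ?_⟩
  have := ((WeakDual.eval_continuous q).tendsto ℓ).comp hlim
  rw [InnerProductSpace.toDual_symm_apply]
  simpa [Function.comp_def] using! this

theorem mem_of_weak_limit {G : Submodule ℝ (H × H × H)} (hG : IsClosed (G : Set (H × H × H)))
    {x y z : ℕ → H} {x' y' z' : H} (h : ∀ n, (x n, y n, z n) ∈ G)
    (hx : ∀ q, Tendsto (fun n => ⟪x n, q⟫) atTop (𝓝 ⟪x', q⟫))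
    (hy : ∀ q, Tendsto (fun n => ⟪y n, q⟫) atTop (𝓝 ⟪y', q⟫))
    (hz : ∀ q, Tendsto (fun n => ⟪z n, q⟫) atTop (𝓝 ⟪z', q⟫)) : (x', y', z') ∈ G := by
  by_contra hmem
  obtain ⟨f, u, h1, h2⟩ := geometric_hahn_banach_point_closed G.convex hG hmem
  have key : ∀ g : StrongDual ℝ H, ∀ {x : ℕ → H} {x' : H},
      (∀ q, Tendsto (fun n => ⟪x n, q⟫) atTop (𝓝 ⟪x', q⟫)) →
      Tendsto (fun n => g (x n)) atTop (𝓝 (g x')) := by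
    intro g x x' hx
    have := hx ((InnerProductSpace.toDual ℝ H).symm g)
    have e : ∀ y, ⟪y, (InnerProductSpace.toDual ℝ H).symm g⟫ = g y := fun y => by
      rw [real_inner_comm, InnerProductSpace.toDual_symm_apply]
    simpa only [e] using this
  have e : ∀ a b c : H, f (a, b, c) = f.comp (.inl ℝ H (H × H)) a +
      (f.comp ((ContinuousLinearMap.inr ℝ H (H × H)).comp (.inl ℝ H H)) b +
      f.comp ((ContinuousLinearMap.inr ℝ H (H × H)).comp (.inr ℝ H H)) c) := by
    intro a b c
    simp [← map_add]
  have hlim : Tendsto (fun n => f (x n, y n, z n)) atTop (𝓝 (f (x', y', z'))) := by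
    simp only [e]
    exact (key _ hx).add ((key _ hy).add (key _ hz))
  have := ge_of_tendsto' hlim fun n => (h2 _ (h n)).le
  linarith

omit [CompleteSpace H] in
theorem Filter.Tendsto.weak {x : ℕ → H} {x' : H} (h : Tendsto x atTop (𝓝 x')) (q : H) :
    Tendsto (fun n => ⟪x n, q⟫) atTop (𝓝 ⟪x', q⟫) :=
  h.inner tendsto_const_nhds

end WeakLimits

section EllipticRegularity

open Set Filter Topology

variable {H : Type*} [NormedAddCommGroup H] [InnerProductSpace ℝ H]

/-- A family of operators `T h` behaving like translation by `h` in the direction of the first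
derivative of the closed graph `G`. -/
structure TranslationAlong (G : Submodule ℝ (H × H × H)) (r C : ℝ) (T : ℝ → H →L[ℝ] H) :
    Prop where
  r_pos : 0 < r
  C_nonneg : 0 ≤ C
  adjoint : ∀ h, |h| ≤ r → ∀ x y, |⟪T h x, y⟫ - ⟪x, T (-h) y⟫| ≤ C * |h| * ‖x‖ * ‖y‖
  mem : ∀ h, |h| ≤ r → ∀ w w1 w2, (w, w1, w2) ∈ G →
    ∃ z, (T h w, T h w1, z) ∈ G ∧ ‖z - T h w2‖ ≤ C * |h| * (‖w1‖ + ‖w2‖)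
  sub_le : ∀ h, |h| ≤ r → ∀ w w1 w2, (w, w1, w2) ∈ G → ‖T h w - w‖ ≤ C * |h| * ‖w1‖
  tendsto : ∀ w w1 w2, (w, w1, w2) ∈ G →
    Tendsto (fun h : ℝ => h⁻¹ • (T h w - w)) (𝓝[≠] 0) (𝓝 w1)

theorem TranslationAlong.exists_second [CompleteSpace H] [TopologicalSpace.SeparableSpace H]
    {G : Submodule ℝ (H × H × H)} {r C : ℝ} {T : ℝ → H →L[ℝ] H}
    (hT : TranslationAlong G r C T) (hG : IsClosed (G : Set (H × H × H)))
    {w w1 w2 g : H} (hw : (w, w1, w2) ∈ G)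
    (hE : ∀ v v1 v2, (v, v1, v2) ∈ G → ⟪w1, v1⟫ + ⟪w2, v2⟫ = ⟪g, v⟫) :
    ∃ y z, (w1, y, z) ∈ G := by
  have hC := hT.C_nonneg
  set M := ‖g‖ + 2 * ‖w1‖ + 4 * ‖w2‖ with hM
  have hM0 : 0 ≤ M := by positivity
  have key : ∀ h, 0 < h → h ≤ r → ∃ z, (T h w - w, T h w1 - w1, z) ∈ G ∧
      ‖T h w1 - w1‖ + ‖z‖ ≤ h * (2 * C * M) := by
    intro h h0 hr
    have ha : |h| = h := abs_of_pos h0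
    have hr1 : |h| ≤ r := by rwa [ha]
    have hr2 : |-h| ≤ r := by rwa [abs_neg]
    obtain ⟨z, hz, hzn⟩ := hT.mem h hr1 w w1 w2 hw
    have hv : (T h w - w, T h w1 - w1, z - w2) ∈ G := by simpa using G.sub_mem hz hw
    refine ⟨z - w2, hv, ?_⟩
    set v := T h w - w
    set v1 := T h w1 - w1 with hv1
    set v2 := z - w2 with hv2
    obtain ⟨y, hy, hyn⟩ := hT.mem (-h) hr2 v v1 v2 hv
    have s := hT.sub_le (-h) hr2 v v1 v2 hv
    have e1 := hE _ _ _ hy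
    have e2 := hE _ _ _ hv
    have a1 := hT.adjoint h hr1 w1 v1
    have a2 := hT.adjoint h hr1 w2 v2
    rw [abs_neg] at s hyn
    rw [ha] at s hyn hzn a1 a2
    have b1 := (abs_le.1 a1).2
    have b2 := (abs_le.1 a2).2
    have c1 : ⟪z, v2⟫ ≤ ⟪T h w2, v2⟫ + C * h * (‖w1‖ + ‖w2‖) * ‖v2‖ := by
      have : ⟪z, v2⟫ = ⟪T h w2, v2⟫ + ⟪z - T h w2, v2⟫ := by rw [inner_sub_left]; ring
      rw [this]
      gcongr
      exact (real_inner_le_norm _ _).trans (by gcongr)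
    have c2 : ⟪w2, T (-h) v2⟫ ≤ ⟪w2, y⟫ + ‖w2‖ * (C * h * (‖v1‖ + ‖v2‖)) := by
      have : ⟪w2, T (-h) v2⟫ = ⟪w2, y⟫ - ⟪w2, y - T (-h) v2⟫ := by rw [inner_sub_right]; ring
      have h3 := (abs_le.1 (abs_real_inner_le_norm w2 (y - T (-h) v2))).1
      have h4 : ‖w2‖ * ‖y - T (-h) v2‖ ≤ ‖w2‖ * (C * h * (‖v1‖ + ‖v2‖)) := by gcongr
      linarith
    have c3 : ⟪g, T (-h) v⟫ - ⟪g, v⟫ ≤ ‖g‖ * (C * h * ‖v1‖) := by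
      rw [← inner_sub_right]
      exact (real_inner_le_norm _ _).trans (by gcongr)
    have d1 : ‖v1‖ ^ 2 = ⟪T h w1, v1⟫ - ⟪w1, v1⟫ := by
      rw [← inner_sub_left, ← hv1, real_inner_self_eq_norm_sq]
    have d2 : ‖v2‖ ^ 2 = ⟪z, v2⟫ - ⟪w2, v2⟫ := by
      rw [← inner_sub_left, ← hv2, real_inner_self_eq_norm_sq]
    have tot : ‖v1‖ ^ 2 + ‖v2‖ ^ 2 ≤ C * h * M * (‖v1‖ + ‖v2‖) := by
      have n1 := norm_nonneg v1
      have n2 := norm_nonneg v2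
      have n3 : 0 ≤ C * h * (‖g‖ * ‖v2‖) := by positivity
      have n4 : 0 ≤ C * h * (‖w1‖ * ‖v1‖) := by positivity
      have n5 : 0 ≤ C * h * (‖w2‖ * ‖v1‖) := by positivity
      have n6 : 0 ≤ C * h * (‖w2‖ * ‖v2‖) := by positivity
      have n7 : 0 ≤ C * h * (‖w1‖ * ‖v2‖) := by positivity
      rw [hM]
      nlinarith
    have n1 := norm_nonneg v1
    have n2 := norm_nonneg v2
    by_contra hlt
    push Not at hlt
    have hpos : 0 < ‖v1‖ + ‖v2‖ := lt_of_le_of_lt (by positivity) hlt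
    nlinarith [sq_nonneg (‖v1‖ - ‖v2‖)]
  obtain ⟨N, hN⟩ := exists_nat_gt (1 / r)
  have hh : ∀ n : ℕ, 0 < (1 : ℝ) / (n + N + 1) ∧ (1 : ℝ) / (n + N + 1) ≤ r := by
    intro n
    refine ⟨by positivity, ?_⟩
    rw [div_le_iff₀ (by positivity)]
    rw [div_lt_iff₀ hT.r_pos] at hN
    nlinarith [hT.r_pos, (Nat.cast_nonneg n : (0 : ℝ) ≤ n)]
  choose z hz hzn using fun n => key _ (hh n).1 (hh n).2
  set h : ℕ → ℝ := fun n => (1 : ℝ) / (n + N + 1) with hhdef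
  have hlim : Tendsto h atTop (𝓝[≠] 0) := by
    refine tendsto_nhdsWithin_iff.2 ⟨?_, Eventually.of_forall fun n => (hh n).1.ne'⟩
    have := (tendsto_one_div_add_atTop_nhds_zero_nat (𝕜 := ℝ)).comp (tendsto_add_atTop_nat N)
    refine this.congr fun n => ?_
    simp [hhdef]
  have hx := (hT.tendsto w w1 w2 hw).comp hlim
  have bdd : ∀ n, ‖(h n)⁻¹ • (T (h n) w1 - w1)‖ ≤ 2 * C * M ∧ ‖(h n)⁻¹ • z n‖ ≤ 2 * C * M := by
    intro n
    have h0 := (hh n).1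
    have h1 := hzn n
    have n1 := norm_nonneg (T (h n) w1 - w1)
    have n2 := norm_nonneg (z n)
    simp only [norm_smul, norm_inv, Real.norm_eq_abs, abs_of_pos h0, hhdef]
    constructor <;> rw [inv_mul_le_iff₀ h0] <;> linarith
  obtain ⟨y', k, hk, hy'⟩ := exists_weak_subseq_limit fun n => (bdd n).1
  obtain ⟨z', l, hl, hz'⟩ := exists_weak_subseq_limit fun n => (bdd (k n)).2
  refine ⟨y', z', mem_of_weak_limit hG (fun n => ?_)
    (Tendsto.weak (hx.comp (hk.tendsto_atTop.comp hl.tendsto_atTop)))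
    (fun q => (hy' q).comp hl.tendsto_atTop) hz'⟩
  exact G.smul_mem (h (k (l n)))⁻¹ (hz (k (l n)))

/-- The functional-analytic data of a pair of first order operators `X, Y` on a Hilbert space,
with `X* = b - X`, `Y* = -a - Y` and `[X, Y] = a X + b Y`. -/
structure SobolevPair (H : Type*) [NormedAddCommGroup H] [InnerProductSpace ℝ H]
    (𝓐 : Type*) where
  G : Submodule ℝ (H × H × H)
  isClosed : IsClosed (G : Set (H × H × H))
  dense : Dense {w | ∃ w1 w2, (w, w1, w2) ∈ G}
  M : 𝓐 → H →L[ℝ] H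
  DX : 𝓐 → 𝓐
  DY : 𝓐 → 𝓐
  mul_mem : ∀ a w w1 w2, (w, w1, w2) ∈ G →
    (M a w, M a w1 + M (DX a) w, M a w2 + M (DY a) w) ∈ G
  one : H
  one_mem : (one, 0, 0) ∈ G
  a : 𝓐
  b : 𝓐
  ibpX : ∀ w w1 w2 v v1 v2, (w, w1, w2) ∈ G → (v, v1, v2) ∈ G →
    ⟪w1, v⟫ + ⟪w, v1⟫ = ⟪M b w, v⟫
  ibpY : ∀ w w1 w2 v v1 v2, (w, w1, w2) ∈ G → (v, v1, v2) ∈ G →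
    ⟪w2, v⟫ + ⟪w, v2⟫ = -⟪M a w, v⟫
  cross : ∀ w w1 w2 v v1 v2, (w, w1, w2) ∈ G → (v, v1, v2) ∈ G → ⟪w1, v2⟫ = ⟪w2, v1⟫

/-- Exchange the two components of the derivative in a closed graph. -/
def swapGraph (G : Submodule ℝ (H × H × H)) : Submodule ℝ (H × H × H) :=
  G.comap (LinearMap.id.prodMap (LinearEquiv.prodComm ℝ H H).toLinearMap)

theorem mem_swapGraph {G : Submodule ℝ (H × H × H)} {w w1 w2 : H} :
    (w, w1, w2) ∈ swapGraph G ↔ (w, w2, w1) ∈ G := Iff.rfl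

theorem isClosed_swapGraph {G : Submodule ℝ (H × H × H)} (hG : IsClosed (G : Set (H × H × H))) :
    IsClosed (swapGraph G : Set (H × H × H)) :=
  hG.preimage (f := fun q : H × H × H => (q.1, q.2.2, q.2.1)) (by fun_prop)

namespace SobolevPair

variable {𝓐 : Type*} (S : SobolevPair H 𝓐)

/-- Elements with `k` derivatives. -/
def Reg : ℕ → H → Prop
  | 0, _ => True
  | k + 1, w => ∃ w1 w2, (w, w1, w2) ∈ S.G ∧ Reg k w1 ∧ Reg k w2

variable {S}

theorem Reg.of_succ : ∀ {k : ℕ} {w : H}, S.Reg (k + 1) w → S.Reg k w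
  | 0, _, _ => trivial
  | _ + 1, _, ⟨w1, w2, h, h1, h2⟩ => ⟨w1, w2, h, Reg.of_succ h1, Reg.of_succ h2⟩

theorem Reg.add : ∀ {k : ℕ} {w v : H}, S.Reg k w → S.Reg k v → S.Reg k (w + v)
  | 0, _, _, _, _ => trivial
  | _ + 1, _, _, ⟨_, _, h, h1, h2⟩, ⟨_, _, h', h1', h2'⟩ =>
    ⟨_, _, S.G.add_mem h h', Reg.add h1 h1', Reg.add h2 h2'⟩

theorem Reg.neg : ∀ {k : ℕ} {w : H}, S.Reg k w → S.Reg k (-w)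
  | 0, _, _ => trivial
  | _ + 1, _, ⟨_, _, h, h1, h2⟩ => ⟨_, _, S.G.neg_mem h, Reg.neg h1, Reg.neg h2⟩

theorem Reg.sub {k : ℕ} {w v : H} (hw : S.Reg k w) (hv : S.Reg k v) : S.Reg k (w - v) := by
  rw [sub_eq_add_neg]; exact hw.add hv.neg

theorem Reg.mul : ∀ {k : ℕ} (a : 𝓐) {w : H}, S.Reg k w → S.Reg k (S.M a w)
  | 0, _, _, _ => trivial
  | _ + 1, a, _, ⟨w1, w2, h, h1, h2⟩ =>
    ⟨_, _, S.mul_mem a _ _ _ h,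
      (Reg.mul a h1).add (Reg.mul (S.DX a) (Reg.of_succ ⟨w1, w2, h, h1, h2⟩)),
      (Reg.mul a h2).add (Reg.mul (S.DY a) (Reg.of_succ ⟨w1, w2, h, h1, h2⟩))⟩

/-- `w` is a weak solution of `X*X w + Y*Y w = g`. -/
def Weak (S : SobolevPair H 𝓐) (w1 w2 g : H) : Prop :=
  ∀ v v1 v2, (v, v1, v2) ∈ S.G → ⟪w1, v1⟫ + ⟪w2, v2⟫ = ⟪g, v⟫

theorem eq_of_inner_graph {x y : H}
    (h : ∀ v v1 v2, (v, v1, v2) ∈ S.G → ⟪x, v⟫ = ⟪y, v⟫) : x = y :=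
  S.dense.eq_of_inner_left (𝕜 := ℝ) fun v ⟨v1, v2, hv⟩ => h v v1 v2 hv

theorem fst_unique {w w1 w2 w1' w2' : H} (h : (w, w1, w2) ∈ S.G) (h' : (w, w1', w2') ∈ S.G) :
    w1 = w1' ∧ w2 = w2' := by
  constructor
  · refine eq_of_inner_graph (S := S) fun v v1 v2 hv => ?_
    linarith [S.ibpX _ _ _ _ _ _ h hv, S.ibpX _ _ _ _ _ _ h' hv]
  · refine eq_of_inner_graph (S := S) fun v v1 v2 hv => ?_
    linarith [S.ibpY _ _ _ _ _ _ h hv, S.ibpY _ _ _ _ _ _ h' hv]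

theorem bracket {w w1 w2 w11 w12 w21 w22 : H} (h : (w, w1, w2) ∈ S.G)
    (h1 : (w1, w11, w12) ∈ S.G) (h2 : (w2, w21, w22) ∈ S.G) :
    w21 = w12 + S.M S.a w1 + S.M S.b w2 := by
  refine eq_of_inner_graph (S := S) fun v v1 v2 hv => ?_
  rw [inner_add_left, inner_add_left]
  linarith [S.ibpY _ _ _ _ _ _ h1 hv, S.ibpX _ _ _ _ _ _ h2 hv, S.cross _ _ _ _ _ _ h hv]

theorem Weak.strong {w1 w2 w11 w12 w21 w22 g : H} (hw : S.Weak w1 w2 g)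
    (h1 : (w1, w11, w12) ∈ S.G) (h2 : (w2, w21, w22) ∈ S.G) :
    w11 + w22 = S.M S.b w1 - S.M S.a w2 - g := by
  refine eq_of_inner_graph (S := S) fun v v1 v2 hv => ?_
  rw [inner_add_left, inner_sub_left, inner_sub_left]
  linarith [S.ibpX _ _ _ _ _ _ h1 hv, S.ibpY _ _ _ _ _ _ h2 hv, hw _ _ _ hv]

variable [CompleteSpace H] [TopologicalSpace.SeparableSpace H]

theorem Weak.reg {r C r' C' : ℝ} {T T' : ℝ → H →L[ℝ] H} (hT : TranslationAlong S.G r C T)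
    (hT' : TranslationAlong (swapGraph S.G) r' C' T') :
    ∀ (k : ℕ) {w w1 w2 g : H}, (w, w1, w2) ∈ S.G → S.Weak w1 w2 g → S.Reg k g →
      S.Reg (k + 2) w := by
  have base : ∀ {w w1 w2 g : H}, (w, w1, w2) ∈ S.G → S.Weak w1 w2 g →
      (∃ y z, (w1, y, z) ∈ S.G) ∧ ∃ y z, (w2, y, z) ∈ S.G := by
    intro w w1 w2 g h hw
    refine ⟨hT.exists_second S.isClosed h hw, ?_⟩
    obtain ⟨y, z, hyz⟩ := hT'.exists_second (isClosed_swapGraph S.isClosed) (g := g)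
      (mem_swapGraph.2 h) (fun v v1 v2 hv => by rw [add_comm]; exact hw _ _ _ hv)
    exact ⟨z, y, hyz⟩
  intro k
  induction k with
  | zero =>
    intro w w1 w2 g h hw _
    obtain ⟨⟨y, z, hyz⟩, ⟨y', z', hyz'⟩⟩ := base h hw
    exact ⟨w1, w2, h, ⟨y, z, hyz, trivial, trivial⟩, ⟨y', z', hyz', trivial, trivial⟩⟩
  | succ k ih =>
    intro w w1 w2 g h hw hg
    have hwk := ih h hw hg.of_succ
    obtain ⟨v1, v2, h', r1, r2⟩ := hwk
    obtain ⟨rfl, rfl⟩ := fst_unique h h'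
    obtain ⟨⟨w11, w12, h1⟩, ⟨w21, w22, h2⟩⟩ := base h hw
    have hbr := bracket h h1 h2
    have hst := Weak.strong hw h1 h2
    set f := S.M S.b w1 - S.M S.a w2 - g with hf
    set e := S.M S.a w1 + S.M S.b w2 with he
    obtain ⟨f1, f2, hfG, rf1, rf2⟩ : S.Reg (k + 1) f := ((r1.mul _).sub (r2.mul _)).sub hg
    obtain ⟨e1, e2, heG, re1, re2⟩ : S.Reg (k + 1) e := (r1.mul _).add (r2.mul _)
    have rf : S.Reg k f := Reg.of_succ ⟨f1, f2, hfG, rf1, rf2⟩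
    have re : S.Reg k e := Reg.of_succ ⟨e1, e2, heG, re1, re2⟩
    have s1 : ∀ v, ⟪w21, v⟫ = ⟪w12, v⟫ + ⟪e, v⟫ := fun v => by
      rw [hbr, he, add_assoc, inner_add_left]
    have s2 : ∀ v, ⟪w11, v⟫ + ⟪w22, v⟫ = ⟪f, v⟫ := fun v => by rw [← hst, inner_add_left]
    have hw1 : S.Weak w11 w12 ((S.M S.b f - f1) + (S.M S.a e + e2)) := by
      intro v v1 v2 hv
      rw [inner_add_left, inner_add_left, inner_sub_left]
      linarith [S.ibpX _ _ _ _ _ _ hfG hv, S.ibpY _ _ _ _ _ _ heG hv,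
        S.cross _ _ _ _ _ _ h2 hv, s1 v2, s2 v1]
    have hw2 : S.Weak w21 w22 ((S.M S.b e - e1) - (S.M S.a f + f2)) := by
      intro v v1 v2 hv
      rw [inner_sub_left, inner_add_left, inner_sub_left]
      linarith [S.ibpX _ _ _ _ _ _ heG hv, S.ibpY _ _ _ _ _ _ hfG hv,
        S.cross _ _ _ _ _ _ h1 hv, s1 v1, s2 v2]
    exact ⟨w1, w2, h,
      ih h1 hw1 (((rf.mul _).sub rf1).add ((re.mul _).add re2)),
      ih h2 hw2 (((re.mul _).sub re1).sub ((rf.mul _).add rf2))⟩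

/-- Poincaré inequality from compactness of a regularizing operator. -/
theorem poincare {Q : H →L[ℝ] H} {C : ℝ}
    (hker : ∀ w, (w, 0, 0) ∈ S.G → ⟪w, S.one⟫ = 0 → w = 0)
    (hQ : ∀ w w1 w2, (w, w1, w2) ∈ S.G → ‖w - Q w‖ ≤ C * (‖w1‖ + ‖w2‖))
    (hcomp : ∀ x : ℕ → H, (∀ n, ‖x n‖ ≤ 1) →
      (∀ q, Tendsto (fun n => ⟪x n, q⟫) atTop (𝓝 0)) → Tendsto (fun n => Q (x n)) atTop (𝓝 0)) :
    ∃ D, ∀ w w1 w2, (w, w1, w2) ∈ S.G → ⟪w, S.one⟫ = 0 → ‖w‖ ≤ D * (‖w1‖ + ‖w2‖) := by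
  by_contra hcon
  push Not at hcon
  choose w w1 w2 hw hmean hlt using fun n : ℕ => hcon n
  have hpos : ∀ n, 0 < ‖w n‖ := fun n => lt_of_le_of_lt (by positivity) (hlt n)
  set x : ℕ → H := fun n => ‖w n‖⁻¹ • w n with hx
  set x1 : ℕ → H := fun n => ‖w n‖⁻¹ • w1 n with hx1
  set x2 : ℕ → H := fun n => ‖w n‖⁻¹ • w2 n with hx2
  have hxn : ∀ n, ‖x n‖ = 1 := fun n => by
    simp [hx, norm_smul, (hpos n).ne']
  have hxG : ∀ n, (x n, x1 n, x2 n) ∈ S.G := fun n => by simpa using! S.G.smul_mem ‖w n‖⁻¹ (hw n)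
  have hD : ∀ n : ℕ, n * (‖x1 n‖ + ‖x2 n‖) ≤ 1 := by
    intro n
    simp only [hx1, hx2, norm_smul, norm_inv, norm_norm]
    have := (hlt n).le
    rw [← mul_add, ← mul_assoc, mul_comm (n : ℝ), mul_assoc, inv_mul_le_iff₀ (hpos n)]
    linarith
  have hsum : Tendsto (fun n => ‖x1 n‖ + ‖x2 n‖) atTop (𝓝 0) := by
    refine squeeze_zero' (Eventually.of_forall fun n => by positivity) ?_
      (tendsto_one_div_atTop_nhds_zero_nat (𝕜 := ℝ))
    filter_upwards [eventually_gt_atTop 0] with n hn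
    have hn' : (0 : ℝ) < n := by exact_mod_cast hn
    rw [le_div_iff₀ hn']
    linarith [hD n]
  have h1 : Tendsto x1 atTop (𝓝 0) := squeeze_zero_norm (fun n => by
    linarith [norm_nonneg (x2 n)]) hsum
  have h2 : Tendsto x2 atTop (𝓝 0) := squeeze_zero_norm (fun n => by
    linarith [norm_nonneg (x1 n)]) hsum
  obtain ⟨z, k, hk, hz⟩ := exists_weak_subseq_limit (C := 1) fun n => (hxn n).le
  have hzG : (z, 0, 0) ∈ S.G := mem_of_weak_limit S.isClosed (fun n => hxG (k n)) hz
    (Tendsto.weak (h1.comp hk.tendsto_atTop)) (Tendsto.weak (h2.comp hk.tendsto_atTop))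
  have hz0 : z = 0 := by
    refine hker z hzG (tendsto_nhds_unique (hz S.one) ?_)
    have : ∀ n, ⟪x (k n), S.one⟫ = 0 := fun n => by simp [hx, inner_smul_left, hmean]
    simp [this]
  subst hz0
  have hQ0 := hcomp (fun n => x (k n)) (fun n => (hxn _).le) (by simpa using hz)
  have hdiff : Tendsto (fun n => x (k n) - Q (x (k n))) atTop (𝓝 0) :=
    squeeze_zero_norm (fun n => hQ _ _ _ (hxG (k n))) (by
      simpa using (hsum.comp hk.tendsto_atTop).const_mul C)
  have hlim : Tendsto (fun n => x (k n)) atTop (𝓝 0) := by simpa using hdiff.add hQ0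
  have := hlim.norm
  simp [hxn] at this

omit [TopologicalSpace.SeparableSpace H] in
/-- Solvability of the weak Poisson equation, given the Poincaré inequality. -/
theorem exists_weak_solution {D : ℝ}
    (hP : ∀ w w1 w2, (w, w1, w2) ∈ S.G → ⟪w, S.one⟫ = 0 → ‖w‖ ≤ D * (‖w1‖ + ‖w2‖)) (f e : H) :
    ∃ u u1 u2, (u, u1, u2) ∈ S.G ∧
      ∀ v v1 v2, (v, v1, v2) ∈ S.G → ⟪u1, v1⟫ + ⟪u2, v2⟫ = ⟪f, v1⟫ + ⟪e, v2⟫ := by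
  set L : WithLp 2 (H × H) ≃L[ℝ] H × H := WithLp.prodContinuousLinearEquiv 2 ℝ H H
  set V : Submodule ℝ (H × H) := S.G.map (LinearMap.snd ℝ H (H × H))
  set W : Submodule ℝ (WithLp 2 (H × H)) := V.comap L.toLinearEquiv.toLinearMap
  have normalize : ∀ q ∈ V, ∃ w, (w, q) ∈ S.G ∧ ⟪w, S.one⟫ = 0 := by
    rintro q ⟨⟨w, q'⟩, h, rfl⟩
    refine ⟨w - (⟪w, S.one⟫ / ⟪S.one, S.one⟫) • S.one, ?_, ?_⟩
    · have := S.G.sub_mem h (S.G.smul_mem (⟪w, S.one⟫ / ⟪S.one, S.one⟫) S.one_mem)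
      rwa [Prod.smul_mk, Prod.mk_zero_zero, smul_zero, Prod.mk_sub_mk, sub_zero] at this
    · rw [inner_sub_left, inner_smul_left]
      by_cases h0 : S.one = 0
      · simp [h0]
      · have : ⟪S.one, S.one⟫ ≠ 0 := inner_self_ne_zero.2 h0
        rw [RCLike.conj_to_real, div_mul_cancel₀ _ this, sub_self]
  have hVc : IsClosed (V : Set (H × H)) := by
    refine IsSeqClosed.isClosed fun q q' hq hlim => ?_
    choose w hw hm using fun n => normalize (q n) (hq n)
    have hcau : CauchySeq w := by
      have hqc := hlim.cauchySeq
      have hD0 : (0 : ℝ) ≤ |D| := abs_nonneg D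
      rw [Metric.cauchySeq_iff] at hqc ⊢
      intro ε hε
      obtain ⟨N, hN⟩ := hqc (ε / (2 * |D| + 1)) (by positivity)
      refine ⟨N, fun m hmN n hn => ?_⟩
      have h1 := hN m hmN n hn
      rw [dist_eq_norm] at h1 ⊢
      have h2 := hP (w m - w n) (q m - q n).1 (q m - q n).2
        (by simpa using! S.G.sub_mem (hw m) (hw n)) (by rw [inner_sub_left, hm, hm, sub_zero])
      have h3 := norm_fst_le (q m - q n)
      have h4 := norm_snd_le (q m - q n)
      rw [lt_div_iff₀ (by positivity)] at h1
      have h5 : D * (‖(q m - q n).1‖ + ‖(q m - q n).2‖) ≤ |D| * (2 * ‖q m - q n‖) := by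
        refine mul_le_mul (le_abs_self D) (by linarith) (by positivity) hD0
      rcases (norm_nonneg (q m - q n)).eq_or_lt with h6 | h6
      · rw [← h6] at h5
        linarith
      · nlinarith
    obtain ⟨w', hw'⟩ := cauchySeq_tendsto_of_complete hcau
    exact ⟨(w', q'), S.isClosed.mem_of_tendsto (hw'.prodMk_nhds hlim)
      (Eventually.of_forall hw), rfl⟩
  have hWc : IsClosed (W : Set (WithLp 2 (H × H))) := hVc.preimage L.continuous
  have : CompleteSpace W := hWc.completeSpace_coe
  set y : WithLp 2 (H × H) := L.symm (f, e)
  obtain ⟨⟨u, u1, u2⟩, huG, hu⟩ := (W.orthogonalProjectionOnto y).2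
  refine ⟨u, u1, u2, huG, fun v v1 v2 hv => ?_⟩
  have := W.starProjection_inner_eq_zero y (L.symm (v1, v2)) ⟨(v, v1, v2), hv, by simp⟩
  rw [inner_sub_left, sub_eq_zero, WithLp.prod_inner_apply, WithLp.prod_inner_apply] at this
  have e1 : WithLp.ofLp (W.starProjection y) = (u1, u2) := hu.symm
  rw [e1] at this
  exact this.symm

end SobolevPair

end EllipticRegularity

section Geometry

open Set Filter Topology

theorem inner_eq_sum3 (u v : R3) : ⟪u, v⟫ = u 0 * v 0 + u 1 * v 1 + u 2 * v 2 := by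
  simp [PiLp.inner_apply, Fin.sum_univ_three, mul_comm]

@[simp] theorem cross3_apply_zero (u v : R3) : cross3 u v 0 = u 1 * v 2 - u 2 * v 1 := rfl
@[simp] theorem cross3_apply_one (u v : R3) : cross3 u v 1 = u 2 * v 0 - u 0 * v 2 := rfl
@[simp] theorem cross3_apply_two (u v : R3) : cross3 u v 2 = u 0 * v 1 - u 1 * v 0 := rfl

theorem ext3 {u v : R3} (h0 : u 0 = v 0) (h1 : u 1 = v 1) (h2 : u 2 = v 2) : u = v := by
  ext i; fin_cases i <;> assumption

/-- Divergence in coordinates. -/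
def dv (v : R3 → R3) (z : R3) : ℝ := ∑ i, fderiv ℝ v z (e3 i) i

/-- A pair of compactly supported fields tangent to the level sets of `q`, which frame the
level sets in the open set `O`. -/
structure LevelFrame where
  q : R3 → ℝ
  X : R3 → R3
  Y : R3 → R3
  O : Set R3
  isOpen_O : IsOpen O
  smooth_q : ContDiff ℝ (⊤ : ℕ∞) q
  smooth_X : ContDiff ℝ (⊤ : ℕ∞) X
  smooth_Y : ContDiff ℝ (⊤ : ℕ∞) Y
  cs_X : HasCompactSupport X
  cs_Y : HasCompactSupport Y
  dqX : ∀ z, fderiv ℝ q z (X z) = 0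
  dqY : ∀ z, fderiv ℝ q z (Y z) = 0
  dq : ∀ z ∈ O, ∀ v, fderiv ℝ q z v = ⟪cross3 (X z) (Y z), v⟫
  dq_ne : ∀ z ∈ O, cross3 (X z) (Y z) ≠ 0

theorem sum_coord_smul (u : R3) : u = u 0 • e3 0 + u 1 • e3 1 + u 2 • e3 2 := by
  refine ext3 ?_ ?_ ?_ <;> simp [e3]

theorem map_eq_sum3 (L : R3 →L[ℝ] R3) (u : R3) (i : Fin 3) :
    L u i = u 0 * L (e3 0) i + u 1 * L (e3 1) i + u 2 * L (e3 2) i := by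
  conv_lhs => rw [sum_coord_smul u]
  simp

theorem contDiff_coord {n : WithTop ℕ∞} (i : Fin 3) : ContDiff ℝ n (fun z : R3 => z i) := by
  fun_prop

theorem hasFDerivAt_coord {v : R3 → R3} {z : R3} (hv : DifferentiableAt ℝ v z) (i : Fin 3) :
    HasFDerivAt (fun z => v z i) ((EuclideanSpace.proj (𝕜 := ℝ) i).comp (fderiv ℝ v z)) z :=
  (EuclideanSpace.proj (𝕜 := ℝ) (ι := Fin 3) i).hasFDerivAt.comp z hv.hasFDerivAt

namespace LevelFrame

variable (S : LevelFrame)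

theorem bracket {z : R3} (hz : z ∈ S.O) :
    fderiv ℝ S.Y z (S.X z) - fderiv ℝ S.X z (S.Y z) = dv S.Y z • S.X z - dv S.X z • S.Y z := by
  have hX : DifferentiableAt ℝ S.X z := (S.smooth_X.differentiable (by simp)) z
  have hY : DifferentiableAt ℝ S.Y z := (S.smooth_Y.differentiable (by simp)) z
  have hsym : ∀ v w, fderiv ℝ (fderiv ℝ S.q) z v w = fderiv ℝ (fderiv ℝ S.q) z w v :=
    fun v w => (S.smooth_q.contDiffAt.isSymmSndFDerivAt
      (by simp only [minSmoothness_of_isRCLikeNormedField]; exact WithTop.coe_le_coe.2 le_top)).eq v w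
  have hd : DifferentiableAt ℝ (fderiv ℝ S.q) z :=
    ((S.smooth_q.fderiv_right (m := 1) (WithTop.coe_le_coe.2 le_top)).differentiable (by simp)) z
  have key : ∀ v w, fderiv ℝ (fderiv ℝ S.q) z v w =
      ⟪cross3 (fderiv ℝ S.X z v) (S.Y z) + cross3 (S.X z) (fderiv ℝ S.Y z v), w⟫ := by
    intro v w
    have h1 : HasFDerivAt (fun y => fderiv ℝ S.q y w)
        ((ContinuousLinearMap.apply ℝ ℝ w).comp (fderiv ℝ (fderiv ℝ S.q) z)) z :=
      (ContinuousLinearMap.apply ℝ ℝ w).hasFDerivAt.comp z hd.hasFDerivAt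
    have c := fun i => hasFDerivAt_coord hX i
    have d := fun i => hasFDerivAt_coord hY i
    have h2 := (((((c 1).mul (d 2)).sub ((c 2).mul (d 1))).mul_const (w 0)).add
      ((((c 2).mul (d 0)).sub ((c 0).mul (d 2))).mul_const (w 1))).add
      ((((c 0).mul (d 1)).sub ((c 1).mul (d 0))).mul_const (w 2))
    have h3 := h2.congr_of_eventuallyEq (f₁ := fun y => fderiv ℝ S.q y w) (by
      filter_upwards [S.isOpen_O.mem_nhds hz] with y hy
      rw [S.dq y hy, inner_eq_sum3]
      simp)
    have := congrArg (fun L : R3 →L[ℝ] ℝ => L v) (h1.unique h3)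
    simp only [ContinuousLinearMap.comp_apply, ContinuousLinearMap.apply_apply] at this
    rw [this, inner_eq_sum3]
    simp
    ring
  have s01 := hsym (e3 0) (e3 1)
  have s02 := hsym (e3 0) (e3 2)
  have s12 := hsym (e3 1) (e3 2)
  simp only [key, inner_eq_sum3] at s01 s02 s12
  simp [e3] at s01 s02 s12
  refine ext3 ?_ ?_ ?_
  all_goals
    simp only [PiLp.sub_apply, PiLp.smul_apply, smul_eq_mul, dv, Fin.sum_univ_three]
    rw [map_eq_sum3 _ (S.X z), map_eq_sum3 _ (S.Y z)]
    simp only [e3]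
  · linear_combination -s12
  · linear_combination s02
  · linear_combination -s01

end LevelFrame

theorem ContDiffOn.contDiff_smul_of_tsupport {E F : Type*} [NormedAddCommGroup E] [NormedSpace ℝ E]
    [NormedAddCommGroup F] [NormedSpace ℝ F] {n : WithTop ℕ∞} {η : E → ℝ} {f : E → F} {W : Set E}
    (hf : ContDiffOn ℝ n f W) (hη : ContDiff ℝ n η) (hW : IsOpen W) (hs : tsupport η ⊆ W) :
    ContDiff ℝ n (fun z => η z • f z) := by
  rw [contDiff_iff_contDiffAt]
  intro z
  by_cases hz : z ∈ tsupport η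
  · exact hη.contDiffAt.smul (hf.contDiffAt (hW.mem_nhds (hs hz)))
  · refine (contDiffAt_const (c := (0 : F))).congr_of_eventuallyEq ?_
    filter_upwards [(isClosed_tsupport η).isOpen_compl.mem_nhds hz] with y hy
    rw [image_eq_zero_of_notMem_tsupport hy, zero_smul]

theorem exists_cutoff {Λ W : Set R3} (hΛ : IsCompact Λ) (hW : IsOpen W) (h : Λ ⊆ W) :
    ∃ (η : R3 → ℝ) (O : Set R3), ContDiff ℝ (⊤ : ℕ∞) η ∧ HasCompactSupport η ∧ tsupport η ⊆ W ∧
      IsOpen O ∧ Λ ⊆ O ∧ O ⊆ W ∧ ∀ z ∈ O, η z = 1 := by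
  obtain ⟨K, hK, h1, h2⟩ := exists_compact_between hΛ hW h
  obtain ⟨f, hf1, hf0, -⟩ := exists_contMDiffMap_one_nhds_of_subset_interior
    (n := (⊤ : ℕ∞)) (modelWithCornersSelf ℝ R3) hΛ.isClosed h1
  have hts : tsupport f ⊆ K := closure_minimal (fun z hz => by
    by_contra hzK
    exact hz (hf0 z hzK)) hK.isClosed
  obtain ⟨O, hO, hΛO, hO1⟩ := mem_nhdsSet_iff_exists.1 hf1
  exact ⟨f, O ∩ W, f.contMDiff.contDiff, hK.of_isClosed_subset (isClosed_tsupport _) hts,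
    hts.trans h2, hO.inter hW, subset_inter hΛO h, inter_subset_right, fun z hz => hO1 hz.1⟩

theorem contDiff_cross3 {E : Type*} [NormedAddCommGroup E] [NormedSpace ℝ E] {n : WithTop ℕ∞}
    {u v : E → R3} {s : Set E} (hu : ContDiffOn ℝ n u s) (hv : ContDiffOn ℝ n v s) :
    ContDiffOn ℝ n (fun z => cross3 (u z) (v z)) s := by
  rw [contDiffOn_euclidean] at hu hv ⊢
  intro i
  fin_cases i
  · exact ((hu 1).mul (hv 2)).sub ((hu 2).mul (hv 1))
  · exact ((hu 2).mul (hv 0)).sub ((hu 0).mul (hv 2))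
  · exact ((hu 0).mul (hv 1)).sub ((hu 1).mul (hv 0))

/-- A nonvanishing tangent field along a compact regular piece of a level set gives a frame. -/
theorem exists_levelFrame {U : Set R3} (hU : IsOpen U) {p : R3 → ℝ}
    (hp : ContDiffOn ℝ (⊤ : ℕ∞) p U) (c : ℝ) {Λ : Set R3} (hΛU : Λ ⊆ U) (hΛ : IsCompact Λ)
    (hreg : ∀ z ∈ Λ, gradient p z ≠ 0) {B : R3 → R3} (hB : ContDiffOn ℝ (⊤ : ℕ∞) B U)
    (hBne : ∀ z ∈ Λ, B z ≠ 0) (htan : ∀ z ∈ Λ, ⟪B z, gradient p z⟫ = 0) :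
    ∃ S : LevelFrame, Λ ⊆ S.O ∧ S.O ⊆ U ∧ ∀ z ∈ S.O, S.q z = p z - c := by
  set g : R3 → R3 := gradient p with hg
  have hgs : ContDiffOn ℝ (⊤ : ℕ∞) g U :=
    (InnerProductSpace.toDual ℝ R3).symm.contDiff.comp_contDiffOn
      (hp.fderiv_of_isOpen hU (by simp))
  have hgd : ∀ z v, fderiv ℝ p z v = ⟪g z, v⟫ := fun z v => by
    simp [hg, gradient]
  set W1 : Set R3 := U ∩ g ⁻¹' {0}ᶜ
  have hW1 : IsOpen W1 := hgs.continuousOn.isOpen_inter_preimage hU isOpen_compl_singleton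
  set X0 : R3 → R3 := fun z => B z - (⟪B z, g z⟫ / ⟪g z, g z⟫) • g z with hX0
  have hX0s : ContDiffOn ℝ (⊤ : ℕ∞) X0 W1 := by
    have hB' := hB.mono (inter_subset_left : W1 ⊆ U)
    have hg' := hgs.mono (inter_subset_left : W1 ⊆ U)
    exact hB'.sub (((hB'.inner ℝ hg').div (hg'.inner ℝ hg')
      fun z hz => inner_self_ne_zero.2 hz.2).smul hg')
  set W : Set R3 := W1 ∩ X0 ⁻¹' {0}ᶜ
  have hW : IsOpen W := hX0s.continuousOn.isOpen_inter_preimage hW1 isOpen_compl_singleton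
  have hX0s' := hX0s.mono (inter_subset_left : W ⊆ W1)
  have hWU : W ⊆ U := inter_subset_left.trans inter_subset_left
  set Y0 : R3 → R3 := fun z => (⟪X0 z, X0 z⟫)⁻¹ • cross3 (g z) (X0 z) with hY0
  have hY0s : ContDiffOn ℝ (⊤ : ℕ∞) Y0 W :=
    ((hX0s'.inner ℝ hX0s').inv fun z hz => inner_self_ne_zero.2 hz.2).smul
      (contDiff_cross3 (hgs.mono hWU) hX0s')
  have hΛW : Λ ⊆ W := fun z hz => ⟨⟨hΛU hz, hreg z hz⟩, by
    have := hBne z hz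
    simp only [hX0, mem_preimage, mem_compl_iff, mem_singleton_iff, htan z hz, zero_div, zero_smul,
      sub_zero, this, not_false_eq_true]⟩
  have hgX : ∀ z ∈ W, ⟪g z, X0 z⟫ = 0 := fun z hz => by
    have : ⟪g z, g z⟫ ≠ 0 := inner_self_ne_zero.2 hz.1.2
    simp only [hX0]
    rw [inner_sub_right, inner_smul_right, div_mul_cancel₀ _ this, real_inner_comm, sub_self]
  have hgY : ∀ z, ⟪g z, Y0 z⟫ = 0 := fun z => by
    simp only [hY0]
    rw [inner_smul_right, inner_eq_sum3 (g z)]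
    simp only [cross3_apply_zero, cross3_apply_one, cross3_apply_two]
    ring
  have hcross : ∀ z ∈ W, cross3 (X0 z) (Y0 z) = g z := fun z hz => by
    have h1 : ⟪X0 z, X0 z⟫ ≠ 0 := inner_self_ne_zero.2 hz.2
    have h2 := hgX z hz
    have h3 := inner_eq_sum3 (X0 z) (X0 z)
    simp only [hY0]
    rw [inner_eq_sum3] at h2
    generalize ⟪X0 z, X0 z⟫ = N at h1 h3
    refine ext3 ?_ ?_ ?_
    all_goals
      simp only [cross3_apply_zero, cross3_apply_one, cross3_apply_two, PiLp.smul_apply,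
        smul_eq_mul]
      field_simp
    · linear_combination -(X0 z 0) * h2 - g z 0 * h3
    · linear_combination -(X0 z 1) * h2 - g z 1 * h3
    · linear_combination -(X0 z 2) * h2 - g z 2 * h3
  obtain ⟨η₂, O₂, s₂, -, t₂, o₂, l₂, w₂, e₂⟩ := exists_cutoff hΛ hW hΛW
  obtain ⟨η₁, O₁, s₁, c₁, t₁, o₁, l₁, w₁, e₁⟩ := exists_cutoff hΛ o₂ l₂
  have hq : ∀ z ∈ O₂, fderiv ℝ (fun z => η₂ z • (p z - c)) z = fderiv ℝ p z := fun z hz => by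
    have : (fun z => η₂ z • (p z - c)) =ᶠ[𝓝 z] fun z => p z - c := by
      filter_upwards [o₂.mem_nhds hz] with y hy
      rw [e₂ y hy, one_smul]
    rw [this.fderiv_eq, fderiv_sub_const]
  have hO₁W : O₁ ⊆ W := w₁.trans w₂
  refine ⟨⟨fun z => η₂ z • (p z - c), fun z => η₁ z • X0 z, fun z => η₁ z • Y0 z, O₁, o₁,
    (((hp.mono hWU).sub contDiffOn_const).contDiff_smul_of_tsupport s₂ hW t₂),
    (hX0s'.contDiff_smul_of_tsupport s₁ hW (t₁.trans w₂)),
    (hY0s.contDiff_smul_of_tsupport s₁ hW (t₁.trans w₂)), c₁.smul_right, c₁.smul_right,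
    fun z => ?_, fun z => ?_, fun z hz v => ?_, fun z hz => ?_⟩, l₁, hO₁W.trans hWU,
    fun z hz => ?_⟩
  · by_cases hz : z ∈ tsupport η₁
    · rw [hq z (t₁ hz), map_smul, hgd, hgX z (w₂ (t₁ hz)), smul_zero]
    · simp [image_eq_zero_of_notMem_tsupport hz]
  · by_cases hz : z ∈ tsupport η₁
    · rw [hq z (t₁ hz), map_smul, hgd, hgY z, smul_zero]
    · simp [image_eq_zero_of_notMem_tsupport hz]
  · simp only [hq z (w₁ hz), e₁ z hz, one_smul, hcross z (hO₁W hz), hgd]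
  · simp only [e₁ z hz, one_smul, hcross z (hO₁W hz)]
    exact (hO₁W hz).1.2
  · simp [e₂ z (w₁ hz)]

end Geometry

section Charts

open Set Filter Topology Metric
open scoped NNReal

theorem HasStrictFDerivAt.exists_uniform_chart {E P F : Type*} [NormedAddCommGroup E]
    [NormedSpace ℝ E] [NormedAddCommGroup P] [NormedSpace ℝ P] [CompleteSpace P]
    [NormedAddCommGroup F] [NormedSpace ℝ F] {Φ : E × P → F} {L : E →L[ℝ] F} {A : P ≃L[ℝ] F}
    {x₀ : E} (h : HasStrictFDerivAt Φ (L.coprod (A : P →L[ℝ] F)) (x₀, 0)) {R : ℝ} (hR : 0 < R) :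
    ∃ r κ C : ℝ, 0 < r ∧ r ≤ R ∧ 0 < κ ∧ 0 < C ∧ ∀ x ∈ ball x₀ r,
      (∀ p ∈ ball (0 : P) r, ∀ p' ∈ ball (0 : P) r,
        ‖p - p'‖ ≤ C * ‖Φ (x, p) - Φ (x, p')‖ ∧ ‖Φ (x, p) - Φ (x, p')‖ ≤ C * ‖p - p'‖) ∧
      ∀ z, ‖z - Φ (x, 0)‖ ≤ κ → ∃ p ∈ ball (0 : P) r, Φ (x, p) = z := by
  set N : ℝ := ‖(A.symm : F →L[ℝ] P)‖ with hN
  have hN0 : 0 ≤ N := norm_nonneg _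
  set ε : ℝ := 1 / (2 * (N + 1)) with hε
  have hε0 : 0 < ε := by positivity
  have hNε : N * ε ≤ 1 / 2 := by
    rw [hε, mul_one_div, div_le_div_iff₀ (by positivity) (by norm_num)]
    linarith
  have hAb : ∀ p, ‖p‖ ≤ N * ‖A p‖ := fun p => by
    simpa using (A.symm : F →L[ℝ] P).le_opNorm (A p)
  have h' := (hasStrictFDerivAt_iff_isLittleO.1 h)
  rw [Asymptotics.isLittleO_iff] at h'
  obtain ⟨s, hs, t, ht, hst⟩ : ∃ s ∈ 𝓝 (x₀, (0 : P)), ∃ t ∈ 𝓝 (x₀, (0 : P)), ∀ a ∈ s, ∀ b ∈ t,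
      ‖Φ a - Φ b - (L.coprod (A : P →L[ℝ] F)) (a - b)‖ ≤ ε * ‖a - b‖ := by
    have h2 := h' hε0
    rw [nhds_prod_eq] at h2
    obtain ⟨s, hs, t, ht, hst⟩ := mem_prod_iff.1 h2
    exact ⟨s, hs, t, ht, fun a ha b hb => hst (mk_mem_prod ha hb)⟩
  obtain ⟨r, hr, hrs⟩ := Metric.mem_nhds_iff.1 (inter_mem hs ht)
  refine ⟨min r R, min r R / (4 * (N + 1)), max (2 * (N + 1)) (‖(A : P →L[ℝ] F)‖ + ε), by positivity,
    min_le_right _ _, by positivity, by positivity, fun x hx => ?_⟩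
  set ρ := min r R with hρ
  have hρ0 : 0 < ρ := by positivity
  have key : ∀ p ∈ ball (0 : P) ρ, ∀ p' ∈ ball (0 : P) ρ,
      ‖Φ (x, p) - Φ (x, p') - A (p - p')‖ ≤ ε * ‖p - p'‖ := by
    intro p hp p' hp'
    have m : ∀ p ∈ ball (0 : P) ρ, (x, p) ∈ ball (x₀, (0 : P)) r := fun p hp => by
      rw [mem_ball, Prod.dist_eq, max_lt_iff]
      exact ⟨hx.trans_le (min_le_left _ _), lt_of_lt_of_le hp (min_le_left _ _)⟩
    have := hst _ (hrs (m p hp)).1 _ (hrs (m p' hp')).2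
    simpa using this
  refine ⟨fun p hp p' hp' => ?_, fun z hz => ?_⟩
  · have k := key p hp p' hp'
    have h1 := hAb (p - p')
    have h2 : ‖A (p - p')‖ ≤ ‖Φ (x, p) - Φ (x, p')‖ + ε * ‖p - p'‖ := by
      have := norm_sub_norm_le (A (p - p')) (Φ (x, p) - Φ (x, p'))
      rw [norm_sub_rev (A (p - p'))] at this
      linarith
    have h3 : ‖Φ (x, p) - Φ (x, p')‖ ≤ ‖A (p - p')‖ + ε * ‖p - p'‖ := by
      have := norm_sub_norm_le (Φ (x, p) - Φ (x, p')) (A (p - p'))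
      linarith
    have h4 : ‖A (p - p')‖ ≤ ‖(A : P →L[ℝ] F)‖ * ‖p - p'‖ := (A : P →L[ℝ] F).le_opNorm _
    constructor
    · refine le_trans ?_ (mul_le_mul_of_nonneg_right (le_max_left _ _) (norm_nonneg _))
      have h5 : N * ‖A (p - p')‖ ≤ N * ‖Φ (x, p) - Φ (x, p')‖ + 1 / 2 * ‖p - p'‖ := by
        have := mul_le_mul_of_nonneg_left h2 hN0
        have h6 := mul_le_mul_of_nonneg_right hNε (norm_nonneg (p - p'))
        nlinarith
      nlinarith [norm_nonneg (Φ (x, p) - Φ (x, p'))]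
    · refine le_trans ?_ (mul_le_mul_of_nonneg_right (le_max_right _ _) (norm_nonneg _))
      linarith
  · rcases hN0.eq_or_lt with h0 | h0
    · have : ∀ y : F, y = 0 := fun y => by
        have := hAb (A.symm y)
        rw [← h0, zero_mul] at this
        simpa using congrArg A (norm_le_zero_iff.1 this)
      exact ⟨0, mem_ball_self hρ0, by rw [this z, this (Φ _)]⟩
    have happ : ApproximatesLinearOn (fun p => Φ (x, p)) (A : P →L[ℝ] F) (ball 0 ρ) ⟨ε, hε0.le⟩ :=
      fun p hp p' hp' => key p hp p' hp'
    have hsub : closedBall (0 : P) (ρ / 2) ⊆ ball 0 ρ := closedBall_subset_ball (by linarith)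
    have hsurj := happ.surjOn_closedBall_of_nonlinearRightInverse A.toNonlinearRightInverse
      (by positivity : 0 ≤ ρ / 2) hsub
    have hzm : z ∈ closedBall (Φ (x, 0))
        (((A.toNonlinearRightInverse.nnnorm : ℝ)⁻¹ - (⟨ε, hε0.le⟩ : ℝ≥0)) * (ρ / 2)) := by
      rw [mem_closedBall, dist_eq_norm]
      refine hz.trans ?_
      have hNN : (A.toNonlinearRightInverse.nnnorm : ℝ) = N := rfl
      rw [hNN]
      change ρ / (4 * (N + 1)) ≤ (N⁻¹ - ε) * (ρ / 2)
      have : (N + 1)⁻¹ ≤ N⁻¹ := by gcongr; linarith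
      have e1 : ε = (N + 1)⁻¹ / 2 := by rw [hε]; field_simp
      have e2 : ρ / (4 * (N + 1)) = (N + 1)⁻¹ / 2 * (ρ / 2) := by field_simp; norm_num
      rw [e1, e2]
      gcongr
      linarith
    obtain ⟨p, hp, hpz⟩ := hsurj hzm
    exact ⟨p, hsub hp, hpz⟩

/-- The flows of a frame, together with Lipschitz constants for the frame. -/
structure FlowFrame extends LevelFrame where
  φ : ℝ → R3 → R3
  ψ : ℝ → R3 → R3
  K : ℝ≥0
  K' : ℝ≥0
  lip_X : LipschitzWith K X
  lip_Y : LipschitzWith K Y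
  lip_DX : LipschitzWith K' (fderiv ℝ X)
  lip_DY : LipschitzWith K' (fderiv ℝ Y)
  flow_X : IsFlow X φ
  flow_Y : IsFlow Y ψ

theorem LevelFrame.exists_flowFrame (S : LevelFrame) : ∃ T : FlowFrame, T.toLevelFrame = S := by
  have lip : ∀ {F : Type} [NormedAddCommGroup F] [NormedSpace ℝ F] (v : R3 → F),
      ContDiff ℝ (⊤ : ℕ∞) v → HasCompactSupport v → ∃ K : ℝ≥0, LipschitzWith K v :=
    fun v hv hc => hv.lipschitzWith_of_hasCompactSupport hc (by simp)
  have sm : ∀ v : R3 → R3, ContDiff ℝ (⊤ : ℕ∞) v → ContDiff ℝ (⊤ : ℕ∞) (fderiv ℝ v) :=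
    fun v hv => hv.fderiv_right (by simp)
  have bd : ∀ v : R3 → R3, ContDiff ℝ (⊤ : ℕ∞) v → HasCompactSupport v →
      ∃ L : ℝ≥0, ∀ x, ‖v x‖ ≤ L := fun v hv hc => by
    obtain ⟨L, hL⟩ := hc.exists_bound_of_continuous hv.continuous
    exact ⟨⟨max L 0, le_max_right _ _⟩, fun x => (hL x).trans (le_max_left _ _)⟩
  obtain ⟨K₁, h₁⟩ := lip S.X S.smooth_X S.cs_X
  obtain ⟨K₂, h₂⟩ := lip S.Y S.smooth_Y S.cs_Y
  obtain ⟨K₃, h₃⟩ := lip _ (sm _ S.smooth_X) (S.cs_X.fderiv ℝ)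
  obtain ⟨K₄, h₄⟩ := lip _ (sm _ S.smooth_Y) (S.cs_Y.fderiv ℝ)
  obtain ⟨L₁, l₁⟩ := bd _ S.smooth_X S.cs_X
  obtain ⟨L₂, l₂⟩ := bd _ S.smooth_Y S.cs_Y
  obtain ⟨φ, hφ⟩ := exists_isFlow h₁ l₁
  obtain ⟨ψ, hψ⟩ := exists_isFlow h₂ l₂
  exact ⟨⟨S, φ, ψ, max K₁ K₂, max K₃ K₄, h₁.weaken (le_max_left _ _), h₂.weaken (le_max_right _ _),
    h₃.weaken (le_max_left _ _), h₄.weaken (le_max_right _ _), hφ, hψ⟩, rfl⟩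

namespace FlowFrame

variable (S : FlowFrame)

/-- Exchange the two fields of a frame. -/
def swap : FlowFrame where
  q := fun z => -S.q z
  X := S.Y
  Y := S.X
  O := S.O
  isOpen_O := S.isOpen_O
  smooth_q := S.smooth_q.neg
  smooth_X := S.smooth_Y
  smooth_Y := S.smooth_X
  cs_X := S.cs_Y
  cs_Y := S.cs_X
  dqX := fun z => by
    change (fderiv ℝ (-S.q) z) _ = 0
    rw [fderiv_neg]; simp [S.dqY z]
  dqY := fun z => by
    change (fderiv ℝ (-S.q) z) _ = 0
    rw [fderiv_neg]; simp [S.dqX z]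
  dq := fun z hz v => by
    change (fderiv ℝ (-S.q) z) _ = _
    rw [fderiv_neg, inner_eq_sum3]
    simp only [neg_apply, S.dq z hz, inner_eq_sum3, cross3_apply_zero,
      cross3_apply_one, cross3_apply_two]
    ring
  dq_ne := fun z hz h => S.dq_ne z hz (by
    have h0 := congrArg (fun v : R3 => v 0) h
    have h1 := congrArg (fun v : R3 => v 1) h
    have h2 := congrArg (fun v : R3 => v 2) h
    simp only [cross3_apply_zero, cross3_apply_one, cross3_apply_two, PiLp.zero_apply] at h0 h1 h2
    refine ext3 ?_ ?_ ?_ <;>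
      simp only [cross3_apply_zero, cross3_apply_one, cross3_apply_two, PiLp.zero_apply] <;>
      linarith)
  φ := S.ψ
  ψ := S.φ
  K := S.K
  K' := S.K'
  lip_X := S.lip_Y
  lip_Y := S.lip_X
  lip_DX := S.lip_DY
  lip_DY := S.lip_DX
  flow_X := S.flow_Y
  flow_Y := S.flow_X

theorem differentiable_q : Differentiable ℝ S.q := S.smooth_q.differentiable (by simp)

theorem q_φ (t : ℝ) (z : R3) : S.q (S.φ t z) = S.q z := by
  have h : ∀ s, HasDerivAt (fun s => S.q (S.φ s z)) 0 s := fun s => by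
    have := (S.differentiable_q (S.φ s z)).hasFDerivAt.comp_hasDerivAt s (S.flow_X.deriv z s)
    rwa [S.dqX] at this
  have := is_const_of_deriv_eq_zero (fun s => (h s).differentiableAt) (fun s => (h s).deriv) t 0
  simpa [S.flow_X.zero] using this

theorem q_ψ (t : ℝ) (z : R3) : S.q (S.ψ t z) = S.q z := by
  have := S.swap.q_φ t z
  simpa [swap] using this

/-- The normal vector. -/
def n (z : R3) : R3 := cross3 (S.X z) (S.Y z)

/-- Local coordinates by flowing along both fields, starting on a transversal. -/
def chart (n x : R3) (p : ℝ × ℝ × ℝ) : R3 := S.ψ p.2.1 (S.φ p.1 (x + p.2.2 • n))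

theorem chart_zero (n x : R3) : S.chart n x 0 = x := by
  simp [chart, S.flow_X.zero, S.flow_Y.zero]

theorem q_chart (n x : R3) (p : ℝ × ℝ × ℝ) : S.q (S.chart n x p) = S.q (x + p.2.2 • n) := by
  rw [chart, q_ψ, q_φ]

theorem continuous_φ : Continuous fun q : ℝ × R3 => S.φ q.1 q.2 := S.flow_X.continuous S.lip_X

theorem continuous_ψ : Continuous fun q : ℝ × R3 => S.ψ q.1 q.2 := S.flow_Y.continuous S.lip_Y

theorem continuous_chart (n : R3) : Continuous fun q : R3 × ℝ × ℝ × ℝ => S.chart n q.1 q.2 := by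
  have h1 : Continuous fun q : R3 × ℝ × ℝ × ℝ => S.φ q.2.1 (q.1 + q.2.2.2 • n) :=
    S.continuous_φ.comp (by fun_prop : Continuous fun q : R3 × ℝ × ℝ × ℝ =>
      (q.2.1, q.1 + q.2.2.2 • n))
  exact S.continuous_ψ.comp ((by fun_prop : Continuous fun q : R3 × ℝ × ℝ × ℝ =>
      q.2.2.1).prodMk h1)

/-- The frame `X, Y, n` as a linear isomorphism. -/
theorem exists_frame_equiv {x₀ : R3} (hx₀ : x₀ ∈ S.O) : ∃ A : (ℝ × ℝ × ℝ) ≃L[ℝ] R3,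
    ∀ p, A p = p.1 • S.X x₀ + p.2.1 • S.Y x₀ + p.2.2 • S.n x₀ := by
  let A₀ : (ℝ × ℝ × ℝ) →ₗ[ℝ] R3 :=
    (LinearMap.fst ℝ ℝ (ℝ × ℝ)).smulRight (S.X x₀) +
    ((LinearMap.fst ℝ ℝ ℝ).comp (LinearMap.snd ℝ ℝ (ℝ × ℝ))).smulRight (S.Y x₀) +
    ((LinearMap.snd ℝ ℝ ℝ).comp (LinearMap.snd ℝ ℝ (ℝ × ℝ))).smulRight (S.n x₀)
  have hA : ∀ p, A₀ p = p.1 • S.X x₀ + p.2.1 • S.Y x₀ + p.2.2 • S.n x₀ := fun p => rfl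
  have hn := S.dq_ne x₀ hx₀
  have hinj : Function.Injective A₀ := by
    rw [← LinearMap.ker_eq_bot, LinearMap.ker_eq_bot']
    rintro ⟨s, t, ρ⟩ h
    rw [hA] at h
    simp only at h
    have e0 := congrArg (fun v : R3 => v 0) h
    have e1 := congrArg (fun v : R3 => v 1) h
    have e2 := congrArg (fun v : R3 => v 2) h
    simp only [PiLp.add_apply, PiLp.smul_apply, smul_eq_mul, PiLp.zero_apply] at e0 e1 e2
    have h1 : ρ * ⟪S.n x₀, S.n x₀⟫ = 0 := by
      rw [inner_eq_sum3]
      simp only [n, cross3_apply_zero, cross3_apply_one, cross3_apply_two] at *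
      linear_combination (S.X x₀ 1 * S.Y x₀ 2 - S.X x₀ 2 * S.Y x₀ 1) * e0 +
        (S.X x₀ 2 * S.Y x₀ 0 - S.X x₀ 0 * S.Y x₀ 2) * e1 +
        (S.X x₀ 0 * S.Y x₀ 1 - S.X x₀ 1 * S.Y x₀ 0) * e2
    have hρ : ρ = 0 := (mul_eq_zero.1 h1).resolve_right (inner_self_ne_zero.2 hn)
    subst hρ
    simp only [zero_mul, add_zero] at e0 e1 e2
    have hs : s • cross3 (S.X x₀) (S.Y x₀) = 0 := by
      refine ext3 ?_ ?_ ?_ <;> simp only [PiLp.smul_apply, smul_eq_mul, cross3_apply_zero,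
        cross3_apply_one, cross3_apply_two, PiLp.zero_apply]
      · linear_combination S.Y x₀ 2 * e1 - S.Y x₀ 1 * e2
      · linear_combination S.Y x₀ 0 * e2 - S.Y x₀ 2 * e0
      · linear_combination S.Y x₀ 1 * e0 - S.Y x₀ 0 * e1
    have ht : t • cross3 (S.X x₀) (S.Y x₀) = 0 := by
      refine ext3 ?_ ?_ ?_ <;> simp only [PiLp.smul_apply, smul_eq_mul, cross3_apply_zero,
        cross3_apply_one, cross3_apply_two, PiLp.zero_apply]
      · linear_combination S.X x₀ 1 * e2 - S.X x₀ 2 * e1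
      · linear_combination S.X x₀ 2 * e0 - S.X x₀ 0 * e2
      · linear_combination S.X x₀ 0 * e1 - S.X x₀ 1 * e0
    rw [(smul_eq_zero.1 hs).resolve_right hn, (smul_eq_zero.1 ht).resolve_right hn]
    rfl
  exact ⟨(LinearMap.linearEquivOfInjective A₀ hinj (by simp)).toContinuousLinearEquiv, hA⟩

theorem hasStrictFDerivAt_chart (x₀ n : R3) :
    HasStrictFDerivAt (fun q : R3 × ℝ × ℝ × ℝ => S.chart n q.1 q.2)
      ((ContinuousLinearMap.id ℝ R3).coprod
        (((ContinuousLinearMap.fst ℝ ℝ (ℝ × ℝ)).smulRight (S.X x₀) +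
        ((ContinuousLinearMap.fst ℝ ℝ ℝ).comp (ContinuousLinearMap.snd ℝ ℝ (ℝ × ℝ))).smulRight
          (S.Y x₀) +
        ((ContinuousLinearMap.snd ℝ ℝ ℝ).comp (ContinuousLinearMap.snd ℝ ℝ (ℝ × ℝ))).smulRight n)))
      (x₀, 0) := by
  have h0 : HasStrictFDerivAt (fun q : R3 × ℝ × ℝ × ℝ => (q.2.1, q.1 + q.2.2.2 • n)) _ (x₀, 0) :=
    (ContinuousLinearMap.hasStrictFDerivAt (F := ℝ × R3)
      (((ContinuousLinearMap.fst ℝ ℝ (ℝ × ℝ)).comp (ContinuousLinearMap.snd ℝ R3 _)).prod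
      (ContinuousLinearMap.fst ℝ R3 (ℝ × ℝ × ℝ) +
        (((ContinuousLinearMap.snd ℝ ℝ ℝ).comp (ContinuousLinearMap.snd ℝ ℝ (ℝ × ℝ))).comp
          (ContinuousLinearMap.snd ℝ R3 _)).smulRight n)))
  have h1 := (S.flow_X.hasStrictFDerivAt S.lip_X x₀)
  have h2 := (S.flow_Y.hasStrictFDerivAt S.lip_Y x₀)
  have h1' : HasStrictFDerivAt (fun q : ℝ × R3 => S.φ q.1 q.2)
      ((ContinuousLinearMap.fst ℝ ℝ R3).smulRight (S.X x₀) + ContinuousLinearMap.snd ℝ ℝ R3)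
      ((fun q : R3 × ℝ × ℝ × ℝ => (q.2.1, q.1 + q.2.2.2 • n)) (x₀, 0)) := by simpa using h1
  have h3 := h1'.comp (x₀, 0) h0
  have h4 : HasStrictFDerivAt (fun q : R3 × ℝ × ℝ × ℝ => q.2.2.1) _ (x₀, 0) :=
    ((ContinuousLinearMap.fst ℝ ℝ ℝ).comp ((ContinuousLinearMap.snd ℝ ℝ (ℝ × ℝ)).comp
      (ContinuousLinearMap.snd ℝ R3 (ℝ × ℝ × ℝ)))).hasStrictFDerivAt
  have h5 := h4.prodMk h3
  have h2' : HasStrictFDerivAt (fun q : ℝ × R3 => S.ψ q.1 q.2)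
      ((ContinuousLinearMap.fst ℝ ℝ R3).smulRight (S.Y x₀) + ContinuousLinearMap.snd ℝ ℝ R3)
      ((fun q : R3 × ℝ × ℝ × ℝ => (q.2.2.1, S.φ q.2.1 (q.1 + q.2.2.2 • n))) (x₀, 0)) := by
    simpa [S.flow_X.zero] using h2
  have h6 := h2'.comp (x₀, 0) h5
  refine h6.congr_fderiv ?_
  ext p <;> simp

theorem exists_chart {x₀ : R3} (hx₀ : x₀ ∈ S.O) {R : ℝ} (hR : 0 < R) :
    ∃ r κ C : ℝ, 0 < r ∧ r ≤ R ∧ 0 < κ ∧ 0 < C ∧ ∀ x ∈ ball x₀ r,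
      (∀ p ∈ ball (0 : ℝ × ℝ × ℝ) r, ∀ p' ∈ ball (0 : ℝ × ℝ × ℝ) r,
        ‖p - p'‖ ≤ C * ‖S.chart (S.n x₀) x p - S.chart (S.n x₀) x p'‖ ∧
        ‖S.chart (S.n x₀) x p - S.chart (S.n x₀) x p'‖ ≤ C * ‖p - p'‖) ∧
      (∀ z, ‖z - x‖ ≤ κ → ∃ p ∈ ball (0 : ℝ × ℝ × ℝ) r, S.chart (S.n x₀) x p = z) ∧
      ∀ ρ ρ' : ℝ, |ρ| < r → |ρ'| < r →
        |ρ - ρ'| ≤ C * |S.q (x + ρ • S.n x₀) - S.q (x + ρ' • S.n x₀)| ∧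
        |S.q (x + ρ • S.n x₀) - S.q (x + ρ' • S.n x₀)| ≤ C * |ρ - ρ'| := by
  obtain ⟨A, hA⟩ := S.exists_frame_equiv hx₀
  set n := S.n x₀ with hn
  have hst : HasStrictFDerivAt (fun q : R3 × ℝ => S.q (q.1 + q.2 • n))
      ((fderiv ℝ S.q x₀).coprod (((ContinuousLinearEquiv.smulLeft (R₁ := ℝ)
        (Units.mk0 ⟪n, n⟫ (inner_self_ne_zero.2 (S.dq_ne x₀ hx₀)))) : ℝ ≃L[ℝ] ℝ) : ℝ →L[ℝ] ℝ)) (x₀, 0) := by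
    have h1 : HasStrictFDerivAt S.q (fderiv ℝ S.q x₀)
        ((fun q : R3 × ℝ => q.1 + q.2 • n) (x₀, 0)) := by
      simpa using S.smooth_q.contDiffAt.hasStrictFDerivAt (by simp)
    have h2 : HasStrictFDerivAt (fun q : R3 × ℝ => q.1 + q.2 • n) _ (x₀, 0) :=
      (ContinuousLinearMap.fst ℝ R3 ℝ + (ContinuousLinearMap.snd ℝ R3 ℝ).smulRight n).hasStrictFDerivAt
    refine (h1.comp (x₀, 0) h2).congr_fderiv ?_
    ext p
    · simp
    · simp [S.dq x₀ hx₀, hn, FlowFrame.n]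
  obtain ⟨r₂, κ₂, C₂, hr₂, hr₂R, _, hC₂, H₂⟩ := hst.exists_uniform_chart hR
  have h1 : HasStrictFDerivAt (fun q : R3 × ℝ × ℝ × ℝ => S.chart n q.1 q.2)
      ((ContinuousLinearMap.id ℝ R3).coprod (A : (ℝ × ℝ × ℝ) →L[ℝ] R3)) (x₀, 0) := by
    refine (S.hasStrictFDerivAt_chart x₀ n).congr_fderiv ?_
    congr 1
    refine ContinuousLinearMap.ext fun p => ?_
    simp [hA]
  obtain ⟨r, κ, C, hr, hrR, hκ, hC, H⟩ := h1.exists_uniform_chart hr₂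
  refine ⟨r, κ, max C C₂, hr, hrR.trans hr₂R, hκ, by positivity, fun x hx => ?_⟩
  obtain ⟨a, b⟩ := H x hx
  obtain ⟨a₂, -⟩ := H₂ x (ball_subset_ball hrR hx)
  refine ⟨fun p hp p' hp' => ?_, fun z hz => ?_, fun ρ ρ' hρ hρ' => ?_⟩
  · obtain ⟨u, v⟩ := a p hp p' hp'
    exact ⟨u.trans (by gcongr; exact le_max_left _ _), v.trans (by gcongr; exact le_max_left _ _)⟩
  · simp only [chart_zero] at b
    exact b z hz
  · obtain ⟨u, v⟩ := a₂ ρ (by simpa using hρ.trans_le hrR) ρ' (by simpa using hρ'.trans_le hrR)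
    exact ⟨u.trans (by
      rw [Real.norm_eq_abs]; gcongr; exact le_max_right _ _), v.trans (by
      rw [Real.norm_eq_abs]; gcongr; exact le_max_right _ _)⟩

end FlowFrame

end Charts

section Surfaces

open Set Filter Topology Metric
open scoped NNReal

/-- A framed level surface: a compact connected piece `Λ` of the zero set of `q`, isolated in the
zero set by the compact neighbourhood `V`. -/
structure FramedSurface extends FlowFrame where
  Λ : Set R3
  V : Set R3
  isCompact_Λ : IsCompact Λ
  isPreconnected_Λ : IsPreconnected Λ
  nonempty_Λ : Λ.Nonempty
  isCompact_V : IsCompact V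
  V_subset : V ⊆ O
  Λ_subset : Λ ⊆ interior V
  mem_Λ_iff : ∀ z ∈ V, z ∈ Λ ↔ q z = 0

theorem FlowFrame.exists_ball_subset_component (S : FlowFrame) {x₀ : R3} (hx₀ : x₀ ∈ S.O)
    (h0 : S.q x₀ = 0) : ∃ δ > 0, ∀ z, ‖z - x₀‖ ≤ δ → S.q z = 0 →
      z ∈ connectedComponentIn {z | z ∈ S.O ∧ S.q z = 0} x₀ := by
  have hc : Continuous fun p : ℝ × ℝ × ℝ => S.chart (S.n x₀) x₀ p :=
    (S.continuous_chart _).comp (by fun_prop : Continuous fun p : ℝ × ℝ × ℝ => (x₀, p))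
  have hev : ∀ᶠ p in 𝓝 (0 : ℝ × ℝ × ℝ), S.chart (S.n x₀) x₀ p ∈ S.O :=
    hc.continuousAt.eventually (by
      beta_reduce
      rw [S.chart_zero]; exact S.isOpen_O.mem_nhds hx₀)
  obtain ⟨R, hR, hRO⟩ := Metric.eventually_nhds_iff_ball.1 hev
  obtain ⟨r, κ, C, hr, hrR, hκ, hC, H⟩ := S.exists_chart hx₀ hR
  obtain ⟨-, hs, hq⟩ := H x₀ (mem_ball_self hr)
  refine ⟨κ, hκ, fun z hz hqz => ?_⟩
  obtain ⟨p, hp, rfl⟩ := hs z hz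
  rw [S.q_chart] at hqz
  have hp3 : |p.2.2| < r := by
    have h1 := norm_snd_le p
    have h2 := norm_snd_le p.2
    rw [mem_ball_zero_iff] at hp
    rw [← Real.norm_eq_abs]
    linarith
  have hρ : p.2.2 = 0 := by
    have := (hq p.2.2 0 hp3 (by simpa using hr)).1
    rw [hqz, zero_smul, add_zero, h0] at this
    simpa using this
  have himg : (fun τ : ℝ => S.chart (S.n x₀) x₀ (τ • p)) '' Icc 0 1 ⊆
      {z | z ∈ S.O ∧ S.q z = 0} := by
    rintro _ ⟨τ, hτ, rfl⟩
    refine ⟨hRO _ ?_, ?_⟩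
    · rw [mem_ball_zero_iff] at hp ⊢
      rw [norm_smul, Real.norm_eq_abs, abs_of_nonneg hτ.1]
      nlinarith [norm_nonneg p, hτ.2]
    · rw [S.q_chart]
      simp [hρ, h0]
  have hpre : IsPreconnected ((fun τ : ℝ => S.chart (S.n x₀) x₀ (τ • p)) '' Icc 0 1) :=
    isPreconnected_Icc.image _ (hc.comp (by fun_prop)).continuousOn
  refine hpre.subset_connectedComponentIn ⟨0, by simp, by simp [S.chart_zero]⟩ himg
    ⟨1, by simp, by simp⟩

theorem FlowFrame.exists_framedSurface (S : FlowFrame) {U : Set R3} {p : R3 → ℝ} {c : ℝ}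
    {Λ : Set R3} {z₀ : R3} (hz₀ : z₀ ∈ Λ) (hΛ : Λ = connectedComponentIn {z | z ∈ U ∧ p z = c} z₀)
    (hΛc : IsCompact Λ) (hO : Λ ⊆ S.O) (hOU : S.O ⊆ U) (hq : ∀ z ∈ S.O, S.q z = p z - c) :
    ∃ T : FramedSurface, T.Λ = Λ := by
  have hsub : Λ ⊆ {z | z ∈ U ∧ p z = c} := hΛ ▸ connectedComponentIn_subset _ _
  have hq0 : ∀ z ∈ Λ, S.q z = 0 := fun z hz => by rw [hq z (hO hz), (hsub hz).2, sub_self]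
  have hloc : ∀ x ∈ Λ, ∃ δ > 0, ∀ z, ‖z - x‖ ≤ δ → S.q z = 0 → z ∈ Λ := by
    intro x hx
    obtain ⟨δ, hδ, h⟩ := S.exists_ball_subset_component (hO hx) (hq0 x hx)
    refine ⟨δ, hδ, fun z hz hz0 => ?_⟩
    have h1 : connectedComponentIn {z | z ∈ U ∧ p z = c} z₀ =
        connectedComponentIn {z | z ∈ U ∧ p z = c} x := connectedComponentIn_eq (hΛ ▸ hx)
    rw [hΛ, h1]
    have h2 : {z | z ∈ S.O ∧ S.q z = 0} ⊆ {z | z ∈ U ∧ p z = c} := fun y hy =>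
      ⟨hOU hy.1, by have := hq y hy.1; linarith [hy.2]⟩
    exact connectedComponentIn_mono x h2 (h z hz hz0)
  choose! δ hδ hδΛ using hloc
  have hopen : IsOpen (S.O ∩ ⋃ x ∈ Λ, ball x (δ x)) :=
    S.isOpen_O.inter (isOpen_biUnion fun x _ => isOpen_ball)
  have hcov : Λ ⊆ S.O ∩ ⋃ x ∈ Λ, ball x (δ x) := fun x hx =>
    ⟨hO hx, mem_biUnion hx (mem_ball_self (hδ x hx))⟩
  obtain ⟨ε, hε, hεs⟩ := hΛc.exists_cthickening_subset_open hopen hcov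
  refine ⟨{ S with
    Λ := Λ
    V := cthickening ε Λ
    isCompact_Λ := hΛc
    isPreconnected_Λ := hΛ ▸ isPreconnected_connectedComponentIn
    nonempty_Λ := ⟨z₀, hz₀⟩
    isCompact_V := hΛc.cthickening
    V_subset := fun z hz => (hεs hz).1
    Λ_subset := (self_subset_thickening hε _).trans
      (interior_maximal (thickening_subset_cthickening _ _) isOpen_thickening)
    mem_Λ_iff := fun z hz => ⟨hq0 z, fun h => by
      obtain ⟨x, hx, hzx⟩ := mem_iUnion₂.1 (hεs hz).2
      exact hδΛ x hx z (by rw [← dist_eq_norm]; exact (mem_ball.1 hzx).le) h⟩ }, rfl⟩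

namespace FramedSurface

variable (S : FramedSurface)

/-- Exchange the two fields. -/
def swap : FramedSurface :=
  { S.toFlowFrame.swap with
    Λ := S.Λ
    V := S.V
    isCompact_Λ := S.isCompact_Λ
    isPreconnected_Λ := S.isPreconnected_Λ
    nonempty_Λ := S.nonempty_Λ
    isCompact_V := S.isCompact_V
    V_subset := S.V_subset
    Λ_subset := S.Λ_subset
    mem_Λ_iff := fun z hz => (S.mem_Λ_iff z hz).trans (neg_eq_zero (a := S.q z)).symm }

theorem Λ_subset_V : S.Λ ⊆ S.V := S.Λ_subset.trans interior_subset

theorem Λ_subset_O : S.Λ ⊆ S.O := S.Λ_subset_V.trans S.V_subset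

theorem q_eq_zero {z : R3} (hz : z ∈ S.Λ) : S.q z = 0 := (S.mem_Λ_iff z (S.Λ_subset_V hz)).1 hz

theorem φ_mem {z : R3} (hz : z ∈ S.Λ) (t : ℝ) : S.φ t z ∈ S.Λ := by
  have hc : Continuous fun t => S.φ t z := S.flow_X.continuous_time z
  have hclopen : IsClopen {t | S.φ t z ∈ S.Λ} := by
    refine ⟨S.isCompact_Λ.isClosed.preimage hc, ?_⟩
    rw [isOpen_iff_mem_nhds]
    intro t ht
    filter_upwards [hc.continuousAt.eventually (isOpen_interior.mem_nhds (S.Λ_subset ht))] with s hs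
    exact (S.mem_Λ_iff _ (interior_subset hs)).2 ((S.q_φ s z).trans (S.q_eq_zero hz))
  have := hclopen.eq_univ ⟨0, by simpa [S.flow_X.zero] using hz⟩
  exact (this ▸ mem_univ t : t ∈ {t | S.φ t z ∈ S.Λ})

theorem ψ_mem {z : R3} (hz : z ∈ S.Λ) (t : ℝ) : S.ψ t z ∈ S.Λ := S.swap.φ_mem hz t

/-- Nearby points of the surface are joined by short flow lines. -/
theorem exists_short_path : ∃ κ C : ℝ, 0 < κ ∧ 0 < C ∧ ∀ x ∈ S.Λ, ∀ z ∈ S.Λ, ‖z - x‖ ≤ κ →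
    ∃ s t, |s| ≤ C * ‖z - x‖ ∧ |t| ≤ C * ‖z - x‖ ∧ S.ψ t (S.φ s x) = z := by
  have hloc : ∀ x₀ ∈ S.Λ, ∃ r κ C : ℝ, 0 < r ∧ 0 < κ ∧ 0 < C ∧ ∀ x ∈ S.Λ, x ∈ ball x₀ r →
      ∀ z ∈ S.Λ, ‖z - x‖ ≤ κ →
        ∃ s t, |s| ≤ C * ‖z - x‖ ∧ |t| ≤ C * ‖z - x‖ ∧ S.ψ t (S.φ s x) = z := by
    intro x₀ hx₀
    obtain ⟨r, κ, C, hr, -, hκ, hC, H⟩ := S.exists_chart (S.Λ_subset_O hx₀) one_pos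
    refine ⟨r, κ, C, hr, hκ, hC, fun x hx hxr z hz hzx => ?_⟩
    obtain ⟨hb, hs, hq⟩ := H x hxr
    obtain ⟨p, hp, rfl⟩ := hs z hzx
    have h1 := norm_fst_le p
    have h2 := norm_snd_le p
    have h3 := norm_snd_le p.2
    have h4 := norm_fst_le p.2
    have hpr := mem_ball_zero_iff.1 hp
    have hρ : p.2.2 = 0 := by
      have := (hq p.2.2 0 (by rw [← Real.norm_eq_abs]; linarith) (by simpa using hr)).1
      have e := S.q_eq_zero hz
      rw [S.q_chart] at e
      rw [e, zero_smul, add_zero, S.q_eq_zero hx] at this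
      simpa using this
    have hb' := (hb p hp 0 (mem_ball_self hr)).1
    rw [S.chart_zero, sub_zero] at hb'
    rw [Real.norm_eq_abs] at h1 h4
    refine ⟨p.1, p.2.1, h1.trans hb', h4.trans (h2.trans hb'), ?_⟩
    simp [FlowFrame.chart, hρ]
  choose! r κ C hr hκ hC H using hloc
  obtain ⟨t, ht, hcov⟩ := S.isCompact_Λ.elim_nhds_subcover (fun x => ball x (r x))
    fun x hx => ball_mem_nhds x (hr x hx)
  have hne : t.Nonempty := by
    obtain ⟨z, hz⟩ := S.nonempty_Λ
    obtain ⟨x, hx, -⟩ := mem_iUnion₂.1 (hcov hz)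
    exact ⟨x, hx⟩
  refine ⟨t.inf' hne κ, t.sup' hne C, (Finset.lt_inf'_iff _).2 fun x hx => hκ x (ht x hx), ?_, ?_⟩
  · obtain ⟨x, hx⟩ := hne
    exact (hC x (ht x hx)).trans_le (Finset.le_sup' C hx)
  · intro x hx z hz hzx
    obtain ⟨y, hy, hxy⟩ := mem_iUnion₂.1 (hcov hx)
    obtain ⟨s, u, hs, hu, e⟩ := H y (ht y hy) x hx hxy z hz (hzx.trans (Finset.inf'_le κ hy))
    have : C y ≤ t.sup' hne C := Finset.le_sup' C hy
    exact ⟨s, u, hs.trans (by gcongr), hu.trans (by gcongr), e⟩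

end FramedSurface

end Surfaces

section MeasureConstruction

open Set Filter Topology MeasureTheory
open scoped NNReal ENNReal

/-- A limit of positive functionals which concentrate on a compact set is given by a measure. -/
theorem exists_measure_of_concentrating {E : Type*} [MetricSpace E] {K : Set E} (hK : IsCompact K)
    [MeasurableSpace E] [BorelSpace E] {ι : Type*} (𝓤 : Ultrafilter ι)
    (I : ι → C(E, ℝ) →ₗ[ℝ] ℝ) (hpos : ∀ i f, (∀ z, 0 ≤ f z) → 0 ≤ I i f) {C : ℝ}
    (hb : ∀ (f : C(E, ℝ)) (c : ℝ), 0 < c → (∀ z ∈ K, |f z| < c) → ∀ᶠ i in 𝓤, |I i f| ≤ C * c) :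
    ∃ μ : Measure K, IsFiniteMeasure μ ∧
      ∀ f : C(E, ℝ), Tendsto (fun i => I i f) 𝓤 (𝓝 (∫ x, f x ∂μ)) := by
  have hlim : ∀ f : C(E, ℝ), ∃ l, Tendsto (fun i => I i f) 𝓤 (𝓝 l) := by
    intro f
    obtain ⟨c, hc⟩ := hK.exists_bound_of_continuousOn f.continuous.continuousOn
    have h1 := hb f (|c| + 1) (by positivity) fun z hz => by
      have := hc z hz
      rw [Real.norm_eq_abs] at this
      linarith [le_abs_self c]
    have h2 : ((𝓤.map fun i => I i f : Ultrafilter ℝ) : Filter ℝ) ≤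
        𝓟 (Icc (-(C * (|c| + 1))) (C * (|c| + 1))) := by
      rw [le_principal_iff, Ultrafilter.mem_coe, Ultrafilter.mem_map]
      filter_upwards [h1] with i hi using abs_le.1 hi
    obtain ⟨l, -, hl⟩ := isCompact_Icc.ultrafilter_le_nhds _ h2
    exact ⟨l, hl⟩
  choose L hL using hlim
  have hLadd : ∀ f g, L (f + g) = L f + L g := fun f g =>
    tendsto_nhds_unique (hL _) (by simpa using (hL f).add (hL g))
  have hLsmul : ∀ (c : ℝ) f, L (c • f) = c * L f := fun c f =>
    tendsto_nhds_unique (hL _) (by simpa using (hL f).const_mul c)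
  have hLzero : ∀ f : C(E, ℝ), (∀ z ∈ K, f z = 0) → L f = 0 := by
    intro f hf
    have h1 : ∀ c > 0, |L f| ≤ C * c := fun c hc =>
      le_of_tendsto (hL f).abs (hb f c hc fun z hz => by simpa [hf z hz] using hc)
    have h2 : Tendsto (fun c : ℝ => C * c) (𝓝[>] 0) (𝓝 (C * 0)) :=
      (tendsto_id.const_mul C).mono_left nhdsWithin_le_nhds
    have h3 := ge_of_tendsto h2 (eventually_mem_nhdsWithin.mono fun c hc => h1 c hc)
    rw [mul_zero] at h3
    exact abs_eq_zero.1 (le_antisymm h3 (abs_nonneg _))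
  have hLeq : ∀ f g : C(E, ℝ), (∀ z ∈ K, f z = g z) → L f = L g := by
    intro f g h
    have h0 := hLzero (f + (-1 : ℝ) • g) fun z hz => by simp [h z hz]
    rw [hLadd, hLsmul] at h0
    linarith
  have hLpos : ∀ f : C(E, ℝ), (∀ z ∈ K, 0 ≤ f z) → 0 ≤ L f := by
    intro f h
    rw [hLeq f (f ⊔ 0) fun z hz => by simp [h z hz]]
    exact ge_of_tendsto (hL _) (Eventually.of_forall fun i => hpos i _ fun z => by simp)
  have hext : ∀ g : C(K, ℝ), ∃ f : C(E, ℝ), f.restrict K = g := fun g =>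
    ContinuousMap.exists_restrict_eq hK.isClosed g
  choose ext hext using hext
  have hext' : ∀ (g : C(K, ℝ)) z (hz : z ∈ K), ext g z = g ⟨z, hz⟩ := fun g z hz =>
    DFunLike.congr_fun (hext g) ⟨z, hz⟩
  have : CompactSpace K := isCompact_iff_compactSpace.1 hK
  let Λ₀ : CompactlySupportedContinuousMap K ℝ →ₗ[ℝ] ℝ :=
    { toFun := fun g => L (ext g)
      map_add' := fun g g' => by
        rw [← hLadd]
        refine hLeq _ _ fun z hz => ?_
        simp [hext' _ z hz]
      map_smul' := fun c g => by
        rw [RingHom.id_apply, smul_eq_mul, ← hLsmul]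
        refine hLeq _ _ fun z hz => ?_
        simp [hext' _ z hz] }
  let Λ := PositiveLinearMap.mk₀ Λ₀ fun g hg => hLpos _ fun z hz => by
    rw [hext' _ z hz]
    exact hg ⟨z, hz⟩
  refine ⟨RealRMK.rieszMeasure Λ, inferInstance, fun f => ?_⟩
  have h1 := RealRMK.integral_rieszMeasure Λ
    (CompactlySupportedContinuousMap.continuousMapEquiv (f.restrict K))
  have h2 : Λ (CompactlySupportedContinuousMap.continuousMapEquiv (f.restrict K)) = L f :=
    hLeq _ _ fun z hz => by rw [hext' _ z hz]; rfl
  rw [h2] at h1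
  have h3 : ∫ x : K, f x ∂(RealRMK.rieszMeasure Λ) = L f := h1
  rw [h3]
  exact hL f

/-- Lipschitz images of boxes in `ℝ³`. -/
theorem exists_volume_lipschitz : ∃ A : ℝ≥0∞, A ≠ ∞ ∧
    (∀ (f : ℝ × ℝ × ℝ → R3) (K : ℝ≥0) (s : Set (ℝ × ℝ × ℝ)), LipschitzOnWith K f s →
      volume (f '' s) ≤ A * (K : ℝ≥0∞) ^ (3 : ℝ) * volume s) ∧
    ∀ (f : R3 → ℝ × ℝ × ℝ) (K : ℝ≥0) (s : Set R3), LipschitzOnWith K f s →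
      volume (f '' s) ≤ A * (K : ℝ≥0∞) ^ (3 : ℝ) * volume s := by
  have i1 : (μH[3] : Measure R3).IsAddHaarMeasure := by
    have := isAddHaarMeasure_hausdorffMeasure (E := R3)
    simpa using this
  have i2 : (μH[3] : Measure (ℝ × ℝ × ℝ)).IsAddHaarMeasure := by
    have := isAddHaarMeasure_hausdorffMeasure (E := ℝ × ℝ × ℝ)
    have e : Module.finrank ℝ (ℝ × ℝ × ℝ) = 3 := by simp
    rw [e] at this
    exact_mod_cast this
  have i3 : (volume : Measure (ℝ × ℝ)).IsAddHaarMeasure := by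
    rw [Measure.volume_eq_prod]; exact Measure.prod.instIsAddHaarMeasure _ _
  have i4 : (volume : Measure (ℝ × ℝ × ℝ)).IsAddHaarMeasure := by
    rw [Measure.volume_eq_prod]; exact Measure.prod.instIsAddHaarMeasure _ _
  have e1 := Measure.isAddLeftInvariant_eq_smul (μH[3] : Measure R3) volume
  have e2 := Measure.isAddLeftInvariant_eq_smul (μH[3] : Measure (ℝ × ℝ × ℝ)) volume
  have f1 := Measure.isAddLeftInvariant_eq_smul (volume : Measure R3) μH[3]
  have f2 := Measure.isAddLeftInvariant_eq_smul (volume : Measure (ℝ × ℝ × ℝ)) μH[3]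
  set a1 := (Measure.addHaarScalarFactor (μH[3] : Measure R3) volume)
  set a2 := (Measure.addHaarScalarFactor (μH[3] : Measure (ℝ × ℝ × ℝ)) volume)
  set b1 := (Measure.addHaarScalarFactor (volume : Measure R3) μH[3])
  set b2 := (Measure.addHaarScalarFactor (volume : Measure (ℝ × ℝ × ℝ)) μH[3])
  refine ⟨b1 * a2 + b2 * a1, by finiteness, fun f K s h => ?_, fun f K s h => ?_⟩
  · have := h.hausdorffMeasure_image_le (d := 3) (by norm_num)
    calc volume (f '' s) = b1 * μH[3] (f '' s) := by rw [f1]; rfl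
      _ ≤ b1 * (K ^ (3 : ℝ) * (a2 * volume s)) := by
        refine mul_le_mul_right (this.trans (mul_le_mul_right (le_of_eq ?_) _)) _
        rw [e2]; rfl
      _ = (b1 * a2) * K ^ (3 : ℝ) * volume s := by ring
      _ ≤ _ := by gcongr; exact le_self_add
  · have := h.hausdorffMeasure_image_le (d := 3) (by norm_num)
    calc volume (f '' s) = b2 * μH[3] (f '' s) := by rw [f2]; rfl
      _ ≤ b2 * (K ^ (3 : ℝ) * (a1 * volume s)) := by
        refine mul_le_mul_right (this.trans (mul_le_mul_right (le_of_eq ?_) _)) _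
        rw [e1]; rfl
      _ = (b2 * a1) * K ^ (3 : ℝ) * volume s := by ring
      _ ≤ _ := by gcongr; exact le_add_self

end MeasureConstruction

section SurfaceMeasure

open Set Filter Topology MeasureTheory Metric
open scoped NNReal ENNReal

theorem integral_fderiv_add_divergence {g : R3 → ℝ} (hg : ContDiff ℝ 1 g) (hc : HasCompactSupport g)
    {v : R3 → R3} (hv : ContDiff ℝ 1 v) :
    ∫ z, fderiv ℝ g z (v z) = -∫ z, g z * dv v z := by
  have hdg : Continuous fun z => fderiv ℝ g z := hg.continuous_fderiv (by simp)
  have hdv : Continuous fun z => fderiv ℝ v z := hv.continuous_fderiv (by simp)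
  have hvi : ∀ i : Fin 3, ContDiff ℝ 1 fun z => v z i := fun i => (contDiff_coord i).comp hv
  have hdvi : ∀ i : Fin 3, Continuous fun z => fderiv ℝ (fun z => v z i) z := fun i =>
    (hvi i).continuous_fderiv (by simp)
  have hcoord : ∀ (i : Fin 3) z u, fderiv ℝ (fun z => v z i) z u = fderiv ℝ v z u i := fun i z u => by
    rw [(hasFDerivAt_coord (hv.differentiable (by simp) z) i).fderiv]
    rfl
  have i1 : ∀ i : Fin 3, Integrable fun z => v z i * fderiv ℝ g z (e3 i) := fun i =>
    (((hvi i).continuous.mul (hdg.clm_apply continuous_const))).integrable_of_hasCompactSupport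
      (((hc.fderiv_apply (𝕜 := ℝ) (e3 i))).mul_left)
  have i2 : ∀ i : Fin 3, Integrable fun z => fderiv ℝ (fun z => v z i) z (e3 i) * g z := fun i =>
    (((hdvi i).clm_apply continuous_const).mul hg.continuous).integrable_of_hasCompactSupport
      hc.mul_left
  have key : ∀ i : Fin 3, ∫ z, v z i * fderiv ℝ g z (e3 i) =
      -∫ z, fderiv ℝ (fun z => v z i) z (e3 i) * g z := fun i =>
    integral_mul_fderiv_eq_neg_fderiv_mul_of_integrable (i2 i) (i1 i)
      (((hvi i).continuous.mul hg.continuous).integrable_of_hasCompactSupport hc.mul_left)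
      (fun x _ => (hvi i).differentiable (by simp) x) fun x _ => hg.differentiable (by simp) x
  have e1 : ∀ z, fderiv ℝ g z (v z) = ∑ i : Fin 3, v z i * fderiv ℝ g z (e3 i) := fun z => by
    conv_lhs => rw [sum_coord_smul (v z)]
    simp [Fin.sum_univ_three]
  have e2 : ∀ z, g z * dv v z = ∑ i : Fin 3, fderiv ℝ (fun z => v z i) z (e3 i) * g z := fun z => by
    rw [dv, Finset.mul_sum]
    exact Finset.sum_congr rfl fun i _ => by rw [hcoord, mul_comm]
  simp_rw [e1, e2]
  rw [integral_finsetSum _ fun i _ => i1 i, integral_finsetSum _ fun i _ => i2 i,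
    ← Finset.sum_neg_distrib]
  exact Finset.sum_congr rfl fun i _ => key i

namespace FramedSurface

variable (S : FramedSurface)

theorem eventually_mem_of_open {W : Set R3} (hW : IsOpen W) (h : S.Λ ⊆ W) :
    ∀ᶠ ε : ℝ in 𝓝[>] 0, ∀ z ∈ S.V, |S.q z| ≤ 2 * ε → z ∈ W := by
  have hK : IsCompact (S.V \ W) := S.isCompact_V.diff hW
  rcases (S.V \ W).eq_empty_or_nonempty with he | hne
  · exact Eventually.of_forall fun ε z hz _ => by
      by_contra hzW
      exact (he ▸ (⟨hz, hzW⟩ : z ∈ S.V \ W) : z ∈ (∅ : Set R3))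
  · obtain ⟨z₀, hz₀, hmin⟩ := hK.exists_isMinOn hne
      (f := fun z => |S.q z|) S.smooth_q.continuous.abs.continuousOn
    have hpos : 0 < |S.q z₀| := abs_pos.2 fun h0 => hz₀.2 (h ((S.mem_Λ_iff _ hz₀.1).2 h0))
    have : ∀ᶠ ε : ℝ in 𝓝[>] 0, ε < |S.q z₀| / 2 :=
      mem_of_superset (Ioo_mem_nhdsGT (half_pos hpos)) fun ε hε => hε.2
    filter_upwards [this] with ε hε z hz hq
    by_contra hzW
    have : |S.q z₀| ≤ |S.q z| := hmin ⟨hz, hzW⟩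
    linarith

theorem exists_local_mass {x₀ : R3} (hx₀ : x₀ ∈ S.Λ) : ∃ κ C : ℝ, 0 < κ ∧ 0 < C ∧ ∀ ε : ℝ, 0 < ε →
    volume (ball x₀ κ ∩ {z | |S.q z| ≤ 2 * ε}) ≤ ENNReal.ofReal (C * ε) := by
  obtain ⟨A, hA, hA1, -⟩ := exists_volume_lipschitz
  obtain ⟨r, κ, C, hr, -, hκ, hC, H⟩ := S.exists_chart (S.Λ_subset_O hx₀) one_pos
  obtain ⟨hb, hs, hq⟩ := H x₀ (mem_ball_self hr)
  refine ⟨κ, (A.toReal * C ^ 3 * (2 * r) * (2 * r) * (4 * C)) + 1, hκ, by positivity,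
    fun ε hε => ?_⟩
  set B : Set (ℝ × ℝ × ℝ) := {p | p ∈ ball 0 r ∧ |p.2.2| ≤ 2 * C * ε} with hB
  have hsub : ball x₀ κ ∩ {z | |S.q z| ≤ 2 * ε} ⊆ S.chart (S.n x₀) x₀ '' B := by
    rintro z ⟨hz, hzq⟩
    obtain ⟨p, hp, rfl⟩ := hs z (by rw [← dist_eq_norm]; exact (mem_ball.1 hz).le)
    refine ⟨p, ⟨hp, ?_⟩, rfl⟩
    have hpr := mem_ball_zero_iff.1 hp
    have h2 := norm_snd_le p
    have h3 := norm_snd_le p.2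
    have := (hq p.2.2 0 (by rw [← Real.norm_eq_abs]; linarith) (by simpa using hr)).1
    rw [zero_smul, add_zero, S.q_eq_zero hx₀, sub_zero, sub_zero, ← S.q_chart] at this
    have hzq' : |S.q (S.chart (S.n x₀) x₀ p)| ≤ 2 * ε := hzq
    nlinarith
  have hlip : LipschitzOnWith C.toNNReal (S.chart (S.n x₀) x₀) B :=
    LipschitzOnWith.of_dist_le_mul fun p hp p' hp' => by
      rw [dist_eq_norm, dist_eq_norm, Real.coe_toNNReal C hC.le]
      exact (hb p hp.1 p' hp'.1).2
  have hBsub : B ⊆ Icc (-r) r ×ˢ Icc (-r) r ×ˢ Icc (-(2 * C * ε)) (2 * C * ε) := by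
    rintro p ⟨hp, hp'⟩
    have hpr := mem_ball_zero_iff.1 hp
    have h1 := norm_fst_le p
    have h2 := norm_snd_le p
    have h4 := norm_fst_le p.2
    rw [Real.norm_eq_abs] at h1 h4
    exact ⟨abs_le.1 (by linarith), abs_le.1 (by linarith), abs_le.1 hp'⟩
  have hvol : volume B ≤ ENNReal.ofReal ((2 * r) * ((2 * r) * (4 * C * ε))) := by
    refine (measure_mono hBsub).trans (le_of_eq ?_)
    rw [Measure.volume_eq_prod, Measure.prod_prod, Measure.volume_eq_prod, Measure.prod_prod,
      Real.volume_Icc, Real.volume_Icc, ← ENNReal.ofReal_mul (by linarith),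
      ← ENNReal.ofReal_mul (by linarith)]
    congr 1
    ring
  have hCe : (C.toNNReal : ℝ≥0∞) ^ (3 : ℝ) = ENNReal.ofReal (C ^ 3) := by
    rw [ENNReal.ofReal_pow hC.le, ENNReal.ofReal]
    norm_cast
  calc _ ≤ _ := measure_mono hsub
    _ ≤ _ := hA1 _ _ _ hlip
    _ ≤ A * ENNReal.ofReal (C ^ 3) * ENNReal.ofReal ((2 * r) * ((2 * r) * (4 * C * ε))) := by
      rw [hCe]; gcongr
    _ = ENNReal.ofReal (A.toReal * C ^ 3 * ((2 * r) * ((2 * r) * (4 * C * ε)))) := by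
      rw [ENNReal.ofReal_mul (p := A.toReal * C ^ 3) (by positivity),
        ENNReal.ofReal_mul (p := A.toReal) (by positivity), ENNReal.ofReal_toReal hA]
    _ ≤ _ := by
      apply ENNReal.ofReal_le_ofReal
      nlinarith

theorem exists_mass : ∃ C : ℝ, 0 < C ∧ ∀ᶠ ε : ℝ in 𝓝[>] 0,
    volume (S.V ∩ {z | |S.q z| ≤ 2 * ε}) ≤ ENNReal.ofReal (C * ε) := by
  choose! κ C hκ hC H using fun x₀ (hx₀ : x₀ ∈ S.Λ) => S.exists_local_mass hx₀
  obtain ⟨t, ht, hcov⟩ := S.isCompact_Λ.elim_nhds_subcover (fun x => ball x (κ x))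
    fun x hx => ball_mem_nhds x (hκ x hx)
  have hsum : 0 ≤ ∑ x ∈ t, C x := Finset.sum_nonneg fun x hx => (hC x (ht x hx)).le
  refine ⟨∑ x ∈ t, C x + 1, by positivity, ?_⟩
  filter_upwards [S.eventually_mem_of_open (isOpen_biUnion fun x _ => isOpen_ball) hcov,
    self_mem_nhdsWithin] with ε hε hε0
  have hε0' : 0 < ε := hε0
  calc _ ≤ volume (⋃ x ∈ t, (ball x (κ x) ∩ {z | |S.q z| ≤ 2 * ε})) := by
        refine measure_mono fun z hz => ?_
        obtain ⟨x, hx, hzx⟩ := mem_iUnion₂.1 (hε z hz.1 hz.2)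
        exact mem_biUnion hx ⟨hzx, hz.2⟩
    _ ≤ ∑ x ∈ t, volume (ball x (κ x) ∩ {z | |S.q z| ≤ 2 * ε}) := measure_biUnion_finset_le _ _
    _ ≤ ∑ x ∈ t, ENNReal.ofReal (C x * ε) := Finset.sum_le_sum fun x hx => H x (ht x hx) ε hε0
    _ = ENNReal.ofReal (∑ x ∈ t, C x * ε) := by
      rw [ENNReal.ofReal_sum_of_nonneg fun x hx => mul_nonneg (hC x (ht x hx)).le hε0'.le]
    _ ≤ _ := by
      apply ENNReal.ofReal_le_ofReal
      rw [← Finset.sum_mul]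
      nlinarith

/-- A smooth function supported near the surface and equal to one on a neighbourhood of it. -/
structure Cutoff where
  η : R3 → ℝ
  W : Set R3
  smooth : ContDiff ℝ (⊤ : ℕ∞) η
  cs : HasCompactSupport η
  nonneg : ∀ z, 0 ≤ η z
  supp : tsupport η ⊆ S.V
  isOpen_W : IsOpen W
  subset_W : S.Λ ⊆ W
  one : ∀ z ∈ W, η z = 1
  W_subset : W ⊆ S.V

theorem nonempty_cutoff : Nonempty S.Cutoff := by
  obtain ⟨η, O, h1, h2, h3, h4, h5, h6, h7⟩ := exists_cutoff S.isCompact_Λ isOpen_interior S.Λ_subset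
  exact ⟨fun z => η z * η z, O, h1.mul h1, h2.mul_right, fun z => mul_self_nonneg _,
    (tsupport_mul_subset_left.trans h3).trans interior_subset, h4, h5,
    fun z hz => by simp [h7 z hz], h6.trans interior_subset⟩

/-- A fixed even bump function on the line. -/
def lineBump : ContDiffBump (0 : ℝ) := ⟨1, 2, one_pos, one_lt_two⟩

namespace Cutoff

variable {S} (c : S.Cutoff)

/-- The same cutoff, for the exchanged frame. -/
def swap : S.swap.Cutoff := { c with }

/-- A weight concentrating on the surface as `ε → 0`. -/
def w (ε : ℝ) (z : R3) : ℝ := c.η z * lineBump (S.q z / ε)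

theorem w_swap (ε : ℝ) : c.swap.w ε = c.w ε := by
  funext z
  change c.η z * lineBump (-S.q z / ε) = c.η z * lineBump (S.q z / ε)
  rw [neg_div, ContDiffBump.neg]

theorem smooth_w (ε : ℝ) : ContDiff ℝ (⊤ : ℕ∞) (c.w ε) :=
  c.smooth.mul (lineBump.contDiff.comp (S.smooth_q.div_const ε))

theorem cs_w (ε : ℝ) : HasCompactSupport (c.w ε) := c.cs.mul_right

theorem w_nonneg (ε : ℝ) (z : R3) : 0 ≤ c.w ε z := mul_nonneg (c.nonneg z) lineBump.nonneg

theorem w_eq_zero {ε : ℝ} (hε : 0 < ε) {z : R3} (hz : ¬(z ∈ S.V ∧ |S.q z| ≤ 2 * ε)) :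
    c.w ε z = 0 := by
  by_cases h : z ∈ S.V
  · have : 2 * ε < |S.q z| := by
      by_contra h'
      exact hz ⟨h, not_lt.1 h'⟩
    rw [w, lineBump.zero_of_le_dist, mul_zero]
    rw [dist_zero_right, Real.norm_eq_abs, abs_div, abs_of_pos hε, le_div_iff₀ hε]
    exact this.le
  · rw [w, image_eq_zero_of_notMem_tsupport fun h' => h (c.supp h'), zero_mul]

theorem w_eq_one {ε : ℝ} (hε : 0 < ε) {z : R3} (hz : z ∈ c.W) (h : |S.q z| ≤ ε) : c.w ε z = 1 := by
  rw [w, c.one z hz, lineBump.one_of_mem_closedBall, mul_one]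
  rw [mem_closedBall, dist_zero_right, Real.norm_eq_abs, abs_div, abs_of_pos hε,
    div_le_iff₀ hε]
  simpa [lineBump] using h

theorem integrable_mul_w {f : R3 → ℝ} (hf : Continuous f) (ε : ℝ) :
    Integrable fun z => f z * c.w ε z :=
  (hf.mul (c.smooth_w ε).continuous).integrable_of_hasCompactSupport (c.cs_w ε).mul_left

/-- The average of a function with respect to the weight. -/
def avg (ε : ℝ) : C(R3, ℝ) →ₗ[ℝ] ℝ where
  toFun f := |ε|⁻¹ * ∫ z, f z * c.w ε z
  map_add' f g := by
    simp only [ContinuousMap.add_apply, add_mul]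
    rw [integral_add (c.integrable_mul_w f.continuous ε) (c.integrable_mul_w g.continuous ε), mul_add]
  map_smul' a f := by
    simp only [ContinuousMap.smul_apply, smul_eq_mul, mul_assoc, RingHom.id_apply]
    rw [integral_const_mul]
    ring

theorem exists_avg_bound : ∃ C : ℝ, ∀ (f : C(R3, ℝ)) (b : ℝ), 0 < b → (∀ z ∈ S.Λ, |f z| < b) →
    ∀ᶠ ε : ℝ in 𝓝[>] 0, |c.avg ε f| ≤ C * b := by
  obtain ⟨C, hC, hm⟩ := S.exists_mass
  obtain ⟨N, hN⟩ := c.cs.exists_bound_of_continuous c.smooth.continuous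
  have hN0 : 0 ≤ N := (norm_nonneg _).trans (hN 0)
  refine ⟨N * C, fun f b hb hf => ?_⟩
  have hop : IsOpen {z | |f z| < b} := isOpen_lt f.continuous.abs continuous_const
  filter_upwards [hm, S.eventually_mem_of_open hop hf, self_mem_nhdsWithin] with ε h1 h2 h3
  have hε : 0 < ε := h3
  set A : Set R3 := S.V ∩ {z | |S.q z| ≤ 2 * ε}
  have hAfin : volume A < ∞ := h1.trans_lt ENNReal.ofReal_lt_top
  have e1 : ∫ z, f z * c.w ε z = ∫ z in A, f z * c.w ε z :=
    (setIntegral_eq_integral_of_forall_compl_eq_zero fun z hz => by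
      rw [c.w_eq_zero hε hz, mul_zero]).symm
  have e2 : ‖∫ z in A, f z * c.w ε z‖ ≤ b * N * volume.real A := by
    refine norm_setIntegral_le_of_norm_le_const hAfin fun z hz => ?_
    rw [norm_mul, w, norm_mul]
    have h4 : ‖f z‖ ≤ b := (h2 z hz.1 hz.2).le
    have h5 : ‖lineBump (S.q z / ε)‖ ≤ 1 := by
      rw [Real.norm_of_nonneg lineBump.nonneg]
      exact lineBump.le_one
    have h6 : ‖c.η z‖ * ‖lineBump (S.q z / ε)‖ ≤ N * 1 := by gcongr; exact hN z
    rw [mul_one] at h6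
    gcongr
  have e3 : volume.real A ≤ C * ε := ENNReal.toReal_le_of_le_ofReal (by positivity) h1
  change |(|ε|⁻¹ * ∫ z, f z * c.w ε z)| ≤ _
  rw [abs_mul, abs_inv, abs_abs, abs_of_pos hε, e1, inv_mul_le_iff₀ hε]
  rw [Real.norm_eq_abs] at e2
  refine e2.trans ?_
  calc b * N * volume.real A ≤ b * N * (C * ε) := by gcongr
    _ = _ := by ring

/-- `μ` is the limit of the averages along a fixed ultrafilter. -/
def IsLimit (μ : Measure S.Λ) : Prop :=
  ∀ f : C(R3, ℝ), Tendsto (fun ε => c.avg ε f) (Ultrafilter.of (𝓝[>] (0 : ℝ)) : Filter ℝ)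
    (𝓝 (∫ x, f x ∂μ))

theorem exists_isLimit : ∃ μ : Measure S.Λ, IsFiniteMeasure μ ∧ c.IsLimit μ := by
  obtain ⟨C, hC⟩ := c.exists_avg_bound
  refine exists_measure_of_concentrating S.isCompact_Λ _ c.avg (fun ε f hf => ?_) (C := C)
    fun f b hb hf => Ultrafilter.of_le _ (hC f b hb hf)
  exact mul_nonneg (by positivity) (integral_nonneg fun z => mul_nonneg (hf z) (c.w_nonneg ε z))

theorem IsLimit.swap {μ : Measure S.Λ} (h : c.IsLimit μ) : c.swap.IsLimit (S := S.swap) μ := by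
  intro f
  have e : ∀ ε, c.swap.avg ε f = c.avg ε f := fun ε => by
    change |ε|⁻¹ * ∫ z, f z * c.swap.w ε z = _
    rw [c.w_swap]
    rfl
  simp_rw [e]
  exact h f

theorem eventually_fderiv_w (c : S.Cutoff) :
    ∀ᶠ ε : ℝ in 𝓝[>] 0, ∀ z, fderiv ℝ (c.w ε) z (S.X z) = 0 := by
  filter_upwards [S.eventually_mem_of_open c.isOpen_W c.subset_W, self_mem_nhdsWithin] with ε h hε z
  have hε : 0 < ε := hε
  have h1 : HasFDerivAt (fun z => lineBump (S.q z / ε)) _ z :=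
    ((lineBump.contDiff (n := 1)).differentiable (by simp) _).hasFDerivAt.comp z
      ((S.differentiable_q z).hasFDerivAt.mul_const ε⁻¹)
  have h2 := ((c.smooth.differentiable (by simp)) z).hasFDerivAt.mul h1
  have h3 : fderiv ℝ (c.w ε) z = _ := h2.fderiv
  rw [h3]
  have h4 : ∀ L : ℝ →L[ℝ] ℝ, (L.comp (ε⁻¹ • fderiv ℝ S.q z)) (S.X z) = 0 := fun L => by
    rw [ContinuousLinearMap.comp_apply, _root_.smul_apply, S.dqX, smul_zero, map_zero]
  simp only [_root_.add_apply, _root_.smul_apply, h4, smul_eq_mul, mul_zero, zero_add]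
  by_cases hz : z ∈ S.V ∧ |S.q z| ≤ 2 * ε
  · have : c.η =ᶠ[𝓝 z] fun _ => 1 := by
      filter_upwards [c.isOpen_W.mem_nhds (h z hz.1 hz.2)] with y hy using c.one y hy
    rw [this.fderiv_eq]
    simp
  · by_cases hV : z ∈ S.V
    · have h5 : lineBump (S.q z / ε) = 0 := lineBump.zero_of_le_dist (by
        rw [dist_zero_right, Real.norm_eq_abs, abs_div, abs_of_pos hε, le_div_iff₀ hε]
        exact (not_le.1 fun h' => hz ⟨hV, h'⟩).le)
      rw [h5, zero_mul]
    · have : fderiv ℝ c.η z = 0 := by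
        by_contra hne
        exact hV (c.supp (support_fderiv_subset ℝ hne))
      simp [this]

theorem IsLimit.integral_fderiv {μ : Measure S.Λ} (h : c.IsLimit μ) {f : R3 → ℝ}
    (hf : ContDiff ℝ 1 f) :
    ∫ x : S.Λ, fderiv ℝ f x (S.X x) ∂μ = -∫ x : S.Λ, f x * dv S.X x ∂μ := by
  have hX : ContDiff ℝ 1 S.X := S.smooth_X.of_le (by exact_mod_cast le_top)
  have c1 : Continuous fun z => fderiv ℝ f z (S.X z) :=
    (hf.continuous_fderiv (by simp)).clm_apply S.smooth_X.continuous
  have cdv : Continuous (dv S.X) := by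
    unfold dv
    refine continuous_finsetSum _ fun i _ => ?_
    exact (contDiff_coord (n := 0) i).continuous.comp
      ((hX.continuous_fderiv (by simp)).clm_apply continuous_const)
  have c2 : Continuous fun z => f z * dv S.X z := hf.continuous.mul cdv
  refine tendsto_nhds_unique (h ⟨_, c1⟩) (((h ⟨_, c2⟩).neg).congr' ?_)
  refine Ultrafilter.of_le _ ?_
  filter_upwards [eventually_fderiv_w c] with ε hε
  change -(|ε|⁻¹ * ∫ z, (f z * dv S.X z) * c.w ε z) = |ε|⁻¹ * ∫ z, fderiv ℝ f z (S.X z) * c.w ε z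
  have hw : ContDiff ℝ 1 (c.w ε) := (c.smooth_w ε).of_le (by exact_mod_cast le_top)
  have h1 := integral_fderiv_add_divergence (hf.mul hw) ((c.cs_w ε).mul_left) hX
  have e1 : ∀ z, fderiv ℝ (fun z => f z * c.w ε z) z (S.X z) = fderiv ℝ f z (S.X z) * c.w ε z := by
    intro z
    have := ((hf.differentiable (by simp) z).hasFDerivAt.mul
      (hw.differentiable (by simp) z).hasFDerivAt).fderiv
    have h' : fderiv ℝ (fun z => f z * c.w ε z) z = _ := this
    rw [h']
    simp only [_root_.add_apply, _root_.smul_apply, hε z, smul_eq_mul, mul_zero, zero_add]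
    ring
  have h1' : ∫ z, fderiv ℝ (fun z => f z * c.w ε z) z (S.X z) =
    -∫ z, (f z * c.w ε z) * dv S.X z := h1
  simp_rw [e1] at h1'
  rw [h1', mul_neg]
  congr 3
  funext z
  ring

end Cutoff

end FramedSurface

end SurfaceMeasure

section LowerBound

open Set Filter Topology MeasureTheory Metric
open scoped NNReal ENNReal

theorem exists_setIntegral_comp_le : ∃ A : ℝ, 0 < A ∧ ∀ (Ψ : ℝ × ℝ × ℝ → R3) (C : ℝ)
    (B : Set (ℝ × ℝ × ℝ)) (F : R3 → ℝ), 0 ≤ C → IsCompact B → Continuous Ψ → Continuous F →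
      (∀ z, 0 ≤ F z) → (∀ p ∈ B, ∀ p' ∈ B, ‖p - p'‖ ≤ C * ‖Ψ p - Ψ p'‖) →
      ∫ p in B, F (Ψ p) ≤ A * C ^ 3 * ∫ z in Ψ '' B, F z := by
  obtain ⟨A, hA, -, hA2⟩ := exists_volume_lipschitz
  refine ⟨A.toReal + 1, by positivity, fun Ψ C B F hC hB hΨ hF hF0 hlip => ?_⟩
  have hinj : InjOn Ψ B := fun p hp p' hp' h => by
    have := hlip p hp p' hp'
    rw [h, sub_self, norm_zero, mul_zero] at this
    exact sub_eq_zero.1 (norm_le_zero_iff.1 this)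
  have hinv : LipschitzOnWith C.toNNReal (Function.invFunOn Ψ B) (Ψ '' B) :=
    LipschitzOnWith.of_dist_le_mul fun z hz z' hz' => by
      obtain ⟨p, hp, rfl⟩ := hz
      obtain ⟨p', hp', rfl⟩ := hz'
      rw [hinj.leftInvOn_invFunOn hp, hinj.leftInvOn_invFunOn hp', dist_eq_norm, dist_eq_norm,
        Real.coe_toNNReal C hC]
      exact hlip p hp p' hp'
  have hK : IsCompact (Ψ '' B) := hB.image hΨ
  have hCe : (C.toNNReal : ℝ≥0∞) ^ (3 : ℝ) = ENNReal.ofReal (C ^ 3) := by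
    rw [ENNReal.ofReal_pow hC, ENNReal.ofReal]
    norm_cast
  have hle : (volume.restrict B).map Ψ ≤
      ENNReal.ofReal ((A.toReal + 1) * C ^ 3) • volume.restrict (Ψ '' B) := by
    refine Measure.le_iff.2 fun s hs => ?_
    rw [Measure.map_apply hΨ.measurable hs, Measure.restrict_apply (hΨ.measurable hs),
      Measure.smul_apply, Measure.restrict_apply hs, smul_eq_mul]
    have hsub : Ψ ⁻¹' s ∩ B ⊆ Function.invFunOn Ψ B '' (s ∩ Ψ '' B) := fun p hp =>
      ⟨Ψ p, ⟨hp.1, p, hp.2, rfl⟩, hinj.leftInvOn_invFunOn hp.2⟩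
    refine (measure_mono hsub).trans ((hA2 _ _ _ (hinv.mono inter_subset_right)).trans ?_)
    gcongr
    rw [hCe, ENNReal.ofReal_mul (by positivity)]
    gcongr
    rw [← ENNReal.ofReal_toReal hA]
    apply ENNReal.ofReal_le_ofReal
    simp
  have hint : Integrable F (ENNReal.ofReal ((A.toReal + 1) * C ^ 3) • volume.restrict (Ψ '' B)) :=
    (hF.continuousOn.integrableOn_compact hK).smul_measure ENNReal.ofReal_ne_top
  calc ∫ p in B, F (Ψ p) = ∫ z, F z ∂((volume.restrict B).map Ψ) :=
        (integral_map hΨ.measurable.aemeasurable hF.aestronglyMeasurable).symm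
    _ ≤ ∫ z, F z ∂(ENNReal.ofReal ((A.toReal + 1) * C ^ 3) • volume.restrict (Ψ '' B)) :=
      integral_mono_measure hle (Eventually.of_forall hF0) hint
    _ = _ := by
      rw [integral_smul_measure, ENNReal.toReal_ofReal (by positivity), smul_eq_mul]

theorem setIntegral_prod_symm_interval {g : ℝ → ℝ → ℝ} (hg : Continuous fun p : ℝ × ℝ => g p.1 p.2)
    {K K' : Set ℝ} (hK : IsCompact K) (hK' : IsCompact K') {e : ℝ} (he : 0 ≤ e) :
    ∫ p in K ×ˢ K' ×ˢ Icc (-e) e, g p.1 p.2.1 = 2 * e * ∫ p in K ×ˢ K', g p.1 p.2 := by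
  have h1 : Continuous fun p : ℝ × ℝ × ℝ => g p.1 p.2.1 :=
    hg.comp (by fun_prop : Continuous fun p : ℝ × ℝ × ℝ => (p.1, p.2.1))
  rw [Measure.volume_eq_prod, setIntegral_prod _
      (h1.continuousOn.integrableOn_compact (hK.prod (hK'.prod isCompact_Icc))),
    Measure.volume_eq_prod, setIntegral_prod (s := K) (t := K') _
      (hg.continuousOn.integrableOn_compact (hK.prod hK')), ← integral_const_mul]
  refine integral_congr_ae (Eventually.of_forall fun s => ?_)
  have h2 : Continuous fun p : ℝ × ℝ => g s p.1 :=
    hg.comp (by fun_prop : Continuous fun p : ℝ × ℝ => (s, p.1))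
  beta_reduce
  rw [setIntegral_prod _ (h2.continuousOn.integrableOn_compact (hK'.prod isCompact_Icc)),
    ← integral_const_mul]
  refine integral_congr_ae (Eventually.of_forall fun t => ?_)
  simp only [integral_const, MeasurableSet.univ, measureReal_restrict_apply, univ_inter, smul_eq_mul]
  rw [Real.volume_real_Icc_of_le (by linarith)]
  ring

namespace FramedSurface

variable (S : FramedSurface)

theorem continuous_flow_comp (x : R3) : Continuous fun p : ℝ × ℝ => S.ψ p.2 (S.φ p.1 x) :=
  S.continuous_ψ.comp ((by fun_prop : Continuous fun p : ℝ × ℝ => p.2).prodMk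
    (S.continuous_φ.comp (by fun_prop : Continuous fun p : ℝ × ℝ => (p.1, x))))

namespace Cutoff

variable {S} {c : S.Cutoff} {μ : Measure S.Λ}

theorem IsLimit.exists_local_lower_bound (h : c.IsLimit μ) {x₀ : R3} (hx₀ : x₀ ∈ S.Λ) :
    ∃ δ C : ℝ, 0 < δ ∧ 0 < C ∧ ∀ x ∈ S.Λ ∩ ball x₀ δ, ∀ F : C(R3, ℝ), (∀ z, 0 ≤ F z) →
      ∫ p in Icc 0 δ ×ˢ Icc 0 δ, F (S.ψ p.2 (S.φ p.1 x)) ≤ C * ∫ z : S.Λ, F z ∂μ := by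
  obtain ⟨A, hA, HA⟩ := exists_setIntegral_comp_le
  obtain ⟨r, κ, C, hr, -, -, hC, H⟩ := S.exists_chart (S.Λ_subset_O hx₀) one_pos
  obtain ⟨ρ, hρ, hW⟩ : ∃ ρ > 0, ∀ q ∈ ball ((x₀, 0) : R3 × ℝ × ℝ × ℝ) ρ,
      S.chart (S.n x₀) q.1 q.2 ∈ c.W := by
    have : ∀ᶠ q in 𝓝 ((x₀, 0) : R3 × ℝ × ℝ × ℝ), S.chart (S.n x₀) q.1 q.2 ∈ c.W := by
      refine (S.continuous_chart (S.n x₀)).continuousAt.eventually_mem (c.isOpen_W.mem_nhds ?_)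
      change S.chart (S.n x₀) x₀ 0 ∈ c.W
      rw [S.chart_zero]
      exact c.subset_W hx₀
    exact Metric.mem_nhds_iff.1 this
  set δ := min ρ r / 2 with hδdef
  have hδ : 0 < δ := by positivity
  have hδρ : δ < ρ := by have := min_le_left ρ r; linarith
  have hδr : δ < r := by have := min_le_right ρ r; linarith
  refine ⟨δ, A * C ^ 4 / 2, hδ, by positivity, fun x hx F hF => ?_⟩
  obtain ⟨hb, -, hq⟩ := H x (ball_subset_ball hδr.le hx.2)
  set Ψ := S.chart (S.n x₀) x with hΨdef
  have hΨ : Continuous Ψ := (S.continuous_chart (S.n x₀)).comp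
    (by fun_prop : Continuous fun p : ℝ × ℝ × ℝ => (x, p))
  set g : ℝ → ℝ → ℝ := fun s t => F (S.ψ t (S.φ s x)) with hg
  have hgc : Continuous fun p : ℝ × ℝ => g p.1 p.2 := F.continuous.comp (S.continuous_flow_comp x)
  have hg0 : ∀ s t, g s t = F (Ψ (s, t, 0)) := fun s t => by simp [hΨdef, FlowFrame.chart, hg]
  set I := ∫ p in Icc 0 δ ×ˢ Icc 0 δ, g p.1 p.2
  change I ≤ _
  have key : ∀ η > 0, 2 / C * (I - η * δ ^ 2) ≤ A * C ^ 3 * ∫ z : S.Λ, F z ∂μ := by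
    intro η hη
    refine ge_of_tendsto ((h F).const_mul (A * C ^ 3)) (Ultrafilter.of_le _ ?_)
    have hK : IsCompact (Icc 0 δ ×ˢ Icc 0 δ ×ˢ Icc (-δ) δ : Set (ℝ × ℝ × ℝ)) :=
      isCompact_Icc.prod (isCompact_Icc.prod isCompact_Icc)
    have huc := hK.uniformContinuousOn_of_continuous (F.continuous.comp hΨ).continuousOn
    obtain ⟨θ, hθ, hθ'⟩ := Metric.uniformContinuousOn_iff.1 huc η hη
    have hsm : ∀ᶠ ε : ℝ in 𝓝[>] 0, ε < C * min δ θ :=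
      mem_of_superset (Ioo_mem_nhdsGT (by positivity)) fun ε hε => hε.2
    filter_upwards [hsm, self_mem_nhdsWithin] with ε h1 h2
    have hε : 0 < ε := h2
    set e := ε / C with hedef
    have he : 0 < e := by positivity
    have heδ : e < min δ θ := by rw [hedef, div_lt_iff₀ hC]; linarith
    have heδ' : e < δ := heδ.trans_le (min_le_left _ _)
    set B : Set (ℝ × ℝ × ℝ) := Icc 0 δ ×ˢ Icc 0 δ ×ˢ Icc (-e) e with hB
    have hBK : B ⊆ Icc 0 δ ×ˢ Icc 0 δ ×ˢ Icc (-δ) δ :=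
      prod_mono le_rfl (prod_mono le_rfl (Icc_subset_Icc (by linarith) heδ'.le))
    have hBc : IsCompact B := isCompact_Icc.prod (isCompact_Icc.prod isCompact_Icc)
    have hBn : ∀ p ∈ B, ‖p‖ ≤ δ := fun p hp => by
      obtain ⟨h1, h2, h3⟩ := hBK hp
      refine norm_prod_le_iff.2 ⟨?_, norm_prod_le_iff.2 ⟨?_, ?_⟩⟩ <;> rw [Real.norm_eq_abs, abs_le]
      · exact ⟨by linarith [h1.1], h1.2⟩
      · exact ⟨by linarith [h2.1], h2.2⟩
      · exact h3
    have hBb : ∀ p ∈ B, p ∈ ball (0 : ℝ × ℝ × ℝ) r := fun p hp =>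
      mem_ball_zero_iff.2 ((hBn p hp).trans_lt hδr)
    have hone : ∀ z ∈ Ψ '' B, c.w ε z = 1 := by
      rintro z ⟨p, hp, rfl⟩
      refine c.w_eq_one hε (hW (x, p) ?_) ?_
      · rw [mem_ball, Prod.dist_eq, max_lt_iff]
        exact ⟨(mem_ball.1 hx.2).trans hδρ, by
          rw [dist_zero_right]; exact (hBn p hp).trans_lt hδρ⟩
      · have h3 := (hq p.2.2 0 (lt_of_le_of_lt (abs_le.2 (hBK hp).2.2) hδr) (by simpa using hr)).2
        rw [zero_smul, add_zero, S.q_eq_zero hx.1, sub_zero, sub_zero, ← S.q_chart] at h3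
        refine h3.trans ?_
        have h4 : |p.2.2| ≤ e := abs_le.2 hp.2.2
        calc C * |p.2.2| ≤ C * e := by gcongr
          _ = ε := by rw [hedef]; field_simp
    have i1 : 2 * e * (I - η * δ ^ 2) ≤ ∫ p in B, F (Ψ p) := by
      have e1 : 2 * e * (I - η * δ ^ 2) = ∫ p in B, (g p.1 p.2.1 - η) := by
        rw [hB, setIntegral_prod_symm_interval (g := fun s t => g s t - η)
          (hgc.sub continuous_const) isCompact_Icc isCompact_Icc he.le]
        congr 1
        rw [integral_sub (hgc.continuousOn.integrableOn_compact (isCompact_Icc.prod isCompact_Icc))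
          (continuousOn_const.integrableOn_compact (isCompact_Icc.prod isCompact_Icc))]
        congr 1
        rw [setIntegral_const, measureReal_def, Measure.volume_eq_prod, Measure.prod_prod,
          ENNReal.toReal_mul, Real.volume_Icc, sub_zero, ENNReal.toReal_ofReal hδ.le, smul_eq_mul]
        ring
      rw [e1]
      have hgc' : Continuous fun p : ℝ × ℝ × ℝ => g p.1 p.2.1 - η :=
        (hgc.comp (by fun_prop : Continuous fun p : ℝ × ℝ × ℝ => (p.1, p.2.1))).sub continuous_const
      refine setIntegral_mono_on (hgc'.continuousOn.integrableOn_compact hBc)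
        ((F.continuous.comp hΨ).continuousOn.integrableOn_compact hBc) hBc.measurableSet
        fun p hp => ?_
      have hp0 : (p.1, p.2.1, (0 : ℝ)) ∈ Icc 0 δ ×ˢ Icc 0 δ ×ˢ Icc (-δ) δ :=
        ⟨hp.1, hp.2.1, by linarith, hδ.le⟩
      have := hθ' _ hp0 p (hBK hp) (by
        rw [Prod.dist_eq, Prod.dist_eq]
        simp only [dist_self, dist_zero_left]
        rw [max_eq_right (le_max_left _ _), max_eq_right (norm_nonneg _), Real.norm_eq_abs]
        exact (abs_le.2 hp.2.2).trans_lt (heδ.trans_le (min_le_right _ _)))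
      rw [hg0]
      rw [Real.dist_eq] at this
      have := (abs_lt.1 this).2
      simp only [Function.comp_apply] at this
      linarith
    have i2 := HA Ψ C B F hC.le hBc hΨ F.continuous hF fun p hp p' hp' =>
      (hb p (hBb p hp) p' (hBb p' hp')).1
    have i3 : ∫ z in Ψ '' B, F z ≤ ∫ z, F z * c.w ε z := by
      rw [setIntegral_congr_fun (g := fun z => F z * c.w ε z) (hBc.image hΨ).measurableSet
        fun z hz => by simp only [hone z hz, mul_one]]
      exact setIntegral_le_integral (c.integrable_mul_w F.continuous ε)
        (Eventually.of_forall fun z => mul_nonneg (hF z) (c.w_nonneg ε z))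
    have i4 : 2 * e * (I - η * δ ^ 2) ≤ A * C ^ 3 * ∫ z, F z * c.w ε z :=
      i1.trans (i2.trans (by gcongr))
    have i5 : A * C ^ 3 * c.avg ε F = ε⁻¹ * (A * C ^ 3 * ∫ z, F z * c.w ε z) := by
      change A * C ^ 3 * (|ε|⁻¹ * ∫ z, F z * c.w ε z) = _
      rw [abs_of_pos hε]
      ring
    have i6 : 2 / C * (I - η * δ ^ 2) = ε⁻¹ * (2 * e * (I - η * δ ^ 2)) := by
      rw [hedef]; field_simp
    rw [i5, i6]
    gcongr
  have hlim : 2 / C * (I - 0 * δ ^ 2) ≤ A * C ^ 3 * ∫ z : S.Λ, F z ∂μ := by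
    have : Tendsto (fun η : ℝ => 2 / C * (I - η * δ ^ 2)) (𝓝[>] 0) (𝓝 (2 / C * (I - 0 * δ ^ 2))) :=
      ((by fun_prop : Continuous fun η : ℝ => 2 / C * (I - η * δ ^ 2)).tendsto 0).mono_left
        nhdsWithin_le_nhds
    exact le_of_tendsto this (by filter_upwards [self_mem_nhdsWithin] with η hη using key η hη)
  calc I = C / 2 * (2 / C * (I - 0 * δ ^ 2)) := by field_simp; ring
    _ ≤ C / 2 * (A * C ^ 3 * ∫ z : S.Λ, F z ∂μ) := by gcongr
    _ = _ := by ring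

theorem IsLimit.exists_lower_bound (h : c.IsLimit μ) :
    ∃ δ C : ℝ, 0 < δ ∧ 0 < C ∧ ∀ x ∈ S.Λ, ∀ F : C(R3, ℝ), (∀ z, 0 ≤ F z) →
      ∫ p in Icc 0 δ ×ˢ Icc 0 δ, F (S.ψ p.2 (S.φ p.1 x)) ≤ C * ∫ z : S.Λ, F z ∂μ := by
  choose! δ C hδ hC H using fun x₀ (hx₀ : x₀ ∈ S.Λ) => h.exists_local_lower_bound hx₀
  obtain ⟨t, ht, hcov⟩ := S.isCompact_Λ.elim_nhds_subcover (fun x => ball x (δ x))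
    fun x hx => ball_mem_nhds x (hδ x hx)
  have hne : t.Nonempty := by
    obtain ⟨x, hx⟩ := S.nonempty_Λ
    obtain ⟨y, hy, -⟩ := mem_iUnion₂.1 (hcov hx)
    exact ⟨y, hy⟩
  obtain ⟨y₀, hy₀, hmin⟩ := t.exists_min_image δ hne
  have hsum : ∀ y ∈ t, C y ≤ ∑ x ∈ t, C x := fun y hy =>
    Finset.single_le_sum (f := C) (fun x hx => (hC x (ht x hx)).le) hy
  refine ⟨δ y₀, ∑ x ∈ t, C x, hδ _ (ht _ hy₀), (hC _ (ht _ hy₀)).trans_le (hsum _ hy₀),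
    fun x hx F hF => ?_⟩
  obtain ⟨y, hy, hxy⟩ := mem_iUnion₂.1 (hcov hx)
  have hI : 0 ≤ ∫ z : S.Λ, F z ∂μ := integral_nonneg fun z => hF z
  have hsub : Icc 0 (δ y₀) ×ˢ Icc 0 (δ y₀) ⊆ Icc 0 (δ y) ×ˢ Icc 0 (δ y) :=
    prod_mono (Icc_subset_Icc_right (hmin y hy)) (Icc_subset_Icc_right (hmin y hy))
  calc _ ≤ ∫ p in Icc 0 (δ y) ×ˢ Icc 0 (δ y), F (S.ψ p.2 (S.φ p.1 x)) :=
        setIntegral_mono_set (((F.continuous.comp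
          (S.continuous_flow_comp x)).continuousOn.integrableOn_compact
            (isCompact_Icc.prod isCompact_Icc)))
          (Eventually.of_forall fun p => hF _) (Eventually.of_forall hsub)
    _ ≤ C y * ∫ z : S.Λ, F z ∂μ := H y (ht y hy) x ⟨hx, hxy⟩ F hF
    _ ≤ _ := by gcongr; exact hsum y hy

end Cutoff

end FramedSurface

end LowerBound

section FlowCalculus

set_option linter.unusedSectionVars false

open Set Filter Topology MeasureTheory
open scoped ENNReal

variable {M : Type*} [MetricSpace M] [CompactSpace M]

/-- Exchange the two derivatives in a space of triples of continuous functions. -/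
def swapTriples (𝒯 : Submodule ℝ (C(M, ℝ) × C(M, ℝ) × C(M, ℝ))) :
    Submodule ℝ (C(M, ℝ) × C(M, ℝ) × C(M, ℝ)) :=
  𝒯.comap (LinearMap.id.prodMap (LinearEquiv.prodComm ℝ C(M, ℝ) C(M, ℝ)).toLinearMap)

theorem mem_swapTriples {𝒯 : Submodule ℝ (C(M, ℝ) × C(M, ℝ) × C(M, ℝ))} {f f1 f2 : C(M, ℝ)} :
    (f, f1, f2) ∈ swapTriples 𝒯 ↔ (f, f2, f1) ∈ 𝒯 := Iff.rfl

section Toolbox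

variable [MeasurableSpace M] [BorelSpace M] (μ : Measure M) [IsFiniteMeasure μ]

/-- The inclusion of continuous functions in `L²`. -/
abbrev toL2 : C(M, ℝ) →L[ℝ] Lp ℝ 2 μ := ContinuousMap.toLp 2 μ ℝ

theorem denseRange_toL2 : DenseRange (toL2 μ) :=
  ContinuousMap.toLp_denseRange ℝ μ ℝ (by simp)

theorem inner_toL2 (f g : C(M, ℝ)) : ⟪toL2 μ f, toL2 μ g⟫ = ∫ x, f x * g x ∂μ := by
  rw [ContinuousMap.inner_toLp]
  simp [mul_comm]

theorem norm_toL2_sq (f : C(M, ℝ)) : ‖toL2 μ f‖ ^ 2 = ∫ x, f x ^ 2 ∂μ := by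
  rw [← real_inner_self_eq_norm_sq, inner_toL2]
  simp [sq]

theorem integrable_cont (f : C(M, ℝ)) : Integrable f μ :=
  f.continuous.integrable_of_hasCompactSupport (HasCompactSupport.of_compactSpace f)

theorem norm_toL2_le {f g : C(M, ℝ)} {K : ℝ} (hK : 0 ≤ K)
    (h : ∫ x, f x ^ 2 ∂μ ≤ K ^ 2 * ∫ x, g x ^ 2 ∂μ) : ‖toL2 μ f‖ ≤ K * ‖toL2 μ g‖ := by
  rw [← norm_toL2_sq, ← norm_toL2_sq, ← mul_pow] at h
  exact le_of_sq_le_sq h (by positivity)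

theorem norm_toL2_mono {f g : C(M, ℝ)} (h : ∀ x, |f x| ≤ |g x|) : ‖toL2 μ f‖ ≤ ‖toL2 μ g‖ := by
  have := norm_toL2_le μ (f := f) (g := g) zero_le_one (by
    rw [one_pow, one_mul]
    exact integral_mono (integrable_cont μ (f ^ 2)) (integrable_cont μ (g ^ 2))
      fun x => sq_le_sq.2 (h x))
  rwa [one_mul] at this

theorem norm_toL2_abs (f : C(M, ℝ)) : ‖toL2 μ |f|‖ = ‖toL2 μ f‖ :=
  le_antisymm (norm_toL2_mono μ fun x => by simp) (norm_toL2_mono μ fun x => by simp)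

theorem integral_abs_mul_le (f g : C(M, ℝ)) :
    ∫ x, |f x * g x| ∂μ ≤ ‖toL2 μ f‖ * ‖toL2 μ g‖ := by
  have : ∫ x, |f x * g x| ∂μ = ⟪toL2 μ |f|, toL2 μ |g|⟫ := by
    rw [inner_toL2]; simp [abs_mul]
  rw [this, ← norm_toL2_abs, ← norm_toL2_abs μ g]
  exact real_inner_le_norm _ _

theorem integral_abs_le (f : C(M, ℝ)) : ∫ x, |f x| ∂μ ≤ ‖toL2 μ 1‖ * ‖toL2 μ f‖ := by
  simpa using integral_abs_mul_le μ 1 f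

/-- The closure in `L²` of a space of triples. -/
def graphL2 (𝒯 : Submodule ℝ (C(M, ℝ) × C(M, ℝ) × C(M, ℝ))) :
    Submodule ℝ (Lp ℝ 2 μ × Lp ℝ 2 μ × Lp ℝ 2 μ) :=
  (𝒯.map ((toL2 μ).toLinearMap.prodMap
    ((toL2 μ).toLinearMap.prodMap (toL2 μ).toLinearMap))).topologicalClosure

variable {μ} {𝒯 : Submodule ℝ (C(M, ℝ) × C(M, ℝ) × C(M, ℝ))}

theorem isClosed_graphL2 : IsClosed (graphL2 μ 𝒯 : Set (Lp ℝ 2 μ × Lp ℝ 2 μ × Lp ℝ 2 μ)) :=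
  Submodule.isClosed_topologicalClosure _

theorem mem_graphL2 {f f1 f2 : C(M, ℝ)} (h : (f, f1, f2) ∈ 𝒯) :
    (toL2 μ f, toL2 μ f1, toL2 μ f2) ∈ graphL2 μ 𝒯 :=
  Submodule.le_topologicalClosure _ ⟨(f, f1, f2), h, rfl⟩

theorem exists_seq_of_mem_graphL2 {w w1 w2 : Lp ℝ 2 μ} (h : (w, w1, w2) ∈ graphL2 μ 𝒯) :
    ∃ f f1 f2 : ℕ → C(M, ℝ), (∀ n, (f n, f1 n, f2 n) ∈ 𝒯) ∧
      Tendsto (fun n => toL2 μ (f n)) atTop (𝓝 w) ∧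
      Tendsto (fun n => toL2 μ (f1 n)) atTop (𝓝 w1) ∧
      Tendsto (fun n => toL2 μ (f2 n)) atTop (𝓝 w2) := by
  have h' : (w, w1, w2) ∈ closure (_ : Set (Lp ℝ 2 μ × Lp ℝ 2 μ × Lp ℝ 2 μ)) := h
  obtain ⟨x, hx, hlim⟩ := mem_closure_iff_seq_limit.1 h'
  choose y hy hyx using hx
  refine ⟨fun n => (y n).1, fun n => (y n).2.1, fun n => (y n).2.2, hy, ?_, ?_, ?_⟩
  · exact ((continuous_fst.tendsto _).comp hlim).congr fun n => by rw [Function.comp_apply, ← hyx]; rfl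
  · exact (((continuous_fst.comp continuous_snd).tendsto _).comp hlim).congr
      fun n => by rw [Function.comp_apply, ← hyx]; rfl
  · exact (((continuous_snd.comp continuous_snd).tendsto _).comp hlim).congr
      fun n => by rw [Function.comp_apply, ← hyx]; rfl

theorem mem_graphL2_swapTriples {w w1 w2 : Lp ℝ 2 μ} (h : (w, w1, w2) ∈ graphL2 μ 𝒯) :
    (w, w2, w1) ∈ graphL2 μ (swapTriples 𝒯) := by
  obtain ⟨f, f1, f2, hf, h0, h1, h2⟩ := exists_seq_of_mem_graphL2 h
  exact isClosed_graphL2.mem_of_tendsto (h0.prodMk_nhds (h2.prodMk_nhds h1))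
    (Eventually.of_forall fun n => mem_graphL2 (mem_swapTriples.2 (hf n)))

theorem mem_of_mem_graphL2_swapTriples {w w1 w2 : Lp ℝ 2 μ}
    (h : (w, w1, w2) ∈ graphL2 μ (swapTriples 𝒯)) : (w, w2, w1) ∈ graphL2 μ 𝒯 := by
  obtain ⟨f, f1, f2, hf, h0, h1, h2⟩ := exists_seq_of_mem_graphL2 h
  exact isClosed_graphL2.mem_of_tendsto (h0.prodMk_nhds (h2.prodMk_nhds h1))
    (Eventually.of_forall fun n => mem_graphL2 (mem_swapTriples.1 (hf n)))

theorem graphL2_swapTriples : graphL2 μ (swapTriples 𝒯) = swapGraph (graphL2 μ 𝒯) :=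
  SetLike.ext fun q => ⟨fun h => mem_of_mem_graphL2_swapTriples (w := q.1) (w1 := q.2.1)
    (w2 := q.2.2) h, fun h => mem_graphL2_swapTriples (w := q.1) (w1 := q.2.2) (w2 := q.2.1) h⟩

end Toolbox

/-- A jointly continuous flow. -/
structure ContFlow (φ : ℝ → C(M, M)) : Prop where
  cont : Continuous fun q : ℝ × M => φ q.1 q.2
  zero : ∀ x, φ 0 x = x
  add : ∀ s t x, φ (s + t) x = φ s (φ t x)

namespace ContFlow

variable {φ : ℝ → C(M, M)} (hφ : ContFlow φ)

include hφ

theorem neg_apply (s : ℝ) (x : M) : φ (-s) (φ s x) = x := by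
  rw [← hφ.add, neg_add_cancel, hφ.zero]

theorem continuous_comp (f : C(M, ℝ)) : Continuous fun s => f.comp (φ s) :=
  ContinuousMap.continuous_of_continuous_uncurry _ (f.continuous.comp hφ.cont)

theorem comp_zero (f : C(M, ℝ)) : f.comp (φ 0) = f := by
  ext x
  simp [hφ.zero]

theorem hasDerivAt_comp {f f1 : C(M, ℝ)}
    (h : ∀ x t, HasDerivAt (fun s => f (φ s x)) (f1 (φ t x)) t) (t : ℝ) :
    HasDerivAt (fun s => f.comp (φ s)) (f1.comp (φ t)) t := by
  have hc := hφ.continuous_comp f1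
  have e : (fun s => f.comp (φ s)) = fun s => f.comp (φ 0) + ∫ r in (0 : ℝ)..s, f1.comp (φ r) := by
    funext s
    ext x
    have h1 := intervalIntegral.integral_eq_sub_of_hasDerivAt (fun r _ => h x r)
      ((f1.continuous.comp (hφ.cont.comp (by fun_prop : Continuous fun r : ℝ =>
        (r, x)))).intervalIntegrable 0 s)
    have h2 := (ContinuousMap.evalCLM ℝ x).intervalIntegral_comp_comm
      (hc.intervalIntegrable (μ := volume) 0 s)
    simp only [ContinuousMap.evalCLM_apply, ContinuousMap.comp_apply] at h2
    rw [ContinuousMap.add_apply, ← h2, h1]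
    simp
  rw [e]
  exact (intervalIntegral.integral_hasDerivAt_right (hc.intervalIntegrable 0 t)
    (hc.stronglyMeasurableAtFilter _ _) hc.continuousAt).const_add _

end ContFlow

variable [MeasurableSpace M] [BorelSpace M]

/-- Triples `(f, X f, Y f)` of continuous functions, with a flow along `X` under which the measure
and the triples behave smoothly. -/
structure DerivationFlow (μ : Measure M) (𝒯 : Submodule ℝ (C(M, ℝ) × C(M, ℝ) × C(M, ℝ)))
    (φ : ℝ → C(M, M)) (b : C(M, ℝ)) (r C : ℝ) : Prop extends ContFlow φ where
  dense : Dense {f | ∃ f1 f2, (f, f1, f2) ∈ 𝒯}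
  one_mem : ((1 : C(M, ℝ)), (0 : C(M, ℝ)), (0 : C(M, ℝ))) ∈ 𝒯
  deriv : ∀ f f1 f2, (f, f1, f2) ∈ 𝒯 → ∀ x t, HasDerivAt (fun s => f (φ s x)) (f1 (φ t x)) t
  ibp : ∀ f f1 f2, (f, f1, f2) ∈ 𝒯 → ∫ x, f1 x ∂μ = ∫ x, b x * f x ∂μ
  r_pos : 0 < r
  C_nonneg : 0 ≤ C
  trans : ∀ h, |h| ≤ r → ∀ f f1 f2, (f, f1, f2) ∈ 𝒯 → ∃ g, (f.comp (φ h), f1.comp (φ h), g) ∈ 𝒯 ∧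
    ∀ x, |g x - f2 (φ h x)| ≤ C * |h| * (|f1 (φ h x)| + |f2 (φ h x)|)

namespace DerivationFlow

variable {μ : Measure M} [IsFiniteMeasure μ] {𝒯 : Submodule ℝ (C(M, ℝ) × C(M, ℝ) × C(M, ℝ))}
  {φ : ℝ → C(M, M)} {b : C(M, ℝ)} {r C : ℝ} (hφ : DerivationFlow μ 𝒯 φ b r C)

include hφ

theorem integral_comp_sub_le_of_mem {f f1 f2 : C(M, ℝ)} (hf : (f, f1, f2) ∈ 𝒯)
    (h0 : ∀ x, 0 ≤ f x) {h : ℝ} (hh : |h| ≤ r) :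
    |∫ x, f (φ h x) ∂μ - ∫ x, f x ∂μ| ≤
      ‖b‖ * Real.exp (‖b‖ * r) * |h| * ∫ x, f x ∂μ := by
  set m : ℝ → ℝ := fun s => ∫ x, f (φ s x) ∂μ with hm
  have hI : ∀ g : C(M, ℝ), Integrable g μ := integrable_cont μ
  have hd : ∀ s, HasDerivAt m (∫ x, f1 (φ s x) ∂μ) s := fun s => by
    have h1 := hφ.hasDerivAt_comp (hφ.deriv f f1 f2 hf) s
    let L : C(M, ℝ) →L[ℝ] ℝ := (innerSL ℝ (toL2 μ 1)).comp (toL2 μ)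
    have hL : ∀ g : C(M, ℝ), L g = ∫ x, g x ∂μ := fun g => by
      change ⟪toL2 μ 1, toL2 μ g⟫ = _
      rw [inner_toL2]
      simp
    have h2 := L.hasFDerivAt.comp_hasDerivAt s h1
    have e : (L ∘ fun s => f.comp (φ s)) = m := by
      funext s; rw [Function.comp_apply, hL]; rfl
    rw [e, hL] at h2
    exact h2
  have hb : ∀ s, |s| ≤ r → ‖∫ x, f1 (φ s x) ∂μ‖ ≤ ‖b‖ * ‖m s‖ := fun s hs => by
    obtain ⟨g, hg, -⟩ := hφ.trans s hs f f1 f2 hf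
    have h1 := hφ.ibp _ _ _ hg
    simp only [ContinuousMap.comp_apply] at h1
    rw [h1]
    have h2 : ‖m s‖ = m s := Real.norm_of_nonneg (integral_nonneg fun x => h0 _)
    rw [h2, hm, ← integral_const_mul]
    refine norm_integral_le_of_norm_le ((hI (f.comp (φ s))).const_mul _) (Eventually.of_forall ?_)
    intro x
    rw [norm_mul, Real.norm_of_nonneg (h0 _)]
    exact mul_le_mul_of_nonneg_right (b.norm_coe_le_norm x) (h0 _)
  have hm0 : m 0 = ∫ x, f x ∂μ := by simp [hm, hφ.zero]
  have hmn : ‖m 0‖ = ∫ x, f x ∂μ := by rw [hm0, Real.norm_of_nonneg (integral_nonneg h0)]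
  have h1 := norm_le_of_deriv_bound (T := r) (norm_nonneg b) le_rfl (fun t _ => hd t)
    (le_refl ‖m 0‖) (fun t ht => by rw [add_zero]; exact hb t ht)
  have h2 : ∀ s ∈ Icc (-|h|) |h|, ‖∫ x, f1 (φ s x) ∂μ‖ ≤
      ‖b‖ * Real.exp (‖b‖ * r) * ∫ x, f x ∂μ := fun s hs => by
    have hs' : |s| ≤ r := (abs_le.2 hs).trans hh
    refine (hb s hs').trans ?_
    have h3 := h1 s hs'
    rw [zero_mul, add_zero, hmn] at h3
    have h4 : Real.exp (‖b‖ * |s|) ≤ Real.exp (‖b‖ * r) := by gcongr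
    have h5 : 0 ≤ ∫ x, f x ∂μ := integral_nonneg h0
    calc ‖b‖ * ‖m s‖ ≤ ‖b‖ * ((∫ x, f x ∂μ) * Real.exp (‖b‖ * r)) := by
          gcongr; exact h3.trans (by gcongr)
      _ = _ := by ring
  have h3 := (convex_Icc (-|h|) |h|).norm_image_sub_le_of_norm_hasDerivWithin_le
    (fun s _ => (hd s).hasDerivWithinAt) h2 (x := 0) (y := h) ⟨by simp, by simp⟩
    ⟨neg_abs_le h, le_abs_self h⟩
  rw [sub_zero, hm0, Real.norm_eq_abs, Real.norm_eq_abs] at h3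
  linarith

theorem integral_comp_sub_le_of_nonneg {f : C(M, ℝ)} (h0 : ∀ x, 0 ≤ f x) {h : ℝ} (hh : |h| ≤ r) :
    |∫ x, f (φ h x) ∂μ - ∫ x, f x ∂μ| ≤
      ‖b‖ * Real.exp (‖b‖ * r) * |h| * ∫ x, f x ∂μ := by
  obtain ⟨g, hg, hlim⟩ := mem_closure_iff_seq_limit.1 (hφ.dense f)
  set k : ℕ → C(M, ℝ) := fun n => g n + ‖g n - f‖ • (1 : C(M, ℝ)) with hk
  have hkl : Tendsto k atTop (𝓝 f) := by
    have h1 : Tendsto (fun n => ‖g n - f‖) atTop (𝓝 0) := by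
      simpa using (hlim.sub_const f).norm
    simpa using hlim.add (h1.smul_const (1 : C(M, ℝ)))
  have cI : ∀ s, Continuous fun f : C(M, ℝ) => ∫ x, f (φ s x) ∂μ := fun s => by
    have : (fun f : C(M, ℝ) => ∫ x, f (φ s x) ∂μ) =
        fun f : C(M, ℝ) => ⟪toL2 μ 1, toL2 μ (f.comp (φ s))⟫ := by
      funext f; rw [inner_toL2]; simp
    rw [this]
    exact continuous_const.inner ((toL2 μ).continuous.comp (ContinuousMap.continuous_precomp _))
  have c0 : Continuous fun f : C(M, ℝ) => ∫ x, f x ∂μ := by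
    simpa [hφ.zero] using cI 0
  have hle : ∀ n, |∫ x, k n (φ h x) ∂μ - ∫ x, k n x ∂μ| ≤
      ‖b‖ * Real.exp (‖b‖ * r) * |h| * ∫ x, k n x ∂μ := fun n => by
    obtain ⟨g1, g2, hgm⟩ := hg n
    have hm : (k n, g1 + ‖g n - f‖ • (0 : C(M, ℝ)), g2 + ‖g n - f‖ • (0 : C(M, ℝ))) ∈ 𝒯 :=
      𝒯.add_mem hgm (𝒯.smul_mem ‖g n - f‖ hφ.one_mem)
    refine hφ.integral_comp_sub_le_of_mem hm (fun x => ?_) hh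
    have h1 := (abs_le.1 ((g n - f).norm_coe_le_norm x)).1
    simp only [ContinuousMap.sub_apply] at h1
    have h2 : k n x = g n x + ‖g n - f‖ * 1 := rfl
    rw [h2]
    linarith [h0 x]
  exact le_of_tendsto_of_tendsto' ((((cI h).tendsto f).comp hkl).sub ((c0.tendsto f).comp hkl)).abs
    (((c0.tendsto f).comp hkl).const_mul _) hle

theorem exists_integral_comp_sub_le : ∃ D : ℝ, 0 ≤ D ∧ ∀ (f : C(M, ℝ)) (h : ℝ), |h| ≤ r →
    |∫ x, f (φ h x) ∂μ - ∫ x, f x ∂μ| ≤ D * |h| * ∫ x, |f x| ∂μ := by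
  refine ⟨‖b‖ * Real.exp (‖b‖ * r), by positivity, fun f h hh => ?_⟩
  have hI : ∀ g : C(M, ℝ), Integrable g μ := integrable_cont μ
  have h1 := hφ.integral_comp_sub_le_of_nonneg (f := f ⊔ 0) (fun x => by simp) hh
  have h2 := hφ.integral_comp_sub_le_of_nonneg (f := (-f) ⊔ 0) (fun x => by simp) hh
  have e : ∀ x, f x = (f ⊔ 0 : C(M, ℝ)) x - ((-f) ⊔ 0 : C(M, ℝ)) x := fun x => by
    simp only [ContinuousMap.sup_apply, ContinuousMap.neg_apply, ContinuousMap.zero_apply]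
    rcases le_total (f x) 0 with h | h
    · rw [max_eq_right h, max_eq_left (by linarith)]; ring
    · rw [max_eq_left h, max_eq_right (by linarith)]; ring
  have e' : ∀ x, |f x| = (f ⊔ 0 : C(M, ℝ)) x + ((-f) ⊔ 0 : C(M, ℝ)) x := fun x => by
    simp only [ContinuousMap.sup_apply, ContinuousMap.neg_apply, ContinuousMap.zero_apply]
    rcases le_total (f x) 0 with h | h
    · rw [max_eq_right h, max_eq_left (by linarith), abs_of_nonpos h]; ring
    · rw [max_eq_left h, max_eq_right (by linarith), abs_of_nonneg h]; ring
  have i1 : Integrable (fun x => (f ⊔ 0 : C(M, ℝ)) (φ h x)) μ := hI ((f ⊔ 0).comp (φ h))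
  have i2 : Integrable (fun x => ((-f) ⊔ 0 : C(M, ℝ)) (φ h x)) μ := hI (((-f) ⊔ 0).comp (φ h))
  rw [integral_congr_ae (Eventually.of_forall fun x => e (φ h x)),
    integral_congr_ae (Eventually.of_forall e), integral_congr_ae (Eventually.of_forall e'),
    integral_sub i1 i2, integral_sub (hI _) (hI _), integral_add (hI _) (hI _), mul_add]
  rw [abs_le] at h1 h2 ⊢
  constructor <;> linarith [h1.1, h1.2, h2.1, h2.2]

theorem exists_norm_comp_le : ∃ K : ℝ, 1 ≤ K ∧ ∀ (f : C(M, ℝ)) (h : ℝ), |h| ≤ r →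
    ‖toL2 μ (f.comp (φ h))‖ ≤ K * ‖toL2 μ f‖ := by
  obtain ⟨D, hD, H⟩ := hφ.exists_integral_comp_sub_le
  have hr := hφ.r_pos
  refine ⟨1 + D * r, by nlinarith, fun f h hh => norm_toL2_le μ (by positivity) ?_⟩
  have h1 := (abs_le.1 (H (f ^ 2) h hh)).2
  simp only [ContinuousMap.pow_apply, abs_pow, sq_abs] at h1
  have h2 : 0 ≤ ∫ x, f x ^ 2 ∂μ := integral_nonneg fun x => sq_nonneg _
  simp only [ContinuousMap.comp_apply]
  have h3 : D * |h| * ∫ x, f x ^ 2 ∂μ ≤ D * r * ∫ x, f x ^ 2 ∂μ := by gcongr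
  have h4 : (1 + D * r) * ∫ x, f x ^ 2 ∂μ ≤ (1 + D * r) ^ 2 * ∫ x, f x ^ 2 ∂μ := by
    apply mul_le_mul_of_nonneg_right _ h2
    have : 0 ≤ D * r := by positivity
    nlinarith
  linarith

end DerivationFlow

end FlowCalculus

section Translation

set_option linter.unusedSectionVars false

open Set Filter Topology MeasureTheory
open scoped ENNReal

variable {M : Type*} [MetricSpace M] [CompactSpace M] [MeasurableSpace M] [BorelSpace M]

/-- The extension to `L²` of the composition with a flow. -/
def translation (μ : Measure M) [IsFiniteMeasure μ] (φ : ℝ → C(M, M)) (h : ℝ) :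
    Lp ℝ 2 μ →L[ℝ] Lp ℝ 2 μ :=
  LinearMap.extendOfNorm
    ((toL2 μ).toLinearMap ∘ₗ (ContinuousMap.compRightAlgHom ℝ ℝ (φ h)).toLinearMap)
    (toL2 μ).toLinearMap

theorem norm_le_of_weak_limit {H : Type*} [NormedAddCommGroup H] [InnerProductSpace ℝ H]
    {x : ℕ → H} {z : H} {c : ℕ → ℝ} {a : ℝ}
    (hx : ∀ q, Tendsto (fun n => ⟪x n, q⟫) atTop (𝓝 ⟪z, q⟫)) (hc : ∀ n, ‖x n‖ ≤ c n)
    (ha : Tendsto c atTop (𝓝 a)) : ‖z‖ ≤ a := by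
  have h1 : ⟪z, z⟫ ≤ a * ‖z‖ := le_of_tendsto_of_tendsto' (hx z) (ha.mul_const ‖z‖) fun n =>
    (real_inner_le_norm _ _).trans (by gcongr; exact hc n)
  rw [real_inner_self_eq_norm_sq] at h1
  by_contra h
  push Not at h
  have ha0 : 0 ≤ a := ge_of_tendsto' ha fun n => (norm_nonneg _).trans (hc n)
  nlinarith [norm_nonneg z]

namespace DerivationFlow

variable {μ : Measure M} [IsFiniteMeasure μ] {𝒯 : Submodule ℝ (C(M, ℝ) × C(M, ℝ) × C(M, ℝ))}
  {φ : ℝ → C(M, M)} {b : C(M, ℝ)} {r C : ℝ} (hφ : DerivationFlow μ 𝒯 φ b r C)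

include hφ

theorem translation_toL2 {h : ℝ} (hh : |h| ≤ r) (f : C(M, ℝ)) :
    translation μ φ h (toL2 μ f) = toL2 μ (f.comp (φ h)) := by
  obtain ⟨K, -, hK⟩ := hφ.exists_norm_comp_le
  exact LinearMap.extendOfNorm_eq (denseRange_toL2 μ) ⟨K, fun f => hK f h hh⟩ f

theorem hasDerivAt_toL2 {f f1 f2 : C(M, ℝ)} (hf : (f, f1, f2) ∈ 𝒯) (t : ℝ) :
    HasDerivAt (fun s => toL2 μ (f.comp (φ s))) (toL2 μ (f1.comp (φ t))) t :=
  (toL2 μ).hasFDerivAt.comp_hasDerivAt t (hφ.hasDerivAt_comp (hφ.deriv f f1 f2 hf) t)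

theorem exists_translationAlong :
    ∃ C', TranslationAlong (graphL2 μ 𝒯) r C' (translation μ φ) := by
  obtain ⟨K, hK1, hK⟩ := hφ.exists_norm_comp_le
  obtain ⟨D, hD, hDle⟩ := hφ.exists_integral_comp_sub_le
  have hr := hφ.r_pos
  have hC := hφ.C_nonneg
  have hK0 : 0 ≤ K := by linarith
  set E := C * K + D * K + K with hE
  have hCE : C * K ≤ E := by nlinarith [mul_nonneg hD hK0]
  have hDE : D * K ≤ E := by nlinarith [mul_nonneg hC hK0]
  have hKE : K ≤ E := by nlinarith [mul_nonneg hC hK0, mul_nonneg hD hK0]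
  have hE0 : 0 ≤ E := hK0.trans hKE
  have hsub : ∀ h, |h| ≤ r → ∀ w w1 w2, (w, w1, w2) ∈ graphL2 μ 𝒯 →
      ‖translation μ φ h w - w‖ ≤ K * |h| * ‖w1‖ := by
    intro h hh w w1 w2 hw
    obtain ⟨f, f1, f2, hf, h0, h1, h2⟩ := exists_seq_of_mem_graphL2 hw
    refine le_of_tendsto_of_tendsto' ((((translation μ φ h).continuous.tendsto w).comp h0).sub
      h0).norm (h1.norm.const_mul (K * |h|)) fun n => ?_
    rw [Function.comp_apply, hφ.translation_toL2 hh]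
    have hb : ∀ s ∈ Icc (-|h|) |h|, ‖toL2 μ ((f1 n).comp (φ s))‖ ≤ K * ‖toL2 μ (f1 n)‖ :=
      fun s hs => hK _ _ ((abs_le.2 hs).trans hh)
    have h3 := (convex_Icc (-|h|) |h|).norm_image_sub_le_of_norm_hasDerivWithin_le
      (fun s _ => (hφ.hasDerivAt_toL2 (hf n) s).hasDerivWithinAt) hb (x := 0) (y := h)
      ⟨by simp, by simp⟩ ⟨neg_abs_le h, le_abs_self h⟩
    rw [sub_zero, hφ.comp_zero, Real.norm_eq_abs] at h3
    linarith
  refine ⟨E, hr, hE0, ?_, ?_, ?_, ?_⟩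
  · intro h hh x y
    have hh' : |-h| ≤ r := by rwa [abs_neg]
    refine (denseRange_toL2 μ).induction_on₂ (p := fun x y =>
      |⟪translation μ φ h x, y⟫ - ⟪x, translation μ φ (-h) y⟫| ≤ E * |h| * ‖x‖ * ‖y‖)
      (isClosed_le (by fun_prop) (by fun_prop)) (fun f g => ?_) x y
    rw [hφ.translation_toL2 hh, hφ.translation_toL2 hh', inner_toL2, inner_toL2]
    have h1 := hDle (f * g.comp (φ (-h))) h hh
    simp only [ContinuousMap.mul_apply, ContinuousMap.comp_apply, hφ.neg_apply] at h1 ⊢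
    refine h1.trans ?_
    have h2 := integral_abs_mul_le μ f (g.comp (φ (-h)))
    simp only [ContinuousMap.comp_apply] at h2
    calc D * |h| * ∫ x, |f x * g (φ (-h) x)| ∂μ
        ≤ D * |h| * (‖toL2 μ f‖ * (K * ‖toL2 μ g‖)) := by
          gcongr; exact h2.trans (by gcongr; exact hK _ _ hh')
      _ = (D * K) * |h| * ‖toL2 μ f‖ * ‖toL2 μ g‖ := by ring
      _ ≤ _ := by gcongr
  · intro h hh w w1 w2 hw
    obtain ⟨f, f1, f2, hf, h0, h1, h2⟩ := exists_seq_of_mem_graphL2 hw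
    choose g hg hgle using fun n => hφ.trans h hh (f n) (f1 n) (f2 n) (hf n)
    have hb : ∀ n, ‖toL2 μ (g n) - toL2 μ ((f2 n).comp (φ h))‖ ≤
        C * K * |h| * (‖toL2 μ (f1 n)‖ + ‖toL2 μ (f2 n)‖) := fun n => by
      rw [← map_sub]
      refine (norm_toL2_mono μ (g := (C * |h|) • (|(f1 n).comp (φ h)| + |(f2 n).comp (φ h)|))
        fun x => ?_).trans ?_
      · simp only [ContinuousMap.sub_apply, ContinuousMap.comp_apply, ContinuousMap.smul_apply,
          ContinuousMap.add_apply, ContinuousMap.abs_apply, smul_eq_mul]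
        exact (hgle n x).trans (le_abs_self _)
      · rw [map_smul, map_add, norm_smul, Real.norm_of_nonneg (by positivity)]
        calc C * |h| * ‖toL2 μ |(f1 n).comp (φ h)| + toL2 μ |(f2 n).comp (φ h)|‖
            ≤ C * |h| * (K * ‖toL2 μ (f1 n)‖ + K * ‖toL2 μ (f2 n)‖) := by
              gcongr
              refine (norm_add_le _ _).trans ?_
              rw [norm_toL2_abs, norm_toL2_abs]
              exact add_le_add (hK _ _ hh) (hK _ _ hh)
          _ = _ := by ring
    have hT : ∀ {k : ℕ → C(M, ℝ)} {u : Lp ℝ 2 μ}, Tendsto (fun n => toL2 μ (k n)) atTop (𝓝 u) →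
        Tendsto (fun n => toL2 μ ((k n).comp (φ h))) atTop (𝓝 (translation μ φ h u)) :=
      fun {k u} hk => (((translation μ φ h).continuous.tendsto u).comp hk).congr fun n =>
        hφ.translation_toL2 hh (k n)
    have hc := ((h1.norm.add h2.norm).const_mul (C * K * |h|))
    obtain ⟨B, hB⟩ := hc.bddAbove_range
    have : Fact ((2 : ℝ≥0∞) ≠ ⊤) := ⟨by simp⟩
    obtain ⟨v, k, hk, hv⟩ := exists_weak_subseq_limit fun n => (hb n).trans (hB ⟨n, rfl⟩)
    refine ⟨translation μ φ h w2 + v, ?_, ?_⟩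
    · refine mem_of_weak_limit isClosed_graphL2 (fun n => mem_graphL2 (hg (k n)))
        (Tendsto.weak ((hT h0).comp hk.tendsto_atTop))
        (Tendsto.weak ((hT h1).comp hk.tendsto_atTop)) fun q => ?_
      have h3 := (Tendsto.weak ((hT h2).comp hk.tendsto_atTop) q).add (hv q)
      rw [← inner_add_left] at h3
      refine h3.congr fun n => ?_
      rw [← inner_add_left, Function.comp_apply, add_sub_cancel]
    · rw [add_sub_cancel_left]
      refine (norm_le_of_weak_limit hv (fun n => hb (k n)) (hc.comp hk.tendsto_atTop)).trans ?_
      gcongr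
  · intro h hh w w1 w2 hw
    refine (hsub h hh w w1 w2 hw).trans (by gcongr)
  · intro w w1 w2 hw
    obtain ⟨f, f1, f2, hf, h0, h1, h2⟩ := exists_seq_of_mem_graphL2 hw
    rw [Metric.tendsto_nhds]
    intro ε hε
    obtain ⟨n, hn⟩ := ((tendsto_iff_norm_sub_tendsto_zero.1 h1).eventually
      (gt_mem_nhds (show 0 < ε / (3 * (K + 1)) by positivity))).exists
    have h3 := (hφ.hasDerivAt_toL2 (hf n) 0).tendsto_slope_zero
    rw [hφ.comp_zero] at h3
    have h4 := (Metric.tendsto_nhds.1 h3) (ε / 3) (by positivity)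
    have h5 : ∀ᶠ h in 𝓝[≠] (0 : ℝ), |h| ≤ r := by
      refine nhdsWithin_le_nhds ?_
      have : Metric.closedBall (0 : ℝ) r ∈ 𝓝 (0 : ℝ) := Metric.closedBall_mem_nhds 0 hr
      filter_upwards [this] with h hh
      simpa using hh
    filter_upwards [h4, h5, self_mem_nhdsWithin] with h h4 h5 h6
    have h6 : h ≠ 0 := h6
    have h7 := hsub h h5 _ _ _ ((graphL2 μ 𝒯).sub_mem hw (mem_graphL2 (hf n)))
    rw [dist_eq_norm] at h4 ⊢
    rw [zero_add, hφ.comp_zero, ← hφ.translation_toL2 h5] at h4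
    set W := toL2 μ (f n)
    set W1 := toL2 μ (f1 n)
    set T := translation μ φ h
    have e : h⁻¹ • (T w - w) - w1 = h⁻¹ • (T (w - W) - (w - W)) + (h⁻¹ • (T W - W) - W1)
        + (W1 - w1) := by
      rw [map_sub]; module
    have h8 : ‖h⁻¹ • (T (w - W) - (w - W))‖ ≤ K * ‖W1 - w1‖ := by
      rw [norm_smul, norm_inv, Real.norm_eq_abs, norm_sub_rev W1]
      have : 0 < |h| := abs_pos.2 h6
      rw [inv_mul_le_iff₀ this]
      calc _ ≤ _ := h7
        _ = _ := by ring
    rw [lt_div_iff₀ (by positivity)] at hn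
    rw [e]
    refine (norm_add₃_le).trans_lt ?_
    nlinarith [norm_nonneg (W1 - w1)]

end DerivationFlow

end Translation

section SobolevEmbedding

set_option linter.unusedSectionVars false

open Set Filter Topology MeasureTheory
open scoped ENNReal

variable {M : Type*} [MetricSpace M] [CompactSpace M]

/-- The weighted average of a function along a flow. -/
def flowAvg {φ : ℝ → C(M, M)} (hφ : ContFlow φ) (δ : ℝ) (k : C(ℝ, ℝ)) :
    C(M, ℝ) →ₗ[ℝ] C(M, ℝ) where
  toFun f := ∫ s in (0 : ℝ)..δ, k s • f.comp (φ s)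
  map_add' f g := by
    rw [← intervalIntegral.integral_add
      (Continuous.intervalIntegrable (by
        have := hφ.continuous_comp f; fun_prop) _ _)
      (Continuous.intervalIntegrable (by
        have := hφ.continuous_comp g; fun_prop) _ _)]
    simp [ContinuousMap.add_comp, smul_add]
  map_smul' c f := by
    rw [← intervalIntegral.integral_smul]
    simp [ContinuousMap.smul_comp, smul_comm c]

section FlowAvg

variable {φ : ℝ → C(M, M)} (hφ : ContFlow φ) (δ : ℝ) (k : C(ℝ, ℝ))

theorem flowAvg_apply (f : C(M, ℝ)) (x : M) :
    flowAvg hφ δ k f x = ∫ s in (0 : ℝ)..δ, k s * f (φ s x) :=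
  ((ContinuousMap.evalCLM ℝ x).intervalIntegral_comp_comm
    ((k.continuous.smul (hφ.continuous_comp f)).intervalIntegrable (μ := volume) 0 δ)).symm

theorem abs_flowAvg_apply_le (hδ : 0 ≤ δ) (hk : ∀ s ∈ Icc 0 δ, |k s| ≤ 1) (f : C(M, ℝ)) (x : M) :
    |flowAvg hφ δ k f x| ≤ ∫ s in (0 : ℝ)..δ, |f (φ s x)| := by
  rw [flowAvg_apply]
  have hc : Continuous fun s => f (φ s x) :=
    f.continuous.comp (hφ.cont.comp (by fun_prop : Continuous fun s : ℝ => (s, x)))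
  refine (intervalIntegral.abs_integral_le_integral_abs hδ).trans
    (intervalIntegral.integral_mono_on hδ ((k.continuous.mul hc).abs.intervalIntegrable _ _)
      (hc.abs.intervalIntegrable _ _) fun s hs => ?_)
  rw [abs_mul]
  exact mul_le_of_le_one_left (abs_nonneg _) (hk s hs)

variable [MeasurableSpace M] [BorelSpace M] {μ : Measure M} [IsFiniteMeasure μ]

theorem norm_toL2_flowAvg_le {K r : ℝ}
    (hK : ∀ (f : C(M, ℝ)) (h : ℝ), |h| ≤ r → ‖toL2 μ (f.comp (φ h))‖ ≤ K * ‖toL2 μ f‖)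
    (hδ : |δ| ≤ r) (hk : ∀ s ∈ uIcc 0 δ, |k s| ≤ 1) (f : C(M, ℝ)) :
    ‖toL2 μ (flowAvg hφ δ k f)‖ ≤ |δ| * K * ‖toL2 μ f‖ := by
  have e : toL2 μ (flowAvg hφ δ k f) = ∫ s in (0 : ℝ)..δ, toL2 μ (k s • f.comp (φ s)) :=
    ((toL2 μ).intervalIntegral_comp_comm
      ((k.continuous.smul (hφ.continuous_comp f)).intervalIntegrable (μ := volume) 0 δ)).symm
  rw [e]
  refine (intervalIntegral.norm_integral_le_of_norm_le_const (C := K * ‖toL2 μ f‖)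
    fun s hs => ?_).trans (by rw [sub_zero]; exact le_of_eq (by ring))
  have hs' : |s| ≤ |δ| := by
    rcases le_total 0 δ with h | h
    · rw [uIoc_of_le h] at hs
      rw [abs_of_pos hs.1, abs_of_nonneg h]; exact hs.2
    · rw [uIoc_of_ge h] at hs
      rw [abs_of_nonpos hs.2, abs_of_nonpos h]; linarith [hs.1]
  rw [map_smul, norm_smul]
  exact (mul_le_of_le_one_left (norm_nonneg _) (hk s (uIoc_subset_uIcc hs))).trans (hK f s (hs'.trans hδ))

end FlowAvg

/-- The weight `δ - s`. -/
def linearWeight (δ : ℝ) : C(ℝ, ℝ) := ⟨fun s => δ - s, by fun_prop⟩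

theorem smul_eq_flowAvg_sub {φ : ℝ → C(M, M)} (hφ : ContFlow φ) (δ : ℝ) {f f1 : C(M, ℝ)}
    (h : ∀ x t, HasDerivAt (fun s => f (φ s x)) (f1 (φ t x)) t) :
    δ • f = flowAvg hφ δ 1 f - flowAvg hφ δ (linearWeight δ) f1 := by
  ext x
  have c : ∀ g : C(M, ℝ), Continuous fun s => g (φ s x) := fun g =>
    g.continuous.comp (hφ.cont.comp (by fun_prop : Continuous fun s : ℝ => (s, x)))
  rw [ContinuousMap.sub_apply, flowAvg_apply, flowAvg_apply]
  have h1 : ∀ s, HasDerivAt (fun s => (δ - s) * f (φ s x))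
      (-(f (φ s x)) + (δ - s) * f1 (φ s x)) s := fun s => by
    have := ((hasDerivAt_id s).const_sub δ).mul (h x s)
    simpa using! this
  have c1 : Continuous fun s => -(f (φ s x)) := (c f).neg
  have c2 : Continuous fun s => (δ - s) * f1 (φ s x) :=
    (continuous_const.sub continuous_id).mul (c f1)
  have h2 := intervalIntegral.integral_eq_sub_of_hasDerivAt (a := 0) (b := δ) (fun s _ => h1 s)
    ((c1.add c2).intervalIntegrable _ _)
  rw [intervalIntegral.integral_add (c1.intervalIntegrable _ _) (c2.intervalIntegrable _ _),
    intervalIntegral.integral_neg] at h2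
  simp only [sub_self, zero_mul, sub_zero, hφ.zero] at h2
  simp only [ContinuousMap.smul_apply, smul_eq_mul, ContinuousMap.one_apply, one_mul, linearWeight,
    ContinuousMap.coe_mk]
  linarith

variable [MeasurableSpace M] [BorelSpace M]

section

variable {μ : Measure M} [IsFiniteMeasure μ] {𝒯 : Submodule ℝ (C(M, ℝ) × C(M, ℝ) × C(M, ℝ))}
  {φ : ℝ → C(M, M)} {b : C(M, ℝ)} {r C : ℝ}

/-- Generalized derivatives of continuous functions which are continuous are derivatives. -/
theorem DerivationFlow.hasDerivAt_of_mem_graphL2 (hφ : DerivationFlow μ 𝒯 φ b r C)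
    (hinj : ∀ f g : C(M, ℝ), toL2 μ f = toL2 μ g → f = g) {F F1 : C(M, ℝ)} {w2 : Lp ℝ 2 μ}
    (h : (toL2 μ F, toL2 μ F1, w2) ∈ graphL2 μ 𝒯) (x : M) (t : ℝ) :
    HasDerivAt (fun s => F (φ s x)) (F1 (φ t x)) t := by
  obtain ⟨f, f1, f2, hf, h0, h1, -⟩ := exists_seq_of_mem_graphL2 h
  obtain ⟨K, hK1, hK⟩ := hφ.exists_norm_comp_le
  have key : ∀ a, |a| ≤ r → F.comp (φ a) - F = flowAvg hφ.toContFlow a 1 F1 := fun a ha => by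
    refine hinj _ _ ?_
    have g0 : Tendsto (fun n => toL2 μ ((f n).comp (φ a) - f n)) atTop
        (𝓝 (toL2 μ (F.comp (φ a) - F))) := by
      rw [map_sub, ← hφ.translation_toL2 ha]
      refine ((((translation μ φ a).continuous.tendsto _).comp h0).sub h0).congr fun n => ?_
      rw [Function.comp_apply, map_sub, hφ.translation_toL2 ha]
    have g1 : Tendsto (fun n => toL2 μ (flowAvg hφ.toContFlow a 1 (f1 n))) atTop
        (𝓝 (toL2 μ (flowAvg hφ.toContFlow a 1 F1))) := by
      rw [tendsto_iff_norm_sub_tendsto_zero] at h1 ⊢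
      refine squeeze_zero (fun n => norm_nonneg _) (fun n => ?_)
        (by simpa using h1.const_mul (|a| * K))
      rw [← map_sub, ← map_sub, ← map_sub]
      exact norm_toL2_flowAvg_le hφ.toContFlow a 1 hK ha (by simp) _
    refine tendsto_nhds_unique g0 (g1.congr fun n => ?_)
    congr 1
    ext x
    rw [flowAvg_apply, ContinuousMap.sub_apply, ContinuousMap.comp_apply]
    have c : ∀ g : C(M, ℝ), Continuous fun s => g (φ s x) := fun g =>
      g.continuous.comp (hφ.cont.comp (by fun_prop : Continuous fun s : ℝ => (s, x)))
    have := intervalIntegral.integral_eq_sub_of_hasDerivAt (a := 0) (b := a)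
      (fun s _ => hφ.deriv _ _ _ (hf n) x s) ((c (f1 n)).intervalIntegrable _ _)
    rw [hφ.zero] at this
    simpa using this
  have hx : ∀ y, HasDerivAt (fun s => F (φ s y)) (F1 y) 0 := fun y => by
    have c : Continuous fun s => F1 (φ s y) :=
      F1.continuous.comp (hφ.cont.comp (by fun_prop : Continuous fun s : ℝ => (s, y)))
    have h3 := (intervalIntegral.integral_hasDerivAt_right (c.intervalIntegrable (μ := volume) 0 0)
      (c.stronglyMeasurableAtFilter _ _) c.continuousAt).const_add (F y)
    rw [hφ.zero] at h3
    refine h3.congr_of_eventuallyEq ?_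
    filter_upwards [Metric.closedBall_mem_nhds (0 : ℝ) hφ.r_pos] with a ha
    have h4 := congrArg (fun g : C(M, ℝ) => g y) (key a (by simpa using ha))
    simp only [ContinuousMap.sub_apply, ContinuousMap.comp_apply, flowAvg_apply,
      ContinuousMap.one_apply, one_mul] at h4
    linarith
  have h5 := HasDerivAt.comp_sub_const t t (by rw [sub_self]; exact hx (φ t x))
  simpa [← hφ.add] using h5

end

/-- Two flows whose derivations span a surface: the orbit squares are dominated by the measure, and
functions invariant under both flows are constant. -/
structure SurfaceFlows (μ : Measure M) (𝒯 : Submodule ℝ (C(M, ℝ) × C(M, ℝ) × C(M, ℝ)))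
    (φ ψ : ℝ → C(M, M)) (b b' : C(M, ℝ)) (r C r' C' δ D : ℝ) : Prop where
  fst : DerivationFlow μ 𝒯 φ b r C
  snd : DerivationFlow μ (swapTriples 𝒯) ψ b' r' C'
  δ_pos : 0 < δ
  δ_le_one : δ ≤ 1
  δ_le : δ ≤ r
  δ_le' : δ ≤ r'
  lower : ∀ x, ∀ F : C(M, ℝ), (∀ z, 0 ≤ F z) →
    ∫ p in Icc 0 δ ×ˢ Icc 0 δ, F (ψ p.2 (φ p.1 x)) ≤ D * ∫ z, F z ∂μ
  conn : ∀ F : C(M, ℝ), (∀ t x, F (φ t x) = F x) → (∀ t x, F (ψ t x) = F x) →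
    ∃ c : ℝ, F = c • 1

namespace SurfaceFlows

variable {μ : Measure M} [IsFiniteMeasure μ]
  {𝒯 : Submodule ℝ (C(M, ℝ) × C(M, ℝ) × C(M, ℝ))}
  {φ ψ : ℝ → C(M, M)} {b b' : C(M, ℝ)} {r C r' C' δ D : ℝ}
  (S : SurfaceFlows μ 𝒯 φ ψ b b' r C r' C' δ D)

include S

theorem continuous_square (x : M) : Continuous fun p : ℝ × ℝ => ψ p.2 (φ p.1 x) :=
  S.snd.cont.comp (continuous_snd.prodMk
    (S.fst.cont.comp (by fun_prop : Continuous fun p : ℝ × ℝ => (p.1, x))))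

theorem isOpenPosMeasure : μ.IsOpenPosMeasure := by
  refine ⟨fun U hU hne hμ => ?_⟩
  obtain ⟨x, hx⟩ := hne
  obtain ⟨ε, hε, hball⟩ := Metric.isOpen_iff.1 hU x hx
  let F : C(M, ℝ) := ⟨fun y => max 0 (ε - dist y x), by fun_prop⟩
  have hF0 : ∀ z, 0 ≤ F z := fun z => le_max_left _ _
  have hFU : ∀ z, z ∉ U → F z = 0 := fun z hz => by
    refine max_eq_left ?_
    by_contra h
    push Not at h
    exact hz (hball (Metric.mem_ball.2 (by linarith)))
  have hint : ∫ z, F z ∂μ = 0 := by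
    refine integral_eq_zero_of_ae ?_
    have : ∀ᵐ z ∂μ, z ∉ U := by
      rw [ae_iff]; simpa using hμ
    filter_upwards [this] with z hz using hFU z hz
  have h1 := S.lower x F hF0
  rw [hint, mul_zero] at h1
  have hc : Continuous fun p : ℝ × ℝ => F (ψ p.2 (φ p.1 x)) := F.continuous.comp (S.continuous_square x)
  have h2 : 0 < ∫ p in Icc 0 δ ×ˢ Icc 0 δ, F (ψ p.2 (φ p.1 x)) := by
    rw [setIntegral_pos_iff_support_of_nonneg_ae (Eventually.of_forall fun p => hF0 _)
      (hc.continuousOn.integrableOn_compact (isCompact_Icc.prod isCompact_Icc))]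
    have ho : IsOpen (Function.support fun p : ℝ × ℝ => F (ψ p.2 (φ p.1 x))) := hc.isOpen_support
    have h0 : ((0 : ℝ), (0 : ℝ)) ∈ Function.support fun p : ℝ × ℝ => F (ψ p.2 (φ p.1 x)) := by
      change max 0 (ε - dist (ψ 0 (φ 0 x)) x) ≠ 0
      rw [S.fst.zero, S.snd.zero, dist_self, sub_zero, max_eq_right hε.le]
      exact hε.ne'
    have hcl : ((0 : ℝ), (0 : ℝ)) ∈ closure (Ioo 0 δ ×ˢ Ioo 0 δ) := by
      rw [closure_prod_eq, closure_Ioo S.δ_pos.ne]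
      exact ⟨left_mem_Icc.2 S.δ_pos.le, left_mem_Icc.2 S.δ_pos.le⟩
    have hne := mem_closure_iff.1 hcl _ ho h0
    refine ((ho.inter (isOpen_Ioo.prod isOpen_Ioo)).measure_pos volume hne).trans_le
      (measure_mono (inter_subset_inter_right _
        (prod_mono Ioo_subset_Icc_self Ioo_subset_Icc_self)))
  linarith

theorem toL2_injective {f g : C(M, ℝ)} (h : toL2 μ f = toL2 μ g) : f = g := by
  have := S.isOpenPosMeasure
  exact ContinuousMap.toLp_injective μ h

/-- The average over orbit squares. -/
def squareAvg (k l : C(ℝ, ℝ)) : C(M, ℝ) →ₗ[ℝ] C(M, ℝ) :=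
  flowAvg S.fst.toContFlow δ k ∘ₗ flowAvg S.snd.toContFlow δ l

theorem norm_squareAvg_le {k l : C(ℝ, ℝ)} (hk : ∀ s ∈ Icc 0 δ, |k s| ≤ 1)
    (hl : ∀ s ∈ Icc 0 δ, |l s| ≤ 1) (f : C(M, ℝ)) :
    ‖S.squareAvg k l f‖ ≤ |D| * ‖toL2 μ 1‖ * ‖toL2 μ f‖ := by
  rw [ContinuousMap.norm_le _ (by positivity)]
  intro x
  have hδ := S.δ_pos.le
  have hc : Continuous fun p : ℝ × ℝ => |f (ψ p.2 (φ p.1 x))| :=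
    (f.continuous.comp (S.continuous_square x)).abs
  have c1 : Continuous fun s => φ s x :=
    S.fst.cont.comp (by fun_prop : Continuous fun s : ℝ => (s, x))
  calc ‖S.squareAvg k l f x‖ ≤ ∫ s in (0 : ℝ)..δ, |flowAvg S.snd.toContFlow δ l f (φ s x)| :=
        abs_flowAvg_apply_le S.fst.toContFlow δ k hδ hk _ x
    _ ≤ ∫ s in (0 : ℝ)..δ, ∫ t in (0 : ℝ)..δ, |f (ψ t (φ s x))| := by
        refine intervalIntegral.integral_mono_on hδ ?_ ?_ fun s _ =>
          abs_flowAvg_apply_le S.snd.toContFlow δ l hδ hl f _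
        · exact (((flowAvg S.snd.toContFlow δ l f).continuous.comp c1).abs).intervalIntegrable _ _
        · exact (intervalIntegral.continuous_parametric_intervalIntegral_of_continuous' hc 0 δ
            ).intervalIntegrable _ _
    _ = ∫ p in Icc 0 δ ×ˢ Icc 0 δ, |f| (ψ p.2 (φ p.1 x)) := by
        rw [Measure.volume_eq_prod, setIntegral_prod _ (by
          rw [← Measure.volume_eq_prod]
          exact hc.continuousOn.integrableOn_compact (isCompact_Icc.prod isCompact_Icc)),
          intervalIntegral.integral_of_le hδ, integral_Icc_eq_integral_Ioc]
        refine setIntegral_congr_fun measurableSet_Ioc fun s _ => ?_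
        simp only
        rw [intervalIntegral.integral_of_le hδ, integral_Icc_eq_integral_Ioc]
        rfl
    _ ≤ D * ∫ z, |f| z ∂μ := S.lower x |f| fun z => abs_nonneg _
    _ ≤ |D| * (‖toL2 μ 1‖ * ‖toL2 μ f‖) := by
        refine mul_le_mul (le_abs_self D) (integral_abs_le μ f) (integral_nonneg fun z =>
          abs_nonneg _) (abs_nonneg _)
    _ = _ := by ring

/-- The extension of `squareAvg` to `L²`. -/
def squareAvgL2 (k l : C(ℝ, ℝ)) : Lp ℝ 2 μ →L[ℝ] C(M, ℝ) :=
  LinearMap.extendOfNorm (S.squareAvg k l) (toL2 μ).toLinearMap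

theorem squareAvgL2_toL2 {k l : C(ℝ, ℝ)} (hk : ∀ s ∈ Icc 0 δ, |k s| ≤ 1)
    (hl : ∀ s ∈ Icc 0 δ, |l s| ≤ 1) (f : C(M, ℝ)) :
    S.squareAvgL2 k l (toL2 μ f) = S.squareAvg k l f :=
  LinearMap.extendOfNorm_eq (denseRange_toL2 μ) ⟨_, S.norm_squareAvg_le hk hl⟩ f

theorem abs_one_le : ∀ s ∈ Icc 0 δ, |(1 : C(ℝ, ℝ)) s| ≤ 1 := by simp

theorem abs_linearWeight_le : ∀ s ∈ Icc 0 δ, |linearWeight δ s| ≤ 1 := fun s hs => by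
  have := S.δ_le_one
  simp only [linearWeight, ContinuousMap.coe_mk]
  rw [abs_le]
  constructor <;> linarith [hs.1, hs.2]

/-- A function with two derivatives, one of them along the first flow, is continuous. -/
theorem exists_continuous {w w1 w2 w11 w12 : Lp ℝ 2 μ} (hw : (w, w1, w2) ∈ graphL2 μ 𝒯)
    (hw1 : (w1, w11, w12) ∈ graphL2 μ 𝒯) : ∃ F : C(M, ℝ), toL2 μ F = w := by
  obtain ⟨f, f1, f2, hf, h0, h1, h2⟩ := exists_seq_of_mem_graphL2 hw
  obtain ⟨g, g1, g2, hg, k0, k1, k2⟩ := exists_seq_of_mem_graphL2 hw1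
  obtain ⟨K, hK1, hK⟩ := S.fst.exists_norm_comp_le
  have o := S.abs_one_le
  have l := S.abs_linearWeight_le
  set L := linearWeight δ with hL
  set I := flowAvg S.fst.toContFlow δ with hI
  have key : ∀ n, δ ^ 2 • f n = S.squareAvg 1 1 (f n) - S.squareAvg 1 L (f2 n)
      - (S.squareAvg L 1 (g n) - S.squareAvg L L (g2 n)) - δ • I L (f1 n - g n) := fun n => by
    have e1 := smul_eq_flowAvg_sub S.fst.toContFlow δ (S.fst.deriv _ _ _ (hf n))
    have e2 := smul_eq_flowAvg_sub S.snd.toContFlow δ (S.snd.deriv _ _ _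
      (mem_swapTriples.2 (hf n)))
    have e3 := smul_eq_flowAvg_sub S.snd.toContFlow δ (S.snd.deriv _ _ _
      (mem_swapTriples.2 (hg n)))
    have e4 := congrArg (I 1) e2
    have e5 := congrArg (I L) e3
    rw [map_smul, map_sub] at e4 e5
    change _ = S.squareAvg 1 1 (f n) - S.squareAvg 1 L (f2 n) at e4
    change _ = S.squareAvg L 1 (g n) - S.squareAvg L L (g2 n) at e5
    rw [pow_two, mul_smul, e1, smul_sub, map_sub, smul_sub, ← e4, ← e5]
    abel
  have hlimI : Tendsto (fun n => toL2 μ (I L (f1 n - g n))) atTop (𝓝 0) := by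
    have hz : Tendsto (fun n => toL2 μ (f1 n - g n)) atTop (𝓝 0) := by
      simpa using h1.sub k0
    exact squeeze_zero_norm (fun n => norm_toL2_flowAvg_le S.fst.toContFlow δ L
      hK (by rw [abs_of_pos S.δ_pos]; exact S.δ_le) (by rwa [uIcc_of_le S.δ_pos.le])
      (f1 n - g n)) (by simpa using hz.norm.const_mul (|δ| * K))
  have hA : ∀ {k l : C(ℝ, ℝ)} {u : ℕ → C(M, ℝ)} {v : Lp ℝ 2 μ}, (∀ s ∈ Icc 0 δ, |k s| ≤ 1) →
      (∀ s ∈ Icc 0 δ, |l s| ≤ 1) → Tendsto (fun n => toL2 μ (u n)) atTop (𝓝 v) →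
      Tendsto (fun n => toL2 μ (S.squareAvg k l (u n))) atTop
        (𝓝 (toL2 μ (S.squareAvgL2 k l v))) := fun {k l u v} hk hl hu =>
    ((((toL2 μ).comp (S.squareAvgL2 k l)).continuous.tendsto v).comp hu).congr fun n => by
      rw [Function.comp_apply, ContinuousLinearMap.comp_apply, S.squareAvgL2_toL2 hk hl]
  have hlim := (((hA o o h0).sub (hA o l h2)).sub ((hA l o k0).sub (hA l l k2))).sub
    (hlimI.const_smul δ)
  rw [smul_zero, sub_zero] at hlim
  have h3 : Tendsto (fun n => δ ^ 2 • toL2 μ (f n)) atTop (𝓝 (δ ^ 2 • w)) := h0.const_smul _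
  have h4 := tendsto_nhds_unique h3 (hlim.congr fun n => by
    rw [← map_smul _ (δ ^ 2), key n]
    simp only [map_sub, map_smul])
  refine ⟨(δ ^ 2)⁻¹ • (S.squareAvgL2 1 1 w - S.squareAvgL2 1 L w2
    - (S.squareAvgL2 L 1 w1 - S.squareAvgL2 L L w12)), ?_⟩
  rw [map_smul, map_sub, map_sub, map_sub, ← h4, smul_smul,
    inv_mul_cancel₀ (pow_ne_zero _ S.δ_pos.ne'), one_smul]

/-- Averaging over orbit squares changes a function by at most its derivatives. -/
theorem exists_norm_sub_squareAvgL2_le : ∃ E, ∀ w w1 w2, (w, w1, w2) ∈ graphL2 μ 𝒯 →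
    ‖w - ((δ ^ 2)⁻¹ • (toL2 μ).comp (S.squareAvgL2 1 1)) w‖ ≤ E * (‖w1‖ + ‖w2‖) := by
  obtain ⟨K, hK1, hK⟩ := S.fst.exists_norm_comp_le
  obtain ⟨K', hK1', hK'⟩ := S.snd.exists_norm_comp_le
  have o := S.abs_one_le
  have l := S.abs_linearWeight_le
  have hδ := S.δ_pos
  have a := abs_of_pos hδ
  have u := uIcc_of_le hδ.le
  set L := linearWeight δ with hL
  have hb : ∀ f f1 f2, (f, f1, f2) ∈ 𝒯 → ‖δ ^ 2 • toL2 μ f - toL2 μ (S.squareAvg 1 1 f)‖ ≤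
      (K + K * K') * (‖toL2 μ f1‖ + ‖toL2 μ f2‖) := fun f f1 f2 hf => by
    have e1 := smul_eq_flowAvg_sub S.fst.toContFlow δ (S.fst.deriv _ _ _ hf)
    have e2 := smul_eq_flowAvg_sub S.snd.toContFlow δ (S.snd.deriv _ _ _ (mem_swapTriples.2 hf))
    have e4 := congrArg (flowAvg S.fst.toContFlow δ 1) e2
    rw [map_smul, map_sub] at e4
    change _ = S.squareAvg 1 1 f - S.squareAvg 1 L f2 at e4
    have e5 : δ ^ 2 • f - S.squareAvg 1 1 f =
        -(S.squareAvg 1 L f2 + δ • flowAvg S.fst.toContFlow δ L f1) := by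
      rw [pow_two, mul_smul, e1, smul_sub, e4]
      abel
    rw [← map_smul, ← map_sub, e5, map_neg, norm_neg, map_add, map_smul]
    have b1 : ‖toL2 μ (S.squareAvg 1 L f2)‖ ≤ |δ| * K * (|δ| * K' * ‖toL2 μ f2‖) :=
      (norm_toL2_flowAvg_le S.fst.toContFlow δ 1 hK (by rw [a]; exact S.δ_le) (by rwa [u])
        _).trans (by
          gcongr
          exact norm_toL2_flowAvg_le S.snd.toContFlow δ L hK' (by rw [a]; exact S.δ_le')
            (by rwa [u]) _)
    have b2 := norm_toL2_flowAvg_le S.fst.toContFlow δ L hK (by rw [a]; exact S.δ_le) (by rwa [u]) f1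
    rw [a] at b1 b2
    refine (norm_add_le _ _).trans ?_
    rw [norm_smul, Real.norm_eq_abs, a]
    have hd2 : δ * δ ≤ 1 := by nlinarith [S.δ_le_one]
    have n1 := norm_nonneg (toL2 μ f1)
    have n2 := norm_nonneg (toL2 μ f2)
    calc _ ≤ δ * K * (δ * K' * ‖toL2 μ f2‖) + δ * (δ * K * ‖toL2 μ f1‖) := by gcongr
      _ = (δ * δ) * (K * K' * ‖toL2 μ f2‖ + K * ‖toL2 μ f1‖) := by ring
      _ ≤ 1 * (K * K' * ‖toL2 μ f2‖ + K * ‖toL2 μ f1‖) := by gcongr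
      _ ≤ _ := by
        have : 0 ≤ K * K' * ‖toL2 μ f1‖ := by positivity
        have : 0 ≤ K * ‖toL2 μ f2‖ := by positivity
        linarith
  refine ⟨(δ ^ 2)⁻¹ * (K + K * K'), fun w w1 w2 hw => ?_⟩
  obtain ⟨f, f1, f2, hf, h0, h1, h2⟩ := exists_seq_of_mem_graphL2 hw
  refine le_of_tendsto_of_tendsto' (h0.sub
    (((((δ ^ 2)⁻¹ • (toL2 μ).comp (S.squareAvgL2 1 1))).continuous.tendsto w).comp h0)).norm
    ((h1.norm.add h2.norm).const_mul _) fun n => ?_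
  rw [Function.comp_apply, _root_.smul_apply, ContinuousLinearMap.comp_apply,
    S.squareAvgL2_toL2 o o]
  have e : toL2 μ (f n) - (δ ^ 2)⁻¹ • toL2 μ (S.squareAvg 1 1 (f n)) =
      (δ ^ 2)⁻¹ • (δ ^ 2 • toL2 μ (f n) - toL2 μ (S.squareAvg 1 1 (f n))) := by
    rw [smul_sub, smul_smul, inv_mul_cancel₀ (pow_ne_zero _ hδ.ne'), one_smul]
  rw [e, norm_smul, Real.norm_of_nonneg (by positivity), mul_assoc]
  gcongr
  exact hb _ _ _ (hf n)

/-- Averaging over orbit squares is compact. -/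
theorem tendsto_squareAvgL2 {x : ℕ → Lp ℝ 2 μ} (hx : ∀ n, ‖x n‖ ≤ 1)
    (hw : ∀ q, Tendsto (fun n => ⟪x n, q⟫) atTop (𝓝 0)) :
    Tendsto (fun n => toL2 μ (S.squareAvgL2 1 1 (x n))) atTop (𝓝 0) := by
  set A := S.squareAvgL2 1 1 with hA
  have hp : ∀ z, Tendsto (fun n => A (x n) z) atTop (𝓝 0) := fun z => by
    let ℓ : StrongDual ℝ (Lp ℝ 2 μ) := (ContinuousMap.evalCLM ℝ z).comp A
    have h1 := hw ((InnerProductSpace.toDual ℝ _).symm ℓ)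
    refine h1.congr fun n => ?_
    rw [real_inner_comm, InnerProductSpace.toDual_symm_apply]
    rfl
  have hb : ∀ n z, |A (x n) z| ≤ ‖A‖ := fun n z =>
    ((A (x n)).norm_coe_le_norm z).trans ((A.le_opNorm _).trans
      (mul_le_of_le_one_right (norm_nonneg _) (hx n)))
  have h2 : Tendsto (fun n => ∫ z, (A (x n) z) ^ 2 ∂μ) atTop (𝓝 (∫ _, (0 : ℝ) ∂μ)) := by
    refine tendsto_integral_of_dominated_convergence (fun _ => ‖A‖ ^ 2)
      (fun n => ((A (x n)).continuous.pow 2).aestronglyMeasurable) (integrable_const _)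
      (fun n => Eventually.of_forall fun z => ?_) (Eventually.of_forall fun z => ?_)
    · rw [Real.norm_of_nonneg (sq_nonneg _)]
      exact sq_le_sq' (by linarith [(abs_le.1 (hb n z)).1]) (abs_le.1 (hb n z)).2
    · simpa using (hp z).pow 2
  simp_rw [← norm_toL2_sq] at h2
  rw [integral_zero] at h2
  have h3 := h2.sqrt
  simp only [Real.sqrt_sq (norm_nonneg _), Real.sqrt_zero] at h3
  exact tendsto_zero_iff_norm_tendsto_zero.2 h3

end SurfaceFlows

end SobolevEmbedding

section SurfaceCalculus

set_option linter.unusedSectionVars false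

open Set Filter Topology MeasureTheory
open scoped ENNReal

variable {M : Type*} [MetricSpace M] [CompactSpace M] [MeasurableSpace M] [BorelSpace M]

/-- Multiplication by a continuous function on `L²`. -/
def mulL2 (μ : Measure M) [IsFiniteMeasure μ] (a : C(M, ℝ)) : Lp ℝ 2 μ →L[ℝ] Lp ℝ 2 μ :=
  LinearMap.extendOfNorm ((toL2 μ).toLinearMap ∘ₗ LinearMap.mulLeft ℝ a) (toL2 μ).toLinearMap

theorem mulL2_toL2 (μ : Measure M) [IsFiniteMeasure μ] (a f : C(M, ℝ)) :
    mulL2 μ a (toL2 μ f) = toL2 μ (a * f) := by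
  refine LinearMap.extendOfNorm_eq (denseRange_toL2 μ) ⟨‖a‖, fun f => ?_⟩ f
  have h : ‖toL2 μ (a * f)‖ ≤ ‖toL2 μ (‖a‖ • f)‖ := norm_toL2_mono μ fun x => by
    simp only [ContinuousMap.mul_apply, ContinuousMap.smul_apply, smul_eq_mul, abs_mul, abs_norm]
    gcongr
    exact a.norm_coe_le_norm x
  rwa [map_smul, norm_smul, norm_norm] at h

/-- A pair of flows together with an algebra of smooth coefficients. -/
structure SurfaceCalculus (μ : Measure M) (𝒯 : Submodule ℝ (C(M, ℝ) × C(M, ℝ) × C(M, ℝ)))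
    (φ ψ : ℝ → C(M, M)) {𝓐 : Type*} (ev : 𝓐 → C(M, ℝ)) (DX DY : 𝓐 → 𝓐) (a b : 𝓐)
    (r C r' C' δ D : ℝ) : Prop
    extends SurfaceFlows μ 𝒯 φ ψ (ev b) (-ev a) r C r' C' δ D where
  ev_mem : ∀ c, (ev c, ev (DX c), ev (DY c)) ∈ 𝒯
  mul_mem : ∀ f f1 f2 g g1 g2, (f, f1, f2) ∈ 𝒯 → (g, g1, g2) ∈ 𝒯 →
    (f * g, f * g1 + f1 * g, f * g2 + f2 * g) ∈ 𝒯
  cross : ∀ f f1 f2 g g1 g2, (f, f1, f2) ∈ 𝒯 → (g, g1, g2) ∈ 𝒯 →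
    ∫ x, f1 x * g2 x ∂μ = ∫ x, f2 x * g1 x ∂μ

namespace SurfaceCalculus

variable {μ : Measure M} [IsFiniteMeasure μ]
  {𝒯 : Submodule ℝ (C(M, ℝ) × C(M, ℝ) × C(M, ℝ))}
  {φ ψ : ℝ → C(M, M)} {𝓐 : Type*} {ev : 𝓐 → C(M, ℝ)} {DX DY : 𝓐 → 𝓐} {a b : 𝓐}
  {r C r' C' δ D : ℝ} (S : SurfaceCalculus μ 𝒯 φ ψ ev DX DY a b r C r' C' δ D)

/-- The Hilbert space data of a surface calculus. -/
def sobolevPair : SobolevPair (Lp ℝ 2 μ) 𝓐 where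
  G := graphL2 μ 𝒯
  isClosed := isClosed_graphL2
  dense := by
    refine ((denseRange_toL2 μ).dense_image (toL2 μ).continuous S.fst.dense).mono ?_
    rintro _ ⟨f, ⟨f1, f2, hf⟩, rfl⟩
    exact ⟨_, _, mem_graphL2 hf⟩
  M c := mulL2 μ (ev c)
  DX := DX
  DY := DY
  mul_mem c w w1 w2 hw := by
    obtain ⟨f, f1, f2, hf, h0, h1, h2⟩ := exists_seq_of_mem_graphL2 hw
    have hm : ∀ (c : 𝓐) {f : ℕ → C(M, ℝ)} {w : Lp ℝ 2 μ},
        Tendsto (fun n => toL2 μ (f n)) atTop (𝓝 w) →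
        Tendsto (fun n => toL2 μ (ev c * f n)) atTop (𝓝 (mulL2 μ (ev c) w)) :=
      fun c f w hf => (((mulL2 μ (ev c)).continuous.tendsto w).comp hf).congr fun n =>
        mulL2_toL2 μ (ev c) (f n)
    refine isClosed_graphL2.mem_of_tendsto ((hm c h0).prodMk_nhds
      (((hm c h1).add (hm (DX c) h0)).prodMk_nhds ((hm c h2).add (hm (DY c) h0))))
      (Eventually.of_forall fun n => ?_)
    rw [← map_add, ← map_add]
    exact mem_graphL2 (S.mul_mem _ _ _ _ _ _ (S.ev_mem c) (hf n))
  one := toL2 μ 1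
  one_mem := by simpa using mem_graphL2 (μ := μ) S.fst.one_mem
  a := a
  b := b
  ibpX w w1 w2 v v1 v2 hw hv := by
    obtain ⟨f, f1, f2, hf, h0, h1, h2⟩ := exists_seq_of_mem_graphL2 hw
    obtain ⟨g, g1, g2, hg, k0, k1, k2⟩ := exists_seq_of_mem_graphL2 hv
    refine tendsto_nhds_unique ((h1.inner k0).add (h0.inner k1))
      (((((mulL2 μ (ev b)).continuous.tendsto w).comp h0).inner k0).congr fun n => ?_)
    have i1 : Integrable (fun x => f1 n x * g n x) μ := integrable_cont μ (f1 n * g n)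
    have i2 : Integrable (fun x => f n x * g1 n x) μ := integrable_cont μ (f n * g1 n)
    rw [Function.comp_apply, mulL2_toL2, inner_toL2, inner_toL2, inner_toL2,
      ← integral_add i1 i2]
    have h := S.fst.ibp _ _ _ (S.mul_mem _ _ _ _ _ _ (hf n) (hg n))
    simp only [ContinuousMap.add_apply, ContinuousMap.mul_apply] at h ⊢
    simp_rw [mul_assoc, add_comm (f1 n _ * g n _)]
    exact h.symm
  ibpY w w1 w2 v v1 v2 hw hv := by
    obtain ⟨f, f1, f2, hf, h0, h1, h2⟩ := exists_seq_of_mem_graphL2 hw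
    obtain ⟨g, g1, g2, hg, k0, k1, k2⟩ := exists_seq_of_mem_graphL2 hv
    refine tendsto_nhds_unique ((h2.inner k0).add (h0.inner k2))
      ((((((mulL2 μ (ev a)).continuous.tendsto w).comp h0).inner k0).neg).congr fun n => ?_)
    have i1 : Integrable (fun x => f2 n x * g n x) μ := integrable_cont μ (f2 n * g n)
    have i2 : Integrable (fun x => f n x * g2 n x) μ := integrable_cont μ (f n * g2 n)
    rw [Function.comp_apply, mulL2_toL2, inner_toL2, inner_toL2, inner_toL2,
      ← integral_add i1 i2,
      ← integral_neg]
    have h := S.snd.ibp _ _ _ (mem_swapTriples.2 (S.mul_mem _ _ _ _ _ _ (hf n) (hg n)))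
    simp only [ContinuousMap.add_apply, ContinuousMap.mul_apply, ContinuousMap.neg_apply,
      neg_mul] at h ⊢
    simp_rw [mul_assoc, add_comm (f2 n _ * g n _)]
    exact h.symm
  cross w w1 w2 v v1 v2 hw hv := by
    obtain ⟨f, f1, f2, hf, h0, h1, h2⟩ := exists_seq_of_mem_graphL2 hw
    obtain ⟨g, g1, g2, hg, k0, k1, k2⟩ := exists_seq_of_mem_graphL2 hv
    refine tendsto_nhds_unique (h1.inner k2) ((h2.inner k1).congr fun n => ?_)
    rw [inner_toL2, inner_toL2]
    exact (S.cross _ _ _ _ _ _ (hf n) (hg n)).symm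

include S

theorem exists_toL2_of_reg {w : Lp ℝ 2 μ} (hw : S.sobolevPair.Reg 2 w) :
    ∃ F : C(M, ℝ), toL2 μ F = w := by
  obtain ⟨w1, w2, h, ⟨w11, w12, h1, -, -⟩, -⟩ := hw
  exact S.exists_continuous h h1

/-- Derivatives along both flows. -/
def HasFlowDeriv (φ ψ : ℝ → C(M, M)) (F F1 F2 : C(M, ℝ)) : Prop :=
  ∀ x t, HasDerivAt (fun s => F (φ s x)) (F1 (φ t x)) t ∧
    HasDerivAt (fun s => F (ψ s x)) (F2 (ψ t x)) t

theorem hasFlowDeriv {F F1 F2 : C(M, ℝ)}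
    (h : (toL2 μ F, toL2 μ F1, toL2 μ F2) ∈ graphL2 μ 𝒯) : HasFlowDeriv φ ψ F F1 F2 := fun x t =>
  ⟨S.fst.hasDerivAt_of_mem_graphL2 (fun _ _ => S.toL2_injective) h x t,
    S.snd.hasDerivAt_of_mem_graphL2 (fun _ _ => S.toL2_injective) (mem_graphL2_swapTriples h) x t⟩

theorem exists_poincare : ∃ E, ∀ w w1 w2, (w, w1, w2) ∈ S.sobolevPair.G →
    ⟪w, S.sobolevPair.one⟫ = 0 → ‖w‖ ≤ E * (‖w1‖ + ‖w2‖) := by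
  have : Fact ((2 : ℝ≥0∞) ≠ ⊤) := ⟨by simp⟩
  obtain ⟨E, hE⟩ := S.exists_norm_sub_squareAvgL2_le
  refine SobolevPair.poincare (Q := (δ ^ 2)⁻¹ • (toL2 μ).comp (S.squareAvgL2 1 1)) (C := E)
    ?_ hE fun x hx hw => ?_
  · intro w hw hm
    obtain ⟨F, rfl⟩ := S.exists_continuous hw (Submodule.zero_mem _)
    have hd : HasFlowDeriv φ ψ F 0 0 := S.hasFlowDeriv (by simpa using! hw)
    have inv : ∀ {φ : ℝ → C(M, M)}, ContFlow φ → (∀ x t, HasDerivAt (fun s => F (φ s x)) 0 t) →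
        ∀ t x, F (φ t x) = F x := fun {φ} hφ h t x => by
      have := is_const_of_deriv_eq_zero (fun s => (h x s).differentiableAt)
        (fun s => (h x s).deriv) t 0
      rwa [hφ.zero] at this
    obtain ⟨c, rfl⟩ := S.conn F (inv S.fst.toContFlow fun x t => (hd x t).1)
      (inv S.snd.toContFlow fun x t => (hd x t).2)
    have hm' : ⟪toL2 μ (c • 1), toL2 μ 1⟫ = 0 := hm
    rw [map_smul, inner_smul_left] at hm'
    rcases mul_eq_zero.1 hm' with h | h
    · have : c = 0 := h
      rw [this, zero_smul, map_zero]
    · rw [map_smul, inner_self_eq_zero.1 h, smul_zero]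
  · simpa using (S.tendsto_squareAvgL2 hx hw).const_smul (δ ^ 2)⁻¹

/-- The Poisson equation making the frame flat after a conformal change. -/
theorem exists_conformal_factor : ∃ u u1 u2 u11 u12 u21 u22 : C(M, ℝ),
    HasFlowDeriv φ ψ u u1 u2 ∧ HasFlowDeriv φ ψ u1 u11 u12 ∧ HasFlowDeriv φ ψ u2 u21 u22 ∧
    u21 = u12 + ev a * u1 + ev b * u2 ∧
    u11 + u22 = ev b * u1 - ev a * u2 -
      (ev b * ev b - ev (DX b) + (ev a * ev a + ev (DY a))) := by
  have : Fact ((2 : ℝ≥0∞) ≠ ⊤) := ⟨by simp⟩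
  set P := S.sobolevPair with hP
  obtain ⟨E, hE⟩ := S.exists_poincare
  obtain ⟨u, u1, u2, hu, hweak⟩ := SobolevPair.exists_weak_solution hE (toL2 μ (ev b))
    (-toL2 μ (ev a))
  obtain ⟨C₁, hT⟩ := S.fst.exists_translationAlong
  obtain ⟨C₂, hT'⟩ := S.snd.exists_translationAlong
  rw [graphL2_swapTriples] at hT'
  set g := ev b * ev b - ev (DX b) + (ev a * ev a + ev (DY a)) with hg
  have hW : P.Weak u1 u2 (toL2 μ g) := fun v v1 v2 hv => by
    rw [hweak v v1 v2 hv]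
    have h1 := P.ibpX _ _ _ _ _ _ (mem_graphL2 (S.ev_mem b)) hv
    have h2 := P.ibpY _ _ _ _ _ _ (mem_graphL2 (S.ev_mem a)) hv
    change _ = ⟪mulL2 μ (ev b) (toL2 μ (ev b)), v⟫ at h1
    change _ = -⟪mulL2 μ (ev a) (toL2 μ (ev a)), v⟫ at h2
    rw [mulL2_toL2] at h1 h2
    rw [hg, map_add, map_sub, map_add, inner_add_left, inner_sub_left, inner_add_left,
      inner_neg_left]
    linarith
  have rev : ∀ k c, P.Reg k (toL2 μ (ev c)) := fun k => by
    induction k with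
    | zero => exact fun _ => trivial
    | succ k ih => exact fun c => ⟨_, _, mem_graphL2 (S.ev_mem c), ih _, ih _⟩
  have rmul : ∀ c d, P.Reg 2 (toL2 μ (ev c * ev d)) := fun c d => by
    have := (rev 2 d).mul c
    change P.Reg 2 (mulL2 μ (ev c) _) at this
    rwa [mulL2_toL2] at this
  have hreg : P.Reg 2 (toL2 μ g) := by
    rw [hg, map_add, map_sub, map_add]
    exact ((rmul _ _).sub (rev 2 _)).add ((rmul _ _).add (rev 2 _))
  have hR := SobolevPair.Weak.reg hT hT' 2 hu hW hreg
  obtain ⟨U, rfl⟩ := S.exists_toL2_of_reg hR.of_succ.of_succ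
  obtain ⟨v1, v2, hv, h1, h2⟩ := hR
  obtain ⟨rfl, rfl⟩ := SobolevPair.fst_unique hu hv
  obtain ⟨U1, rfl⟩ := S.exists_toL2_of_reg h1.of_succ
  obtain ⟨U2, rfl⟩ := S.exists_toL2_of_reg h2.of_succ
  obtain ⟨w11, w12, hw1, h11, h12⟩ := h1
  obtain ⟨w21, w22, hw2, h21, h22⟩ := h2
  obtain ⟨U11, rfl⟩ := S.exists_toL2_of_reg h11
  obtain ⟨U12, rfl⟩ := S.exists_toL2_of_reg h12
  obtain ⟨U21, rfl⟩ := S.exists_toL2_of_reg h21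
  obtain ⟨U22, rfl⟩ := S.exists_toL2_of_reg h22
  refine ⟨U, U1, U2, U11, U12, U21, U22, S.hasFlowDeriv hu, S.hasFlowDeriv hw1,
    S.hasFlowDeriv hw2, S.toL2_injective ?_, S.toL2_injective ?_⟩
  · have := SobolevPair.bracket hu hw1 hw2
    change _ = _ + mulL2 μ (ev a) (toL2 μ U1) + mulL2 μ (ev b) (toL2 μ U2) at this
    rwa [mulL2_toL2, mulL2_toL2, ← map_add, ← map_add] at this
  · have := SobolevPair.Weak.strong hW hw1 hw2
    change _ = mulL2 μ (ev b) (toL2 μ U1) - mulL2 μ (ev a) (toL2 μ U2) - _ at this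
    rwa [mulL2_toL2, mulL2_toL2, ← map_add, ← map_sub, ← map_sub] at this

end SurfaceCalculus

end SurfaceCalculus

section TangentCalculus

open Set Filter Topology MeasureTheory Metric
open scoped NNReal ENNReal Convolution

theorem ContDiff.exists_smooth_approx_of_hasCompactSupport {g : R3 → ℝ} (hg : ContDiff ℝ 1 g)
    (hc : HasCompactSupport g) {ε : ℝ} (hε : 0 < ε) :
    ∃ g' : R3 → ℝ, ContDiff ℝ (⊤ : ℕ∞) g' ∧ ∀ x, ‖fderiv ℝ g' x - fderiv ℝ g x‖ ≤ ε := by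
  have hdc : Continuous (fderiv ℝ g) := hg.continuous_fderiv (by simp)
  obtain ⟨δ, hδ, H⟩ := Metric.uniformContinuous_iff.1
    ((hc.fderiv ℝ).uniformContinuous_of_continuous hdc) ε hε
  let φ : ContDiffBump (0 : R3) := ⟨δ / 2, δ, half_pos hδ, half_lt_self hδ⟩
  refine ⟨φ.normed volume ⋆[ContinuousLinearMap.lsmul ℝ ℝ, volume] g,
    φ.hasCompactSupport_normed.contDiff_convolution_left _ φ.contDiff_normed
      hg.continuous.locallyIntegrable, fun x => ?_⟩
  refine ContinuousLinearMap.opNorm_le_bound _ hε.le fun v => ?_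
  rw [(hc.hasFDerivAt_convolution_right (ContinuousLinearMap.lsmul ℝ ℝ)
    (φ.continuous_normed.locallyIntegrable) hg x).fderiv, _root_.sub_apply,
    convolution_precompR_apply _ φ.continuous_normed.locallyIntegrable (hc.fderiv ℝ) hdc,
    ← dist_eq_norm]
  refine φ.dist_normed_convolution_le (g := fun a => fderiv ℝ g a v)
    ((hdc.clm_apply continuous_const).aestronglyMeasurable) fun y hy => ?_
  rw [dist_eq_norm, ← _root_.sub_apply]
  refine (ContinuousLinearMap.le_opNorm _ _).trans ?_
  gcongr
  rw [← dist_eq_norm]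
  exact (H hy).le

theorem ContDiff.exists_smooth_approx {g : R3 → ℝ} (hg : ContDiff ℝ 1 g) {Λ : Set R3}
    (hΛ : IsCompact Λ) {ε : ℝ} (hε : 0 < ε) :
    ∃ g' : R3 → ℝ, ContDiff ℝ (⊤ : ℕ∞) g' ∧ ∀ x ∈ Λ, ‖fderiv ℝ g' x - fderiv ℝ g x‖ ≤ ε := by
  obtain ⟨η, O, hη, hηc, -, hO, hΛO, -, h1⟩ := exists_cutoff hΛ isOpen_univ (subset_univ Λ)
  obtain ⟨g', hg', H⟩ := ContDiff.exists_smooth_approx_of_hasCompactSupport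
    ((hη.of_le (by exact_mod_cast le_top)).mul hg) hηc.mul_right hε
  refine ⟨g', hg', fun x hx => ?_⟩
  have : (fun y => η y * g y) =ᶠ[𝓝 x] g := by
    filter_upwards [hO.mem_nhds (hΛO hx)] with y hy
    rw [h1 y hy, one_mul]
  rw [← this.fderiv_eq]
  exact H x

theorem norm_sq_smul_of_inner_cross3_eq_zero {X Y v : R3} (h : ⟪cross3 X Y, v⟫ = 0) :
    ‖cross3 X Y‖ ^ 2 • v =
      ⟪cross3 Y (cross3 X Y), v⟫ • X + ⟪cross3 (cross3 X Y) X, v⟫ • Y := by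
  rw [← real_inner_self_eq_norm_sq]
  simp only [inner_eq_sum3, cross3_apply_zero, cross3_apply_one, cross3_apply_two] at h ⊢
  refine ext3 ?_ ?_ ?_ <;>
  simp only [PiLp.add_apply, PiLp.smul_apply, smul_eq_mul]
  · linear_combination (X 1 * Y 2 - X 2 * Y 1) * h
  · linear_combination (X 2 * Y 0 - X 0 * Y 2) * h
  · linear_combination (X 0 * Y 1 - X 1 * Y 0) * h

theorem continuous_cross3 {α : Type*} [TopologicalSpace α] {u v : α → R3} (hu : Continuous u)
    (hv : Continuous v) : Continuous fun z => cross3 (u z) (v z) := by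
  have h : ContDiffOn ℝ 0 (fun p : R3 × R3 => cross3 p.1 p.2) univ :=
    contDiff_cross3 contDiff_fst.contDiffOn contDiff_snd.contDiffOn
  exact (contDiffOn_univ.1 h).continuous.comp (hu.prodMk hv)

namespace FramedSurface

variable (S : FramedSurface)

/-- Vectors tangent to the surface are combinations of the frame with controlled coefficients. -/
theorem exists_tangent_coeff : ∃ A : ℝ, 0 ≤ A ∧ ∀ z ∈ S.Λ, ∀ v, fderiv ℝ S.q z v = 0 →
    ∃ α β : ℝ, |α| ≤ A * ‖v‖ ∧ |β| ≤ A * ‖v‖ ∧ v = α • S.X z + β • S.Y z := by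
  have cX := S.smooth_X.continuous
  have cY := S.smooth_Y.continuous
  have cn : Continuous fun z => cross3 (S.X z) (S.Y z) := continuous_cross3 cX cY
  have key : ∀ P : R3 → R3, Continuous P → ∃ A, 0 ≤ A ∧ ∀ z ∈ S.Λ,
      ‖(‖cross3 (S.X z) (S.Y z)‖ ^ 2)⁻¹ • P z‖ ≤ A := fun P hP => by
    obtain ⟨A, hA⟩ := S.isCompact_Λ.exists_bound_of_continuousOn
      (f := fun z => (‖cross3 (S.X z) (S.Y z)‖ ^ 2)⁻¹ • P z)
      (((cn.norm.pow 2).continuousOn.inv₀ fun z hz =>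
        pow_ne_zero _ (norm_ne_zero_iff.2 (S.dq_ne z (S.Λ_subset_O hz)))).smul hP.continuousOn)
    obtain ⟨x, hx⟩ := S.nonempty_Λ
    exact ⟨A, (norm_nonneg _).trans (hA x hx), hA⟩
  obtain ⟨A, hA0, hA⟩ := key _ (continuous_cross3 cY cn)
  obtain ⟨B, hB0, hB⟩ := key _ (continuous_cross3 cn cX)
  refine ⟨max A B, le_max_of_le_left hA0, fun z hz v hv => ⟨_, _,
    (norm_inner_le_norm (𝕜 := ℝ) _ v).trans (mul_le_mul_of_nonneg_right
      ((hA z hz).trans (le_max_left _ _)) (norm_nonneg v)),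
    (norm_inner_le_norm (𝕜 := ℝ) _ v).trans (mul_le_mul_of_nonneg_right
      ((hB z hz).trans (le_max_right _ _)) (norm_nonneg v)), ?_⟩⟩
  rw [S.dq z (S.Λ_subset_O hz)] at hv
  have hn : ‖cross3 (S.X z) (S.Y z)‖ ^ 2 ≠ 0 :=
    pow_ne_zero _ (norm_ne_zero_iff.2 (S.dq_ne z (S.Λ_subset_O hz)))
  rw [inner_smul_left, inner_smul_left, mul_smul, mul_smul, ← smul_add,
    ← norm_sq_smul_of_inner_cross3_eq_zero hv, smul_smul]
  simp [hn]

/-- Pulling back by the first flow distorts the second field by a small tangent amount. -/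
theorem exists_pullback : ∃ r C : ℝ, 0 < r ∧ 0 ≤ C ∧ ∀ h : ℝ, |h| ≤ r → ∀ f : R3 → ℝ,
    ContDiff ℝ 1 f → ContDiff ℝ 1 (fun x => f (S.φ h x)) ∧ ∀ x ∈ S.Λ,
      fderiv ℝ (fun x => f (S.φ h x)) x (S.X x) = fderiv ℝ f (S.φ h x) (S.X (S.φ h x)) ∧
      |fderiv ℝ (fun x => f (S.φ h x)) x (S.Y x) - fderiv ℝ f (S.φ h x) (S.Y (S.φ h x))| ≤
        C * |h| * (|fderiv ℝ f (S.φ h x) (S.X (S.φ h x))| +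
          |fderiv ℝ f (S.φ h x) (S.Y (S.φ h x))|) := by
  obtain ⟨T, J, hT, -, -, HJ⟩ := S.flow_X.exists_fderiv S.lip_X
    (S.smooth_X.differentiable (by simp)) S.lip_DX
  obtain ⟨A, hA0, hA⟩ := S.exists_tangent_coeff
  obtain ⟨L, hL⟩ := S.cs_Y.exists_bound_of_continuous S.smooth_Y.continuous
  obtain ⟨L', hL'⟩ := S.cs_X.exists_bound_of_continuous S.smooth_X.continuous
  have hL0 := (norm_nonneg _).trans (hL 0)
  have hL0' := (norm_nonneg _).trans (hL' 0)
  have hK0 : (0 : ℝ) ≤ S.K := S.K.2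
  refine ⟨T, A * (2 * S.K * L + S.K * L'), hT, by positivity, fun h hh f hf => ?_⟩
  obtain ⟨HJ1, HJ2⟩ := HJ h hh
  have hd : ∀ x, HasFDerivAt (fun x => f (S.φ h x)) ((fderiv ℝ f (S.φ h x)).comp (J h x)) x :=
    fun x => ((hf.differentiable (by simp) _).hasFDerivAt).comp x (HJ1 x).1
  have hfd : fderiv ℝ (fun x => f (S.φ h x)) = fun x => (fderiv ℝ f (S.φ h x)).comp (J h x) :=
    funext fun x => (hd x).fderiv
  have hcs : Continuous (S.φ h) := S.flow_X.continuous_space S.lip_X h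
  refine ⟨contDiff_one_iff_fderiv.2 ⟨fun x => (hd x).differentiableAt, ?_⟩, fun x hx => ?_⟩
  · rw [hfd]
    exact ((hf.continuous_fderiv (by simp)).comp hcs).clm_comp HJ2
  rw [hfd]
  have hJX : J h x (S.X x) = S.X (S.φ h x) := by
    have h1 : HasDerivAt (fun s => S.φ h (S.φ s x)) (J h x (S.X x)) 0 := by
      have h2 := S.flow_X.deriv x 0
      have h3 := (HJ1 x).1
      rw [S.flow_X.zero] at h2
      rw [← S.flow_X.zero x] at h3
      have := h3.comp_hasDerivAt 0 h2
      rwa [S.flow_X.zero] at this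
    have h2 := S.flow_X.deriv (S.φ h x) 0
    rw [S.flow_X.zero] at h2
    refine h1.unique (h2.congr_of_eventuallyEq (Eventually.of_forall fun s => ?_))
    change S.φ h (S.φ s x) = S.φ s (S.φ h x)
    rw [← S.flow_X.add S.lip_X, ← S.flow_X.add S.lip_X, add_comm]
  refine ⟨by rw [ContinuousLinearMap.comp_apply, hJX], ?_⟩
  set z := S.φ h x with hz
  have hzΛ : z ∈ S.Λ := S.φ_mem hx h
  have hdq : fderiv ℝ S.q z (J h x (S.Y x)) = 0 := by
    have h1 := ((S.differentiable_q z).hasFDerivAt.comp x (HJ1 x).1).fderiv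
    have h2 : S.q ∘ S.φ h = S.q := funext fun y => S.q_φ h y
    rw [h2] at h1
    rw [← ContinuousLinearMap.comp_apply, ← h1, S.dqY]
  obtain ⟨α, β, hα, hβ, hv⟩ := hA z hzΛ (J h x (S.Y x) - S.Y z) (by rw [map_sub, hdq, S.dqY, sub_zero])
  have hnorm : ‖J h x (S.Y x) - S.Y z‖ ≤ (2 * S.K * L + S.K * L') * |h| := by
    have e : J h x (S.Y x) - S.Y z = (J h x - ContinuousLinearMap.id ℝ R3) (S.Y x) +
        (S.Y x - S.Y z) := by simp
    have h1 : ‖(J h x - ContinuousLinearMap.id ℝ R3) (S.Y x)‖ ≤ 2 * S.K * |h| * L :=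
      (ContinuousLinearMap.le_opNorm _ _).trans
        (mul_le_mul (HJ1 x).2 (hL x) (norm_nonneg _) (by positivity))
    have h2 : ‖S.Y x - S.Y z‖ ≤ S.K * (L' * |h|) := by
      rw [← dist_eq_norm]
      refine (S.lip_Y.dist_le_mul x z).trans ?_
      gcongr
      rw [dist_comm, dist_eq_norm, hz]
      have := Convex.norm_image_sub_le_of_norm_hasDerivWithin_le
        (f := fun s => S.φ s x) (s := univ) (C := L') (x := 0) (y := h)
        (fun s _ => (S.flow_X.deriv x s).hasDerivWithinAt) (fun s _ => hL' _) convex_univ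
        (mem_univ _) (mem_univ _)
      simpa [S.flow_X.zero] using this
    rw [e]
    refine (norm_add_le _ _).trans ?_
    linarith
  rw [ContinuousLinearMap.comp_apply, ← map_sub, hv, map_add, map_smul, map_smul, smul_eq_mul,
    smul_eq_mul]
  set a := fderiv ℝ f z (S.X z)
  set b := fderiv ℝ f z (S.Y z)
  have hα' := hα.trans (mul_le_mul_of_nonneg_left hnorm hA0)
  have hβ' := hβ.trans (mul_le_mul_of_nonneg_left hnorm hA0)
  calc |α * a + β * b| ≤ |α| * |a| + |β| * |b| := by
        rw [← abs_mul, ← abs_mul]; exact abs_add_le _ _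
    _ ≤ A * ((2 * S.K * L + S.K * L') * |h|) * |a| + A * ((2 * S.K * L + S.K * L') * |h|) * |b| := by
        gcongr
    _ = _ := by ring

end FramedSurface

end TangentCalculus

section FramedSurfaceCalculus

open Set Filter Topology MeasureTheory Metric
open scoped NNReal ENNReal

/-- Smooth functions on `ℝ³`. -/
abbrev Smooth3 : Type := {f : R3 → ℝ // ContDiff ℝ (⊤ : ℕ∞) f}

/-- The derivative of a smooth function along a smooth field. -/
def Smooth3.along (v : R3 → R3) (hv : ContDiff ℝ (⊤ : ℕ∞) v) (f : Smooth3) : Smooth3 :=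
  ⟨fun z => fderiv ℝ f.1 z (v z), (f.2.fderiv_right (m := ((⊤ : ℕ∞) : WithTop ℕ∞)) le_rfl).clm_apply hv⟩

theorem contDiff_dv {v : R3 → R3} (hv : ContDiff ℝ (⊤ : ℕ∞) v) : ContDiff ℝ (⊤ : ℕ∞) (dv v) := by
  unfold dv
  refine ContDiff.sum fun i _ => ?_
  exact (contDiff_coord i).comp
    ((hv.fderiv_right (m := ((⊤ : ℕ∞) : WithTop ℕ∞)) le_rfl).clm_apply contDiff_const)

namespace FramedSurface

variable (S : FramedSurface)

instance : CompactSpace S.Λ := isCompact_iff_compactSpace.1 S.isCompact_Λ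

instance : PreconnectedSpace S.Λ := Subtype.preconnectedSpace S.isPreconnected_Λ

instance : Nonempty S.Λ := S.nonempty_Λ.to_subtype

/-- The first flow on the surface. -/
def flow (t : ℝ) : C(S.Λ, S.Λ) :=
  ⟨fun x => ⟨S.φ t x, S.φ_mem x.2 t⟩, ((S.flow_X.continuous_space S.lip_X t).comp
    continuous_subtype_val).subtype_mk _⟩

/-- The second flow on the surface. -/
def flow' (t : ℝ) : C(S.Λ, S.Λ) := S.swap.flow t

@[simp] theorem coe_flow (t : ℝ) (x : S.Λ) : (S.flow t x : R3) = S.φ t x := rfl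

@[simp] theorem coe_flow' (t : ℝ) (x : S.Λ) : (S.flow' t x : R3) = S.ψ t x := rfl

theorem contFlow_flow : ContFlow S.flow where
  cont := (S.continuous_φ.comp (by fun_prop : Continuous fun q : ℝ × S.Λ => (q.1, (q.2 : R3)))).subtype_mk _
  zero x := Subtype.ext (S.flow_X.zero x)
  add s t x := Subtype.ext (S.flow_X.add S.lip_X s t x)

/-- Restrictions to the surface of `C¹` functions, with their derivatives along the frame. -/
def triples : Submodule ℝ (C(S.Λ, ℝ) × C(S.Λ, ℝ) × C(S.Λ, ℝ)) where
  carrier := {T | ∃ f : R3 → ℝ, ContDiff ℝ 1 f ∧ ∀ x : S.Λ, T.1 x = f x ∧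
    T.2.1 x = fderiv ℝ f x (S.X x) ∧ T.2.2 x = fderiv ℝ f x (S.Y x)}
  add_mem' := by
    rintro T T' ⟨f, hf, h⟩ ⟨g, hg, h'⟩
    refine ⟨fun z => f z + g z, hf.add hg, fun x => ?_⟩
    rw [fderiv_fun_add (hf.differentiable (by simp) _) (hg.differentiable (by simp) _)]
    exact ⟨by simp [h, h'], by simp [h, h'], by simp [h, h']⟩
  zero_mem' := ⟨fun _ => 0, contDiff_const, fun x => by simp⟩
  smul_mem' := by
    rintro c T ⟨f, hf, h⟩
    refine ⟨fun z => c * f z, contDiff_const.mul hf, fun x => ?_⟩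
    rw [fderiv_const_mul (hf.differentiable (by simp) _)]
    exact ⟨by simp [h], by simp [h], by simp [h]⟩

theorem mem_triples {f f1 f2 : C(S.Λ, ℝ)} : (f, f1, f2) ∈ S.triples ↔ ∃ g : R3 → ℝ,
    ContDiff ℝ 1 g ∧ ∀ x : S.Λ, f x = g x ∧ f1 x = fderiv ℝ g x (S.X x) ∧
      f2 x = fderiv ℝ g x (S.Y x) := Iff.rfl

/-- Restriction of a smooth function to the surface. -/
def restrict (f : Smooth3) : C(S.Λ, ℝ) :=
  ⟨fun x => f.1 x, f.2.continuous.comp continuous_subtype_val⟩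

/-- The divergence of the first field, up to sign. -/
def coeffB : Smooth3 := ⟨fun z => -dv S.X z, (contDiff_dv S.smooth_X).neg⟩

/-- The divergence of the second field. -/
def coeffA : Smooth3 := ⟨dv S.Y, contDiff_dv S.smooth_Y⟩

theorem triples_swap : S.swap.triples = swapTriples S.triples :=
  Submodule.ext fun _ => exists_congr fun _ => and_congr_right fun _ => forall_congr' fun _ =>
    and_congr_right fun _ => and_comm

theorem mul_mem_triples {f f1 f2 g g1 g2 : C(S.Λ, ℝ)} (hf : (f, f1, f2) ∈ S.triples)
    (hg : (g, g1, g2) ∈ S.triples) : (f * g, f * g1 + f1 * g, f * g2 + f2 * g) ∈ S.triples := by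
  rw [mem_triples] at hf hg ⊢
  obtain ⟨F, hF, h⟩ := hf
  obtain ⟨G, hG, h'⟩ := hg
  refine ⟨fun z => F z * G z, hF.mul hG, fun x => ?_⟩
  rw [fderiv_fun_mul (hF.differentiable (by simp) _) (hG.differentiable (by simp) _)]
  refine ⟨by simp [h, h'], ?_, ?_⟩ <;> simp [h, h'] <;> ring

theorem one_mem_triples :
    ((1 : C(S.Λ, ℝ)), (0 : C(S.Λ, ℝ)), (0 : C(S.Λ, ℝ))) ∈ S.triples :=
  ⟨fun _ => 1, contDiff_const, fun x => by simp⟩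

theorem restrict_mem_triples (f : Smooth3) : (S.restrict f, S.restrict (f.along S.X S.smooth_X),
    S.restrict (f.along S.Y S.smooth_Y)) ∈ S.triples :=
  ⟨f.1, f.2.of_le (by exact_mod_cast le_top), fun _ => ⟨rfl, rfl, rfl⟩⟩

theorem dense_triples : Dense {f : C(S.Λ, ℝ) | ∃ f1 f2, (f, f1, f2) ∈ S.triples} := by
  let A : Subalgebra ℝ C(S.Λ, ℝ) :=
    { carrier := {f | ∃ f1 f2, (f, f1, f2) ∈ S.triples}
      mul_mem' := fun ⟨_, _, hf⟩ ⟨_, _, hg⟩ => ⟨_, _, S.mul_mem_triples hf hg⟩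
      add_mem' := fun ⟨_, _, hf⟩ ⟨_, _, hg⟩ => ⟨_, _, S.triples.add_mem hf hg⟩
      algebraMap_mem' := fun c => by
        have := S.triples.smul_mem c S.one_mem_triples
        refine ⟨_, _, (?_ : (algebraMap ℝ C(S.Λ, ℝ) c, c • (0 : C(S.Λ, ℝ)), c • (0 : C(S.Λ, ℝ))) ∈ _)⟩
        rwa [Algebra.algebraMap_eq_smul_one] }
  have hsep : A.SeparatesPoints := by
    intro x y hxy
    have : ∃ i, (x : R3) i ≠ (y : R3) i := by
      by_contra! hne
      exact hxy (Subtype.ext (by ext i; exact hne i))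
    obtain ⟨i, hi⟩ := this
    exact ⟨_, ⟨S.restrict ⟨fun z => z i, contDiff_coord i⟩, ⟨_, _, S.restrict_mem_triples _⟩, rfl⟩, hi⟩
  have h := ContinuousMap.subalgebra_topologicalClosure_eq_top_of_separatesPoints A hsep
  intro f
  have h2 : f ∈ A.topologicalClosure := h ▸ Algebra.mem_top
  exact h2

theorem exists_derivationFlow (c : S.Cutoff) {μ : Measure S.Λ} [IsFiniteMeasure μ]
    (hμ : c.IsLimit μ) :
    ∃ r C, DerivationFlow μ S.triples S.flow (S.restrict S.coeffB) r C := by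
  obtain ⟨r, C, hr, hC, H⟩ := S.exists_pullback
  refine ⟨r, C, { S.contFlow_flow with
    dense := S.dense_triples
    one_mem := S.one_mem_triples
    deriv := ?_
    ibp := ?_
    r_pos := hr
    C_nonneg := hC
    trans := ?_ }⟩
  · rintro f f1 f2 ⟨g, hg, h⟩ x t
    have h1 := (hg.differentiable (by simp) (S.φ t x)).hasFDerivAt.comp_hasDerivAt t
      (S.flow_X.deriv x t)
    rw [(h (S.flow t x)).2.1]
    exact h1.congr_of_eventuallyEq (Eventually.of_forall fun s => (h (S.flow s x)).1)
  · rintro f f1 f2 ⟨g, hg, h⟩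
    have h1 := hμ.integral_fderiv c hg
    rw [← integral_neg] at h1
    calc ∫ x, f1 x ∂μ = ∫ x : S.Λ, fderiv ℝ g x (S.X x) ∂μ := integral_congr_ae
          (Eventually.of_forall fun x => (h x).2.1)
      _ = _ := h1
      _ = _ := integral_congr_ae (Eventually.of_forall fun x => by
          change -(g x * dv S.X x) = -dv S.X x * f x
          rw [show f x = g x from (h x).1]
          ring)
  · rintro k hk f f1 f2 ⟨g, hg, h⟩
    obtain ⟨hg1, hg2⟩ := H k hk g hg
    let G : C(S.Λ, ℝ) := ⟨fun x => fderiv ℝ (fun x => g (S.φ k x)) x (S.Y x),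
      ((hg1.continuous_fderiv (by simp)).clm_apply S.smooth_Y.continuous).comp
        continuous_subtype_val⟩
    refine ⟨G, ⟨_, hg1, fun x => ⟨(h (S.flow k x)).1, ?_, rfl⟩⟩, fun x => ?_⟩
    · rw [(hg2 x x.2).1]
      exact (h (S.flow k x)).2.1
    · have h1 := (h (S.flow k x)).2.1
      have h2 := (h (S.flow k x)).2.2
      dsimp only at h1 h2
      rw [h1, h2]
      exact (hg2 x x.2).2

theorem cross_of_smooth (c : S.Cutoff) {μ : Measure S.Λ} [IsFiniteMeasure μ] (hμ : c.IsLimit μ)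
    {f : R3 → ℝ} (hf : ContDiff ℝ 1 f) {g : R3 → ℝ} (hg : ContDiff ℝ (⊤ : ℕ∞) g) :
    ∫ x : S.Λ, fderiv ℝ f x (S.X x) * fderiv ℝ g x (S.Y x) ∂μ =
      ∫ x : S.Λ, fderiv ℝ f x (S.Y x) * fderiv ℝ g x (S.X x) ∂μ := by
  have key : ∀ {v w : R3 → R3}, ContDiff ℝ (⊤ : ℕ∞) v → ContDiff ℝ (⊤ : ℕ∞) w →
      (∀ {F : R3 → ℝ}, ContDiff ℝ 1 F →
        ∫ x : S.Λ, fderiv ℝ F x (v x) ∂μ = -∫ x : S.Λ, F x * dv v x ∂μ) →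
      ∫ x : S.Λ, fderiv ℝ f x (v x) * fderiv ℝ g x (w x) ∂μ =
        -∫ x : S.Λ, f x * (fderiv ℝ (fun z => fderiv ℝ g z (w z)) x (v x) +
          fderiv ℝ g x (w x) * dv v x) ∂μ := by
    intro v w hv hw hI
    have hW : ContDiff ℝ (⊤ : ℕ∞) fun z => fderiv ℝ g z (w z) :=
      (hg.fderiv_right (m := ((⊤ : ℕ∞) : WithTop ℕ∞)) le_rfl).clm_apply hw
    have hW1 : ContDiff ℝ 1 fun z => fderiv ℝ g z (w z) := hW.of_le (by exact_mod_cast le_top)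
    have h1 := hI (hf.mul hW1)
    have e : ∀ x : R3, fderiv ℝ (fun z => f z * fderiv ℝ g z (w z)) x (v x) =
        f x * fderiv ℝ (fun z => fderiv ℝ g z (w z)) x (v x) +
          fderiv ℝ f x (v x) * fderiv ℝ g x (w x) := fun x => by
      rw [fderiv_fun_mul (hf.differentiable (by simp) _) (hW1.differentiable (by simp) _)]
      simp only [_root_.add_apply, _root_.smul_apply, smul_eq_mul]
      ring
    have hfc := hf.continuous
    have c1 : Continuous fun z => fderiv ℝ f z (v z) :=
      (hf.continuous_fderiv (by simp)).clm_apply hv.continuous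
    have c2 : Continuous fun z => fderiv ℝ (fun z => fderiv ℝ g z (w z)) z (v z) :=
      (hW1.continuous_fderiv (by simp)).clm_apply hv.continuous
    have c3 := hW1.continuous
    have c4 := (contDiff_dv hv).continuous
    have i1 : Integrable (fun x : S.Λ => f x * fderiv ℝ (fun z => fderiv ℝ g z (w z)) x (v x)) μ :=
      integrable_cont μ ⟨_, (hfc.mul c2).comp continuous_subtype_val⟩
    have i2 : Integrable (fun x : S.Λ => fderiv ℝ f x (v x) * fderiv ℝ g x (w x)) μ :=
      integrable_cont μ ⟨_, (c1.mul c3).comp continuous_subtype_val⟩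
    have i3 : Integrable (fun x : S.Λ => f x * (fderiv ℝ g x (w x) * dv v x)) μ :=
      integrable_cont μ ⟨_, (hfc.mul (c3.mul c4)).comp continuous_subtype_val⟩
    simp_rw [e] at h1
    rw [integral_add i1 i2] at h1
    simp_rw [mul_assoc] at h1
    simp_rw [mul_add]
    rw [integral_add i1 i3]
    linarith
  rw [key S.smooth_X S.smooth_Y (hμ.integral_fderiv c),
    key S.smooth_Y S.smooth_X ((hμ.swap c).integral_fderiv c.swap)]
  congr 1
  refine integral_congr_ae (Eventually.of_forall fun x => ?_)
  have hd : Differentiable ℝ (fderiv ℝ g) :=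
    (hg.fderiv_right (m := 1) (WithTop.coe_le_coe.2 le_top)).differentiable (by simp)
  have e : ∀ {w : R3 → R3}, ContDiff ℝ (⊤ : ℕ∞) w → ∀ v,
      fderiv ℝ (fun z => fderiv ℝ g z (w z)) x v =
        fderiv ℝ (fderiv ℝ g) x v (w x) + fderiv ℝ g x (fderiv ℝ w x v) := fun hw v => by
    rw [fderiv_clm_apply (hd _) (hw.differentiable (by simp) _)]
    simp [add_comm]
  have hsym : fderiv ℝ (fderiv ℝ g) x (S.X x) (S.Y x) = fderiv ℝ (fderiv ℝ g) x (S.Y x) (S.X x) :=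
    (hg.contDiffAt.isSymmSndFDerivAt
      (by simp only [minSmoothness_of_isRCLikeNormedField]; exact WithTop.coe_le_coe.2 le_top)).eq _ _
  have hb := congrArg (fderiv ℝ g x) (S.bracket (S.Λ_subset_O x.2))
  simp only [map_sub, map_smul, smul_eq_mul] at hb
  dsimp only
  rw [e S.smooth_Y, e S.smooth_X, hsym]
  linear_combination (f x) * hb

theorem cross_triples (c : S.Cutoff) {μ : Measure S.Λ} [IsFiniteMeasure μ] (hμ : c.IsLimit μ)
    {f f1 f2 g g1 g2 : C(S.Λ, ℝ)} (hf : (f, f1, f2) ∈ S.triples) (hg : (g, g1, g2) ∈ S.triples) :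
    ∫ x, f1 x * g2 x ∂μ = ∫ x, f2 x * g1 x ∂μ := by
  rw [mem_triples] at hf hg
  obtain ⟨F, hF, h⟩ := hf
  obtain ⟨G, hG, h'⟩ := hg
  obtain ⟨LX, hLX⟩ := S.cs_X.exists_bound_of_continuous S.smooth_X.continuous
  obtain ⟨LY, hLY⟩ := S.cs_Y.exists_bound_of_continuous S.smooth_Y.continuous
  have hX0 := (norm_nonneg _).trans (hLX 0)
  have hY0 := (norm_nonneg _).trans (hLY 0)
  have bound : ∀ ε > 0, |∫ x, (f1 x * g2 x - f2 x * g1 x) ∂μ| ≤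
      ((‖f1‖ * LY + ‖f2‖ * LX) * ε) * μ.real univ := by
    intro ε hε
    obtain ⟨G', hG', H⟩ := hG.exists_smooth_approx S.isCompact_Λ hε
    have h0 := S.cross_of_smooth c hμ hF hG'
    let gX := S.restrict (Smooth3.along S.X S.smooth_X ⟨G', hG'⟩)
    let gY := S.restrict (Smooth3.along S.Y S.smooth_Y ⟨G', hG'⟩)
    have h1 : ∫ x, (f1 x * gY x - f2 x * gX x) ∂μ = 0 := by
      have i1 : Integrable (fun x => f1 x * gY x) μ := integrable_cont μ (f1 * gY)
      have i2 : Integrable (fun x => f2 x * gX x) μ := integrable_cont μ (f2 * gX)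
      rw [integral_sub i1 i2, sub_eq_zero]
      refine (integral_congr_ae (Eventually.of_forall fun x => ?_)).trans (h0.trans
        (integral_congr_ae (Eventually.of_forall fun x => ?_)))
      · rw [(h x).2.1]
        rfl
      · change _ = f2 x * _
        rw [(h x).2.2]
        rfl
    have e : ∫ x, (f1 x * g2 x - f2 x * g1 x) ∂μ =
        ∫ x, (f1 x * (g2 x - gY x) - f2 x * (g1 x - gX x)) ∂μ := by
      have i1 : Integrable (fun x => f1 x * g2 x - f2 x * g1 x) μ :=
        integrable_cont μ (f1 * g2 - f2 * g1)
      have i2 : Integrable (fun x => f1 x * gY x - f2 x * gX x) μ :=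
        integrable_cont μ (f1 * gY - f2 * gX)
      rw [← sub_zero (∫ x, (f1 x * g2 x - f2 x * g1 x) ∂μ), ← h1, ← integral_sub i1 i2]
      exact integral_congr_ae (Eventually.of_forall fun x => by dsimp only; ring)
    rw [e, ← Real.norm_eq_abs]
    refine norm_integral_le_of_norm_le_const (Eventually.of_forall fun x => ?_)
    have b1 : |g2 x - gY x| ≤ ε * LY := by
      rw [(h' x).2.2, abs_sub_comm]
      change |fderiv ℝ G' x (S.Y x) - _| ≤ _
      rw [← _root_.sub_apply, ← Real.norm_eq_abs]
      exact (ContinuousLinearMap.le_opNorm _ _).trans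
        (mul_le_mul (H x x.2) (hLY x) (norm_nonneg _) hε.le)
    have b2 : |g1 x - gX x| ≤ ε * LX := by
      rw [(h' x).2.1, abs_sub_comm]
      change |fderiv ℝ G' x (S.X x) - _| ≤ _
      rw [← _root_.sub_apply, ← Real.norm_eq_abs]
      exact (ContinuousLinearMap.le_opNorm _ _).trans
        (mul_le_mul (H x x.2) (hLX x) (norm_nonneg _) hε.le)
    have c1 : |f1 x| ≤ ‖f1‖ := f1.norm_coe_le_norm x
    have c2 : |f2 x| ≤ ‖f2‖ := f2.norm_coe_le_norm x
    calc ‖f1 x * (g2 x - gY x) - f2 x * (g1 x - gX x)‖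
        ≤ |f1 x| * |g2 x - gY x| + |f2 x| * |g1 x - gX x| := by
          rw [← abs_mul, ← abs_mul]; exact norm_sub_le _ _
      _ ≤ ‖f1‖ * (ε * LY) + ‖f2‖ * (ε * LX) := by gcongr
      _ = _ := by ring
  have hlim : Tendsto (fun ε : ℝ => ((‖f1‖ * LY + ‖f2‖ * LX) * ε) * μ.real univ) (𝓝[>] 0) (𝓝 0) := by
    refine Tendsto.mono_left ?_ nhdsWithin_le_nhds
    have : Continuous fun ε : ℝ => ((‖f1‖ * LY + ‖f2‖ * LX) * ε) * μ.real univ := by fun_prop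
    simpa using this.tendsto 0
  have h2 := ge_of_tendsto hlim (eventually_mem_nhdsWithin.mono bound)
  have i1 : Integrable (fun x => f1 x * g2 x) μ := integrable_cont μ (f1 * g2)
  have i2 : Integrable (fun x => f2 x * g1 x) μ := integrable_cont μ (f2 * g1)
  rw [← sub_eq_zero, ← integral_sub i1 i2]
  exact abs_nonpos_iff.1 h2

theorem eq_const_of_invariant {F : C(S.Λ, ℝ)} (h1 : ∀ t x, F (S.flow t x) = F x)
    (h2 : ∀ t x, F (S.flow' t x) = F x) : ∃ c : ℝ, F = c • 1 := by
  obtain ⟨κ, C, hκ, -, H⟩ := S.exists_short_path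
  have hloc : IsLocallyConstant F := (IsLocallyConstant.iff_eventually_eq _).2 fun x => by
    filter_upwards [ball_mem_nhds x hκ] with z hz
    have hz' : ‖(z : R3) - x‖ ≤ κ := by
      rw [← dist_eq_norm]
      exact (mem_ball.1 hz).le
    obtain ⟨s, t, -, -, hst⟩ := H x x.2 z z.2 hz'
    have : S.flow' t (S.flow s x) = z := Subtype.ext hst
    rw [← this, h2, h1]
  obtain ⟨x₀⟩ := (inferInstance : Nonempty S.Λ)
  refine ⟨F x₀, ContinuousMap.ext fun x => ?_⟩
  simp [hloc.apply_eq_of_preconnectedSpace x x₀]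

theorem exists_surfaceCalculus : ∃ (μ : Measure S.Λ) (_ : IsFiniteMeasure μ) (r C r' C' δ D : ℝ),
    SurfaceCalculus μ S.triples S.flow S.flow' S.restrict (Smooth3.along S.X S.smooth_X)
      (Smooth3.along S.Y S.smooth_Y) S.coeffA S.coeffB r C r' C' δ D := by
  obtain ⟨c⟩ := S.nonempty_cutoff
  obtain ⟨μ, hfin, hμ⟩ := c.exists_isLimit
  obtain ⟨r, C, h1⟩ := S.exists_derivationFlow c hμ
  obtain ⟨r', C', h2⟩ := @exists_derivationFlow S.swap c.swap μ hfin (hμ.swap c)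
  obtain ⟨δ, D, hδ, hD, hlow⟩ := hμ.exists_lower_bound
  have h2' : DerivationFlow μ (swapTriples S.triples) S.flow' (-S.restrict S.coeffA) r' C' := by
    have := S.triples_swap ▸ h2
    exact this
  set δ' := min (min δ 1) (min r r') with hδ'
  have hδ'δ : δ' ≤ δ := (min_le_left _ _).trans (min_le_left _ _)
  refine ⟨μ, hfin, r, C, r', C', δ', D, {
    fst := h1
    snd := h2'
    δ_pos := lt_min (lt_min hδ one_pos) (lt_min h1.r_pos h2'.r_pos)
    δ_le_one := (min_le_left _ _).trans (min_le_right _ _)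
    δ_le := (min_le_right _ _).trans (min_le_left _ _)
    δ_le' := (min_le_right _ _).trans (min_le_right _ _)
    lower := fun x F hF => ?_
    conn := fun F => S.eq_const_of_invariant
    ev_mem := S.restrict_mem_triples
    mul_mem := fun f f1 f2 g g1 g2 => S.mul_mem_triples
    cross := fun f f1 f2 g g1 g2 => S.cross_triples c hμ }⟩
  obtain ⟨G, hG⟩ := ContinuousMap.exists_restrict_eq S.isCompact_Λ.isClosed F
  have hGF : ∀ z : S.Λ, G z = F z := fun z => congrArg (fun F : C(S.Λ, ℝ) => F z) hG
  let G' : C(R3, ℝ) := ⟨fun z => |G z|, G.continuous.abs⟩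
  have hG' : ∀ z : S.Λ, G' z = F z := fun z => by
    change |G z| = _
    rw [hGF, abs_of_nonneg (hF z)]
  have h3 := hlow x x.2 G' fun z => abs_nonneg _
  have e1 : ∀ p : ℝ × ℝ, F (S.flow' p.2 (S.flow p.1 x)) = G' (S.ψ p.2 (S.φ p.1 x)) := fun p =>
    (hG' _).symm
  simp_rw [e1]
  simp_rw [hG'] at h3
  refine (setIntegral_mono_set ?_ (Eventually.of_forall fun p => abs_nonneg _)
    (Eventually.of_forall ?_)).trans h3
  · exact (G'.continuous.comp (S.continuous_flow_comp x)).continuousOn.integrableOn_compact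
      (isCompact_Icc.prod isCompact_Icc)
  · exact prod_mono (Icc_subset_Icc_right hδ'δ) (Icc_subset_Icc_right hδ'δ)

end FramedSurface

end FramedSurfaceCalculus

section CommutingFlows

set_option linter.unusedSectionVars false

open Set Filter Topology Metric
open scoped NNReal

variable {E : Type*} [NormedAddCommGroup E] [NormedSpace ℝ E]

theorem norm_sub_smul_le_of_hasDerivAt {γ γ' : ℝ → E} {v : E} {C h : ℝ}
    (hγ : ∀ t, |t| ≤ |h| → HasDerivAt γ (γ' t) t) (hC : ∀ t, |t| ≤ |h| → ‖γ' t - v‖ ≤ C) :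
    ‖γ h - γ 0 - h • v‖ ≤ C * |h| := by
  have := Convex.norm_image_sub_le_of_norm_hasDerivWithin_le
    (f := fun t => γ t - t • v) (f' := fun t => γ' t - v) (s := Icc (-|h|) |h|) (C := C) (x := 0)
    (y := h) (fun t ht => by
      have h1 := (hasDerivAt_id t).smul_const v
      rw [one_smul] at h1
      exact ((hγ t (abs_le.2 ht)).sub h1).hasDerivWithinAt)
    (fun t ht => hC t (abs_le.2 ht)) (convex_Icc _ _) (by simp) (abs_le.1 le_rfl)
  rw [sub_zero, Real.norm_eq_abs] at this
  convert this using 2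
  simp only [zero_smul, sub_zero]
  abel

namespace IsFlow

variable {v : E → E} {φ : ℝ → E → E} {K : ℝ≥0} {L : ℝ}

theorem norm_sub_self_le (hφ : IsFlow v φ) (hL : ∀ x, ‖v x‖ ≤ L) (h : ℝ) (x : E) :
    ‖φ h x - x‖ ≤ L * |h| := by
  have := norm_sub_smul_le_of_hasDerivAt (v := 0) (h := h) (fun t _ => hφ.deriv x t)
    (fun t _ => by simpa using hL _)
  simpa [hφ.zero] using this

theorem norm_sub_taylor_le (hφ : IsFlow v φ) (hK : LipschitzWith K v) (hL : ∀ x, ‖v x‖ ≤ L) (h : ℝ)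
    (x : E) : ‖φ h x - x - h • v x‖ ≤ K * (L * |h|) * |h| := by
  have hL0 : 0 ≤ L := (norm_nonneg _).trans (hL 0)
  have := norm_sub_smul_le_of_hasDerivAt (v := v x) (h := h) (C := K * (L * |h|))
    (fun t _ => hφ.deriv x t) (fun t ht => by
      refine (hK.norm_sub_le _ _).trans ?_
      have := (hφ.norm_sub_self_le hL t x).trans (mul_le_mul_of_nonneg_left ht hL0)
      gcongr)
  simpa [hφ.zero] using this

end IsFlow

variable {v w W : E → E} {α β : ℝ → E → E} {K : ℝ≥0} {L : ℝ} {N : Set E}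

theorem exists_commutator_bound (hα : IsFlow v α) (hβ : IsFlow w β) (hv : LipschitzWith K v)
    (hw : LipschitzWith K w) (hLv : ∀ x, ‖v x‖ ≤ L) (hLw : ∀ x, ‖w x‖ ≤ L)
    (hNα : ∀ x ∈ N, ∀ t, α t x ∈ N) (hNβ : ∀ x ∈ N, ∀ t, β t x ∈ N) (hW : UniformContinuousOn W N)
    (h1 : ∀ x ∈ N, ∀ t, HasDerivAt (fun t => w (α t x)) (W (α t x)) t)
    (h2 : ∀ x ∈ N, ∀ t, HasDerivAt (fun t => v (β t x)) (W (β t x)) t) (s : ℝ) {ε : ℝ}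
    (hε : 0 < ε) : ∃ δ > 0, ∀ h, |h| ≤ δ → ∀ x ∈ N, ‖β h (α s x) - α s (β h x)‖ ≤ ε * |h| := by
  have hL0 : 0 ≤ L := (norm_nonneg _).trans (hLv 0)
  have hK0 : (0 : ℝ) ≤ K := K.2
  set B : ℝ := (K * L + (1 + K * (K * L)) * |s|) * Real.exp (K * |s|) + K * L with hB
  have hB0 : 0 ≤ B := by positivity
  set e := ε / (B + 1) with he
  have he0 : 0 < e := by positivity
  obtain ⟨δ₀, hδ₀, H⟩ := Metric.uniformContinuousOn_iff_le.1 hW e he0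
  refine ⟨min e (δ₀ / (L + 1)), by positivity, fun h hh x hx => ?_⟩
  have hhe : |h| ≤ e := hh.trans (min_le_left _ _)
  have hhδ : L * |h| ≤ δ₀ := by
    have h3 : |h| ≤ δ₀ / (L + 1) := hh.trans (min_le_right _ _)
    rw [le_div_iff₀ (by positivity)] at h3
    nlinarith [abs_nonneg h]
  have hvar : ∀ y ∈ N, ‖v (β h y) - v y - h • W y‖ ≤ e * |h| := fun y hy => by
    have := norm_sub_smul_le_of_hasDerivAt (v := W y) (h := h) (C := e)
      (fun t _ => h2 y hy t) (fun t ht => by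
        rw [← dist_eq_norm]
        refine H _ (hNβ y hy t) _ hy ?_
        rw [dist_eq_norm]
        exact (hβ.norm_sub_self_le hLw t y).trans
          ((mul_le_mul_of_nonneg_left ht hL0).trans hhδ))
    simpa [hβ.zero] using this
  set c : ℝ → E := fun t => α t x + h • w (α t x) with hc
  have hcβ : ∀ t, ‖β h (α t x) - c t‖ ≤ K * L * e * |h| := fun t => by
    have h3 := hβ.norm_sub_taylor_le hw hLw h (α t x)
    rw [hc, ← sub_sub]
    refine h3.trans ?_
    have : K * (L * |h|) * |h| ≤ K * (L * e) * |h| := by gcongr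
    linarith
  have hdef : ∀ t, ‖v (α t x) + h • W (α t x) - v (c t)‖ ≤ (1 + K * (K * L)) * e * |h| := fun t => by
    have h3 := hvar _ (hNα x hx t)
    have h4 : ‖v (β h (α t x)) - v (c t)‖ ≤ K * (K * L * e * |h|) :=
      (hv.norm_sub_le _ _).trans (mul_le_mul_of_nonneg_left (hcβ t) hK0)
    have h5 : v (α t x) + h • W (α t x) - v (c t) = (v (β h (α t x)) - v (c t)) -
        (v (β h (α t x)) - v (α t x) - h • W (α t x)) := by abel
    rw [h5]
    refine (norm_sub_le _ _).trans ?_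
    linarith
  have hgr := norm_le_of_deriv_bound (y := fun t => c t - α t (β h x))
    (y' := fun t => v (α t x) + h • W (α t x) - v (α t (β h x))) (T := |s|) (K := K)
    (δ := K * L * e * |h|) (ε := (1 + K * (K * L)) * e * |h|) hK0 (by positivity)
    (fun t _ => ((hα.deriv x t).add ((h1 x hx t).const_smul h)).sub (hα.deriv (β h x) t))
    (by
      rw [hα.zero, norm_sub_rev]
      have := hcβ 0
      rwa [hα.zero] at this)
    (fun t _ => by
      have h5 : v (α t x) + h • W (α t x) - v (α t (β h x)) =
          (v (c t) - v (α t (β h x))) + (v (α t x) + h • W (α t x) - v (c t)) := by abel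
      rw [h5]
      exact (norm_add_le _ _).trans (add_le_add (hv.norm_sub_le _ _) (hdef t))) s le_rfl
  have h6 : β h (α s x) - α s (β h x) = (β h (α s x) - c s) + (c s - α s (β h x)) := by abel
  rw [h6]
  refine ((norm_add_le _ _).trans (add_le_add (hcβ s) hgr)).trans ?_
  have h7 : K * L * e * |h| + (K * L * e * |h| + (1 + K * (K * L)) * e * |h| * |s|) *
      Real.exp (K * |s|) = B * e * |h| := by rw [hB]; ring
  rw [h7]
  have h8 : B * e ≤ ε := by
    rw [he, mul_div_assoc', div_le_iff₀ (by positivity)]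
    nlinarith
  gcongr

/-- Flows of Lipschitz fields commute on an invariant set where the two mixed derivatives of the
fields agree. -/
theorem commute_of_derivs_eq (hα : IsFlow v α) (hβ : IsFlow w β) (hv : LipschitzWith K v)
    (hw : LipschitzWith K w) (hLv : ∀ x, ‖v x‖ ≤ L) (hLw : ∀ x, ‖w x‖ ≤ L)
    (hNα : ∀ x ∈ N, ∀ t, α t x ∈ N) (hNβ : ∀ x ∈ N, ∀ t, β t x ∈ N) (hW : UniformContinuousOn W N)
    (h1 : ∀ x ∈ N, ∀ t, HasDerivAt (fun t => w (α t x)) (W (α t x)) t)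
    (h2 : ∀ x ∈ N, ∀ t, HasDerivAt (fun t => v (β t x)) (W (β t x)) t) {x : E} (hx : x ∈ N)
    (s t : ℝ) : β t (α s x) = α s (β t x) := by
  have hK0 : (0 : ℝ) ≤ K := K.2
  rw [← sub_eq_zero, ← norm_le_zero_iff]
  have key : ∀ ε > 0, ‖β t (α s x) - α s (β t x)‖ ≤ ε * |t| * Real.exp (K * |t|) := by
    intro ε hε
    obtain ⟨δ, hδ, H⟩ := exists_commutator_bound hα hβ hv hw hLv hLw hNα hNβ hW h1 h2 s hε
    obtain ⟨n, hn⟩ := exists_nat_gt (|t| / δ)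
    have hn0 : (0 : ℝ) < n := lt_of_le_of_lt (by positivity) hn
    set h := t / n with hh
    have hhδ : |h| ≤ δ := by
      rw [hh, abs_div, abs_of_pos hn0, div_le_iff₀ hn0]
      rw [div_lt_iff₀ hδ] at hn
      linarith
    have ind : ∀ k : ℕ, ‖β (k * h) (α s x) - α s (β (k * h) x)‖ ≤
        k * (ε * |h|) * Real.exp (K * (k * |h|)) := by
      intro k
      induction k with
      | zero => simp [hβ.zero]
      | succ k ih =>
        have e1 : ((k + 1 : ℕ) : ℝ) * h = h + k * h := by push_cast; ring
        rw [e1, hβ.add hw, hβ.add hw]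
        set y := β (k * h) x
        have hy : y ∈ N := hNβ x hx _
        have e2 : β h (β (k * h) (α s x)) - α s (β h y) =
            (β h (β (k * h) (α s x)) - β h (α s y)) + (β h (α s y) - α s (β h y)) := by abel
        rw [e2]
        have b1 := (hβ.norm_sub_le hw h (β (k * h) (α s x)) (α s y)).trans
          (mul_le_mul_of_nonneg_right ih (Real.exp_pos _).le)
        have b2 := H h hhδ y hy
        rw [mul_assoc, ← Real.exp_add] at b1
        have e3 : K * (((k + 1 : ℕ) : ℝ) * |h|) = K * (k * |h|) + K * |h| := by push_cast; ring
        rw [e3]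
        have b3 : 1 ≤ Real.exp (K * (k * |h|) + K * |h|) := Real.one_le_exp (by positivity)
        refine (norm_add_le _ _).trans ?_
        push_cast
        have b4 : ε * |h| ≤ ε * |h| * Real.exp (K * (k * |h|) + K * |h|) :=
          le_mul_of_one_le_right (by positivity) b3
        linarith
    have e4 : (n : ℝ) * h = t := by rw [hh]; field_simp
    have e5 : (n : ℝ) * |h| = |t| := by rw [← e4, abs_mul, abs_of_pos hn0]
    have := ind n
    rw [e4, e5] at this
    refine this.trans_eq ?_
    rw [← e5]
    ring
  have hlim : Tendsto (fun ε : ℝ => ε * |t| * Real.exp (K * |t|)) (𝓝[>] 0) (𝓝 0) := by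
    refine Tendsto.mono_left ?_ nhdsWithin_le_nhds
    have : Continuous fun ε : ℝ => ε * |t| * Real.exp (K * |t|) := by fun_prop
    simpa using this.tendsto 0
  exact ge_of_tendsto hlim (eventually_mem_nhdsWithin.mono key)

end CommutingFlows

section DerivativeOnSurface

set_option linter.unusedSectionVars false

open Set Filter Topology Metric Asymptotics
open scoped NNReal

namespace FramedSurface

variable (S : FramedSurface) {G : Type*} [NormedAddCommGroup G] [NormedSpace ℝ G]

/-- `F` has derivatives `F1` and `F2` along the two flows on the surface. -/
structure FlowDiff (F F1 F2 : R3 → G) : Prop where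
  fst : ∀ x ∈ S.Λ, ∀ t, HasDerivAt (fun s => F (S.φ s x)) (F1 (S.φ t x)) t
  snd : ∀ x ∈ S.Λ, ∀ t, HasDerivAt (fun s => F (S.ψ s x)) (F2 (S.ψ t x)) t
  continuous_fst : ContinuousOn F1 S.Λ
  continuous_snd : ContinuousOn F2 S.Λ

theorem exists_bound_fields : ∃ L : ℝ, 0 ≤ L ∧ (∀ z, ‖S.X z‖ ≤ L) ∧ ∀ z, ‖S.Y z‖ ≤ L := by
  obtain ⟨LX, hLX⟩ := S.cs_X.exists_bound_of_continuous S.smooth_X.continuous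
  obtain ⟨LY, hLY⟩ := S.cs_Y.exists_bound_of_continuous S.smooth_Y.continuous
  exact ⟨max LX LY, ((norm_nonneg _).trans (hLX 0)).trans (le_max_left _ _),
    fun z => (hLX z).trans (le_max_left _ _), fun z => (hLY z).trans (le_max_right _ _)⟩

theorem flowDiff_of_differentiable {F : R3 → G} (hF : ContDiff ℝ 1 F) :
    S.FlowDiff F (fun z => fderiv ℝ F z (S.X z)) fun z => fderiv ℝ F z (S.Y z) where
  fst x _ t := (hF.differentiable (by simp) _).hasFDerivAt.comp_hasDerivAt t (S.flow_X.deriv x t)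
  snd x _ t := (hF.differentiable (by simp) _).hasFDerivAt.comp_hasDerivAt t (S.flow_Y.deriv x t)
  continuous_fst := ((hF.continuous_fderiv (by simp)).clm_apply S.smooth_X.continuous).continuousOn
  continuous_snd := ((hF.continuous_fderiv (by simp)).clm_apply S.smooth_Y.continuous).continuousOn

variable {S}

namespace FlowDiff

variable {F F1 F2 : R3 → G} (hF : S.FlowDiff F F1 F2)

include hF

theorem isLittleO {z : R3} (hz : z ∈ S.Λ) {s t : R3 → ℝ} {κ C : ℝ} (hκ : 0 < κ)
    (H : ∀ y ∈ S.Λ, ‖y - z‖ ≤ κ → |s y| ≤ C * ‖y - z‖ ∧ |t y| ≤ C * ‖y - z‖ ∧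
      S.ψ (t y) (S.φ (s y) z) = y) :
    (fun y => F y - F z - s y • F1 z - t y • F2 z) =o[𝓝[S.Λ] z] fun y => y - z := by
  obtain ⟨L, hL0, hLX, hLY⟩ := S.exists_bound_fields
  rw [isLittleO_iff]
  intro c hc
  set ε := c / (2 * |C| + 1) with hε
  have hε0 : 0 < ε := by positivity
  obtain ⟨δ₁, hδ₁, h1⟩ := Metric.continuousOn_iff.1 hF.continuous_fst z hz ε hε0
  obtain ⟨δ₂, hδ₂, h2⟩ := Metric.continuousOn_iff.1 hF.continuous_snd z hz ε hε0
  have hδ : 0 < min κ (min δ₁ δ₂ / (2 * L * |C| + 1)) := by positivity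
  filter_upwards [self_mem_nhdsWithin, mem_nhdsWithin_of_mem_nhds (Metric.ball_mem_nhds z hδ)]
    with y hy hyδ
  rw [mem_ball, dist_eq_norm, lt_min_iff, lt_div_iff₀ (by positivity)] at hyδ
  obtain ⟨hs, ht, hst⟩ := H y hy hyδ.1.le
  have hC : C * ‖y - z‖ ≤ |C| * ‖y - z‖ := by gcongr; exact le_abs_self C
  have hN : 0 ≤ ‖y - z‖ := norm_nonneg _
  have e1 : ‖F (S.φ (s y) z) - F z - s y • F1 z‖ ≤ ε * |s y| := by
    have := norm_sub_smul_le_of_hasDerivAt (v := F1 z) (h := s y) (C := ε)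
      (fun t _ => hF.fst z hz t) (fun t ht => by
        rw [← dist_eq_norm]
        refine (h1 _ (S.φ_mem hz t) ?_).le
        rw [dist_eq_norm]
        have h3 := (S.flow_X.norm_sub_self_le hLX t z).trans
          (mul_le_mul_of_nonneg_left (ht.trans (hs.trans hC)) hL0)
        nlinarith [min_le_left δ₁ δ₂, mul_nonneg hL0 (mul_nonneg (abs_nonneg C) hN)])
    simpa [S.flow_X.zero] using this
  have e2 : ‖F y - F (S.φ (s y) z) - t y • F2 z‖ ≤ ε * |t y| := by
    have := norm_sub_smul_le_of_hasDerivAt (v := F2 z) (h := t y) (C := ε)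
      (fun t _ => hF.snd (S.φ (s y) z) (S.φ_mem hz _) t) (fun τ hτ => by
        rw [← dist_eq_norm]
        refine (h2 _ (S.ψ_mem (S.φ_mem hz _) τ) ?_).le
        rw [dist_eq_norm]
        have h3 := (S.flow_X.norm_sub_self_le hLX (s y) z).trans
          (mul_le_mul_of_nonneg_left (hs.trans hC) hL0)
        have h4 := (S.flow_Y.norm_sub_self_le hLY τ (S.φ (s y) z)).trans
          (mul_le_mul_of_nonneg_left (hτ.trans (ht.trans hC)) hL0)
        have h5 := norm_sub_le_norm_sub_add_norm_sub (S.ψ τ (S.φ (s y) z)) (S.φ (s y) z) z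
        nlinarith [min_le_right δ₁ δ₂])
    rw [hst] at this
    simpa [S.flow_Y.zero] using this
  have h6 : F y - F z - s y • F1 z - t y • F2 z =
      (F (S.φ (s y) z) - F z - s y • F1 z) + (F y - F (S.φ (s y) z) - t y • F2 z) := by abel
  rw [h6]
  refine ((norm_add_le _ _).trans (add_le_add e1 e2)).trans ?_
  have h7 : ε * |s y| + ε * |t y| ≤ ε * (2 * |C| * ‖y - z‖) := by
    rw [← mul_add]
    gcongr
    linarith
  refine h7.trans ?_
  have h8 : ε * (2 * |C| + 1) = c := by rw [hε]; field_simp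
  nlinarith [mul_nonneg hε0.le hN]

theorem exists_hasFDerivWithinAt {z : R3} (hz : z ∈ S.Λ) : ∃ L : R3 →L[ℝ] G,
    HasFDerivWithinAt F L S.Λ z ∧ L (S.X z) = F1 z ∧ L (S.Y z) = F2 z := by
  obtain ⟨κ, C, hκ, hC, H⟩ := S.exists_short_path
  have H' : ∀ y, ∃ p : ℝ × ℝ, y ∈ S.Λ → ‖y - z‖ ≤ κ →
      |p.1| ≤ C * ‖y - z‖ ∧ |p.2| ≤ C * ‖y - z‖ ∧ S.ψ p.2 (S.φ p.1 z) = y := fun y => by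
    by_cases h : y ∈ S.Λ ∧ ‖y - z‖ ≤ κ
    · obtain ⟨s, t, h1⟩ := H z hz y h.1 h.2
      exact ⟨(s, t), fun _ _ => h1⟩
    · exact ⟨0, fun h1 h2 => absurd ⟨h1, h2⟩ h⟩
  choose p hp using H'
  have hFo := hF.isLittleO hz (s := fun y => (p y).1) (t := fun y => (p y).2) hκ hp
  have hIo := (S.flowDiff_of_differentiable (F := id) contDiff_id).isLittleO hz
    (s := fun y => (p y).1) (t := fun y => (p y).2) hκ hp
  simp only [fderiv_id, ContinuousLinearMap.id_apply, id] at hIo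
  obtain ⟨A, hA⟩ := S.exists_frame_equiv (S.Λ_subset_O hz)
  let c : R3 →L[ℝ] ℝ × ℝ × ℝ := A.symm
  let L : R3 →L[ℝ] G := ((ContinuousLinearMap.fst ℝ ℝ (ℝ × ℝ)).comp c).smulRight (F1 z) +
    ((ContinuousLinearMap.fst ℝ ℝ ℝ).comp
      ((ContinuousLinearMap.snd ℝ ℝ (ℝ × ℝ)).comp c)).smulRight (F2 z)
  have hL : ∀ v, L v = (A.symm v).1 • F1 z + (A.symm v).2.1 • F2 z := fun v => rfl
  have hX : L (S.X z) = F1 z := by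
    have : A.symm (S.X z) = (1, 0, 0) := by rw [A.symm_apply_eq, hA]; simp
    rw [hL, this]
    simp
  have hY : L (S.Y z) = F2 z := by
    have : A.symm (S.Y z) = (0, 1, 0) := by rw [A.symm_apply_eq, hA]; simp
    rw [hL, this]
    simp
  refine ⟨L, HasFDerivWithinAt.of_isLittleO ?_, hX, hY⟩
  refine (hFo.sub ((L.isBigO_comp (fun y => y - z - (p y).1 • S.X z - (p y).2 • S.Y z)
    (𝓝[S.Λ] z)).trans_isLittleO hIo)).congr_left fun y => ?_
  simp only [map_sub, map_smul, hX, hY]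
  abel

theorem hasDerivAt_comp {γ : ℝ → R3} {t a b : ℝ} (hγ : ∀ s, γ s ∈ S.Λ)
    (h : HasDerivAt γ (a • S.X (γ t) + b • S.Y (γ t)) t) :
    HasDerivAt (fun s => F (γ s)) (a • F1 (γ t) + b • F2 (γ t)) t := by
  obtain ⟨L, hL, hX, hY⟩ := hF.exists_hasFDerivWithinAt (hγ t)
  have := hL.comp_hasDerivWithinAt t h.hasDerivWithinAt (fun s _ => hγ s : MapsTo γ univ S.Λ)
  rw [hasDerivWithinAt_univ, map_add, map_smul, map_smul, hX, hY] at this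
  exact this

theorem continuousOn : ContinuousOn F S.Λ := fun _ hz =>
  (hF.exists_hasFDerivWithinAt hz).choose_spec.1.continuousWithinAt

theorem congr {F' F1' F2' : R3 → G} (h : EqOn F' F S.Λ) (h1 : EqOn F1' F1 S.Λ)
    (h2 : EqOn F2' F2 S.Λ) : S.FlowDiff F' F1' F2' where
  fst x hx t := by
    rw [h1 (S.φ_mem hx t)]
    simpa only [h (S.φ_mem hx _)] using hF.fst x hx t
  snd x hx t := by
    rw [h2 (S.ψ_mem hx t)]
    simpa only [h (S.ψ_mem hx _)] using hF.snd x hx t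
  continuous_fst := hF.continuous_fst.congr h1
  continuous_snd := hF.continuous_snd.congr h2

theorem exists_lipschitzOnWith : ∃ K : ℝ≥0, LipschitzOnWith K F S.Λ := by
  obtain ⟨κ, C, hκ, hC, H⟩ := S.exists_short_path
  obtain ⟨B, hB⟩ := S.isCompact_Λ.exists_bound_of_continuousOn hF.continuousOn
  obtain ⟨M₁, hM₁⟩ := S.isCompact_Λ.exists_bound_of_continuousOn hF.continuous_fst
  obtain ⟨M₂, hM₂⟩ := S.isCompact_Λ.exists_bound_of_continuousOn hF.continuous_snd
  refine ⟨((|M₁| + |M₂|) * C + 2 * |B| / κ).toNNReal,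
    LipschitzOnWith.of_dist_le_mul fun z hz x hx => ?_⟩
  rw [Real.coe_toNNReal _ (by positivity), dist_eq_norm, dist_eq_norm, add_mul]
  have hN := norm_nonneg (z - x)
  rcases le_or_gt ‖z - x‖ κ with h | h
  · obtain ⟨s, t, hs, ht, hst⟩ := H x hx z hz h
    have e1 := norm_sub_smul_le_of_hasDerivAt (v := 0) (h := s) (C := |M₁|)
      (fun t _ => hF.fst x hx t) fun t _ => by
        rw [sub_zero]
        exact (hM₁ _ (S.φ_mem hx t)).trans (le_abs_self _)
    have e2 := norm_sub_smul_le_of_hasDerivAt (v := 0) (h := t) (C := |M₂|)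
      (fun t _ => hF.snd (S.φ s x) (S.φ_mem hx s) t) fun t _ => by
        rw [sub_zero]
        exact (hM₂ _ (S.ψ_mem (S.φ_mem hx s) t)).trans (le_abs_self _)
    rw [smul_zero, sub_zero] at e1 e2
    rw [hst] at e2
    simp only [S.flow_X.zero, S.flow_Y.zero] at e1 e2
    have h3 := norm_sub_le_norm_sub_add_norm_sub (F z) (F (S.φ s x)) (F x)
    have h4 : |M₁| * |s| ≤ |M₁| * (C * ‖z - x‖) := by gcongr
    have h5 : |M₂| * |t| ≤ |M₂| * (C * ‖z - x‖) := by gcongr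
    have h6 : 0 ≤ 2 * |B| / κ * ‖z - x‖ := by positivity
    linarith
  · have h3 := (norm_sub_le (F z) (F x)).trans (add_le_add (hB z hz) (hB x hx))
    have h4 : 2 * |B| / κ * κ ≤ 2 * |B| / κ * ‖z - x‖ := by gcongr
    rw [div_mul_cancel₀ _ hκ.ne'] at h4
    have h6 : 0 ≤ (|M₁| + |M₂|) * C * ‖z - x‖ := by positivity
    linarith [le_abs_self B]

end FlowDiff

theorem FlowDiff.exists_extension {F F1 F2 : R3 → ℝ} (hF : S.FlowDiff F F1 F2) :
    ∃ (f : R3 → ℝ) (K : ℝ≥0) (B : ℝ), LipschitzWith K f ∧ (∀ z, |f z| ≤ B) ∧ EqOn f F S.Λ ∧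
      S.FlowDiff f F1 F2 := by
  obtain ⟨K, hK⟩ := hF.exists_lipschitzOnWith
  obtain ⟨B, hB⟩ := S.isCompact_Λ.exists_bound_of_continuousOn hF.continuousOn
  obtain ⟨g, hg, hgF⟩ := hK.extend_real
  have hE : EqOn (fun z => max (-|B|) (min |B| (g z))) F S.Λ := fun z hz => by
    have h1 := abs_le.1 ((hB z hz).trans (le_abs_self B))
    beta_reduce
    rw [← hgF hz, min_eq_right, max_eq_right]
    · exact (hgF hz) ▸ h1.1
    · exact (hgF hz) ▸ h1.2
  refine ⟨fun z => max (-|B|) (min |B| (g z)), K, |B|, (hg.const_min _).const_max _, fun z => ?_, hE,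
    hF.congr hE (fun _ _ => rfl) fun _ _ => rfl⟩
  rw [abs_le]
  exact ⟨le_max_left _ _, max_le (by linarith [abs_nonneg B]) (min_le_left _ _)⟩

end FramedSurface

end DerivativeOnSurface

section FlatFrames

open Set Filter Topology
open scoped NNReal

/-- A framed surface with a factor `r` and rotation rates `m`, `k` for which the rotating rescaled
frame consists of commuting fields. -/
structure FlatFrame extends FramedSurface where
  r : R3 → ℝ
  m : R3 → ℝ
  k : R3 → ℝ
  m1 : R3 → ℝ
  m2 : R3 → ℝ
  k1 : R3 → ℝ
  k2 : R3 → ℝ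
  C : ℝ≥0
  B : ℝ
  lip_r : LipschitzWith C r
  lip_m : LipschitzWith C m
  lip_k : LipschitzWith C k
  bound_r : ∀ z, |r z| ≤ B
  bound_m : ∀ z, |m z| ≤ B
  bound_k : ∀ z, |k z| ≤ B
  r_ne : ∀ z ∈ Λ, r z ≠ 0
  diff_r : toFramedSurface.FlowDiff r (fun z => r z * (k z + dv X z)) fun z => r z * (dv Y z - m z)
  diff_m : toFramedSurface.FlowDiff m m1 m2
  diff_k : toFramedSurface.FlowDiff k k1 k2
  flat : ∀ z ∈ Λ, k1 z - m2 z = dv Y z * m z - dv X z * k z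

namespace FramedSurface

variable (S : FramedSurface)

theorem exists_extension (F : C(S.Λ, ℝ)) : ∃ f : R3 → ℝ, Continuous f ∧ ∀ x : S.Λ, f x = F x := by
  obtain ⟨g, hg⟩ := ContinuousMap.exists_restrict_eq S.isCompact_Λ.isClosed F
  exact ⟨g, g.continuous, fun x => by rw [← hg]; rfl⟩

theorem flowDiff_of_hasFlowDeriv {F F1 F2 : C(S.Λ, ℝ)}
    (h : SurfaceCalculus.HasFlowDeriv S.flow S.flow' F F1 F2) {f f1 f2 : R3 → ℝ}
    (hf : ∀ x : S.Λ, f x = F x) (h1 : ∀ x : S.Λ, f1 x = F1 x) (h2 : ∀ x : S.Λ, f2 x = F2 x) :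
    S.FlowDiff f f1 f2 where
  fst x hx t := by
    have := (h ⟨x, hx⟩ t).1
    simp only [← hf, ← h1, coe_flow] at this
    exact this
  snd x hx t := by
    have := (h ⟨x, hx⟩ t).2
    simp only [← hf, ← h2, coe_flow'] at this
    exact this
  continuous_fst := continuousOn_iff_continuous_domRestrict.2 (F1.continuous.congr fun x => (h1 x).symm)
  continuous_snd := continuousOn_iff_continuous_domRestrict.2 (F2.continuous.congr fun x => (h2 x).symm)

theorem FlowDiff.add {F F1 F2 G G1 G2 : R3 → ℝ} (hF : S.FlowDiff F F1 F2) (hG : S.FlowDiff G G1 G2) :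
    S.FlowDiff (fun z => F z + G z) (fun z => F1 z + G1 z) fun z => F2 z + G2 z where
  fst x hx t := (hF.fst x hx t).add (hG.fst x hx t)
  snd x hx t := (hF.snd x hx t).add (hG.snd x hx t)
  continuous_fst := hF.continuous_fst.add hG.continuous_fst
  continuous_snd := hF.continuous_snd.add hG.continuous_snd

theorem FlowDiff.neg {F F1 F2 : R3 → ℝ} (hF : S.FlowDiff F F1 F2) :
    S.FlowDiff (fun z => -F z) (fun z => -F1 z) fun z => -F2 z where
  fst x hx t := (hF.fst x hx t).neg
  snd x hx t := (hF.snd x hx t).neg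
  continuous_fst := hF.continuous_fst.neg
  continuous_snd := hF.continuous_snd.neg

theorem FlowDiff.exp_neg {F F1 F2 : R3 → ℝ} (hF : S.FlowDiff F F1 F2) :
    S.FlowDiff (fun z => Real.exp (-F z)) (fun z => Real.exp (-F z) * -F1 z)
      fun z => Real.exp (-F z) * -F2 z where
  fst x hx t := (hF.fst x hx t).neg.exp
  snd x hx t := (hF.snd x hx t).neg.exp
  continuous_fst := hF.continuousOn.neg.rexp.mul hF.continuous_fst.neg
  continuous_snd := hF.continuousOn.neg.rexp.mul hF.continuous_snd.neg

theorem exists_flatFrame : ∃ T : FlatFrame, T.toFramedSurface = S := by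
  obtain ⟨μ, hμ, r, C, r', C', δ, D, hcalc⟩ := S.exists_surfaceCalculus
  obtain ⟨u, u1, u2, u11, u12, u21, u22, hu, hu1, hu2, hsymm, hlap⟩ :=
    hcalc.exists_conformal_factor
  choose! ext hext_cont hext using S.exists_extension
  have Hu := S.flowDiff_of_hasFlowDeriv hu (hext u) (hext u1) (hext u2)
  have Hu1 := S.flowDiff_of_hasFlowDeriv hu1 (hext u1) (hext u11) (hext u12)
  have Hu2 := S.flowDiff_of_hasFlowDeriv hu2 (hext u2) (hext u21) (hext u22)
  have Ha := S.flowDiff_of_differentiable (F := S.coeffA.1) (S.coeffA.2.of_le (by simp))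
  have Hb := S.flowDiff_of_differentiable (F := S.coeffB.1) (S.coeffB.2.of_le (by simp))
  obtain ⟨fr, Kr, Br, lr, br, er, dr⟩ := (FlowDiff.exp_neg S Hu).exists_extension
  obtain ⟨fm, Km, Bm, lm, bm, em, dm⟩ := (FlowDiff.add S Ha Hu2).exists_extension
  obtain ⟨fk, Kk, Bk, lk, bk, ek, dk⟩ := (FlowDiff.add S Hb (FlowDiff.neg S Hu1)).exists_extension
  refine ⟨{ S with
    r := fr, m := fm, k := fk
    m1 := _, m2 := _, k1 := _, k2 := _
    C := max Kr (max Km Kk), B := max Br (max Bm Bk)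
    lip_r := lr.weaken (le_max_left _ _)
    lip_m := lm.weaken ((le_max_left _ _).trans (le_max_right _ _))
    lip_k := lk.weaken ((le_max_right _ _).trans (le_max_right _ _))
    bound_r := fun z => (br z).trans (le_max_left _ _)
    bound_m := fun z => (bm z).trans ((le_max_left _ _).trans (le_max_right _ _))
    bound_k := fun z => (bk z).trans ((le_max_right _ _).trans (le_max_right _ _))
    r_ne := fun z hz => by rw [er hz]; exact (Real.exp_pos _).ne'
    diff_r := dr.congr (fun _ _ => rfl) (fun z hz => ?_) fun z hz => ?_
    diff_m := dm
    diff_k := dk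
    flat := fun z hz => ?_ }, rfl⟩
  · beta_reduce
    rw [er hz, ek hz]
    change _ * (-dv S.X z + -ext u1 z + dv S.X z) = _
    ring
  · beta_reduce
    rw [er hz, em hz]
    change _ * (dv S.Y z - (dv S.Y z + ext u2 z)) = _
    ring
  · beta_reduce
    rw [em hz, ek hz]
    have := congrArg (fun F : C(S.Λ, ℝ) => F ⟨z, hz⟩) hlap
    change u11 ⟨z, hz⟩ + u22 ⟨z, hz⟩ = -dv S.X z * u1 ⟨z, hz⟩ - dv S.Y z * u2 ⟨z, hz⟩ -
      (-dv S.X z * -dv S.X z - fderiv ℝ S.coeffB.1 z (S.X z) +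
        (dv S.Y z * dv S.Y z + fderiv ℝ S.coeffA.1 z (S.Y z))) at this
    rw [← hext, ← hext, ← hext, ← hext] at this
    dsimp only at this
    change fderiv ℝ S.coeffB.1 z (S.X z) + -ext u11 z - (fderiv ℝ S.coeffA.1 z (S.Y z) + ext u22 z) =
      dv S.Y z * (dv S.Y z + ext u2 z) - dv S.X z * (-dv S.X z + -ext u1 z)
    linarith

end FramedSurface

end FlatFrames

section BoundedLipschitz

open scoped NNReal

set_option linter.unusedSectionVars false

variable {α E F : Type*} [PseudoMetricSpace α] [SeminormedAddCommGroup E] [NormedSpace ℝ E]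
  [SeminormedAddCommGroup F]

/-- Bounded Lipschitz functions. -/
def BddLip (f : α → E) : Prop := ∃ K L : ℝ≥0, LipschitzWith K f ∧ ∀ x, ‖f x‖ ≤ L

theorem BddLip.of_bound {f : α → E} {K : ℝ≥0} {B : ℝ} (h : LipschitzWith K f)
    (hB : ∀ x, ‖f x‖ ≤ B) : BddLip f :=
  ⟨K, B.toNNReal, h, fun x => (hB x).trans (Real.le_coe_toNNReal B)⟩

theorem BddLip.comp {β : Type*} [PseudoMetricSpace β] {f : α → E} (hf : BddLip f) {g : β → α}
    {K : ℝ≥0} (hg : LipschitzWith K g) : BddLip fun x => f (g x) := by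
  obtain ⟨C, L, h1, h2⟩ := hf
  exact ⟨C * K, L, h1.comp hg, fun x => h2 _⟩

theorem BddLip.add {f g : α → E} (hf : BddLip f) (hg : BddLip g) : BddLip fun x => f x + g x := by
  obtain ⟨K, L, h1, h2⟩ := hf
  obtain ⟨K', L', h3, h4⟩ := hg
  exact ⟨K + K', L + L', h1.add h3, fun x =>
    (norm_add_le _ _).trans (by push_cast; exact add_le_add (h2 x) (h4 x))⟩

theorem BddLip.smul {c : α → ℝ} {f : α → E} (hc : BddLip c) (hf : BddLip f) :
    BddLip fun x => c x • f x := by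
  obtain ⟨K, L, h1, h2⟩ := hc
  obtain ⟨K', L', h3, h4⟩ := hf
  refine ⟨L * K' + K * L', L * L', LipschitzWith.of_dist_le_mul fun x y => ?_, fun x => ?_⟩
  · have e : c x • f x - c y • f y = c x • (f x - f y) + (c x - c y) • f y := by
      rw [smul_sub, sub_smul]; abel
    have h5 := h1.dist_le_mul x y
    have h6 := h3.dist_le_mul x y
    rw [dist_eq_norm] at h5 h6 ⊢
    rw [e]
    refine (norm_add_le _ _).trans ?_
    rw [norm_smul, norm_smul]
    push_cast
    have h7 : ‖c x‖ * ‖f x - f y‖ ≤ L * (K' * dist x y) := by gcongr; exact h2 x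
    have h8 : ‖c x - c y‖ * ‖f y‖ ≤ K * dist x y * L' := by gcongr; exact h4 y
    linarith
  · rw [norm_smul]
    push_cast
    gcongr
    · exact h2 x
    · exact h4 x

theorem BddLip.prodMk {f : α → E} {g : α → F} (hf : BddLip f) (hg : ∃ K L : ℝ≥0,
    LipschitzWith K g ∧ ∀ x, ‖g x‖ ≤ L) : ∃ K L : ℝ≥0,
    LipschitzWith K (fun x => (f x, g x)) ∧ ∀ x, ‖(f x, g x)‖ ≤ L := by
  obtain ⟨K, L, h1, h2⟩ := hf
  obtain ⟨K', L', h3, h4⟩ := hg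
  exact ⟨max K K', max L L', h1.prodMk h3, fun x => by
    rw [Prod.norm_mk]; push_cast; exact max_le_max (h2 x) (h4 x)⟩

end BoundedLipschitz

section RotatingFields

open Set Filter Topology Metric Real
open scoped NNReal

theorem FramedSurface.mem_of_curve (S : FramedSurface) {γ : ℝ → R3} (hγ : Continuous γ)
    (h0 : γ 0 ∈ S.Λ) (hq : ∀ t, S.q (γ t) = 0) (t : ℝ) : γ t ∈ S.Λ := by
  have hclopen : IsClopen {t | γ t ∈ S.Λ} := by
    refine ⟨S.isCompact_Λ.isClosed.preimage hγ, ?_⟩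
    rw [isOpen_iff_mem_nhds]
    intro t ht
    filter_upwards [hγ.continuousAt.eventually (isOpen_interior.mem_nhds (S.Λ_subset ht))] with s hs
    exact (S.mem_Λ_iff _ (interior_subset hs)).2 (hq s)
  have := hclopen.eq_univ ⟨0, h0⟩
  exact (this ▸ mem_univ t : t ∈ {t | γ t ∈ S.Λ})

/-- Translation of the angle. -/
def turn (β : ℝ) (p : R3 × ℝ) : R3 × ℝ := (p.1, p.2 + β)

@[simp] theorem turn_zero (p : R3 × ℝ) : turn 0 p = p := by simp [turn]

theorem turn_turn (β γ : ℝ) (p : R3 × ℝ) : turn β (turn γ p) = turn (γ + β) p := by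
  simp [turn, add_assoc]

theorem hasDerivAt_turn {γ : ℝ → R3 × ℝ} {v : R3 × ℝ} {t : ℝ} (h : HasDerivAt γ v t) (β : ℝ) :
    HasDerivAt (fun s => turn β (γ s)) v t := by
  have := h.add_const ((0 : R3), β)
  refine this.congr_of_eventuallyEq (Eventually.of_forall fun s => ?_)
  simp [turn, Prod.ext_iff]

theorem lipschitzWith_turn (β : ℝ) : LipschitzWith 1 (turn β) :=
  LipschitzWith.of_dist_le_mul fun p p' => by simp [turn, Prod.dist_eq]

theorem UniformContinuousOn.comp_trig {E : Type*} [UniformSpace E] {G : R3 × ℝ × ℝ → E} {A : Set R3}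
    (hG : UniformContinuousOn G (A ×ˢ (Icc (-1) 1 ×ˢ Icc (-1) 1))) :
    UniformContinuousOn (fun p : R3 × ℝ => G (p.1, cos p.2, sin p.2)) (A ×ˢ univ) := by
  have hg : UniformContinuous fun p : R3 × ℝ => (p.1, cos p.2, sin p.2) :=
    uniformContinuous_fst.prodMk ((lipschitzWith_cos.uniformContinuous.comp uniformContinuous_snd).prodMk
      (lipschitzWith_sin.uniformContinuous.comp uniformContinuous_snd))
  exact hG.comp hg.uniformContinuousOn fun p hp =>
    ⟨hp.1, ⟨neg_one_le_cos _, cos_le_one _⟩, neg_one_le_sin _, sin_le_one _⟩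

namespace FlatFrame

variable (S : FlatFrame)

/-- The lift of the rescaled frame direction with coefficients `c`, `s`. -/
def vec (c s : ℝ) (z : R3) : R3 × ℝ :=
  (S.r z • (c • S.X z + s • S.Y z), S.r z * (c * S.m z + s * S.k z))

/-- The rotating field on the angle bundle. -/
def rot (p : R3 × ℝ) : R3 × ℝ := S.vec (cos p.2) (sin p.2) p.1

theorem bddLip_rot : BddLip S.rot := by
  have hX : BddLip S.X := by
    obtain ⟨L, hL⟩ := S.cs_X.exists_bound_of_continuous S.smooth_X.continuous
    exact .of_bound S.lip_X hL
  have hY : BddLip S.Y := by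
    obtain ⟨L, hL⟩ := S.cs_Y.exists_bound_of_continuous S.smooth_Y.continuous
    exact .of_bound S.lip_Y hL
  have hc : BddLip cos := .of_bound lipschitzWith_cos (B := 1) fun x => abs_cos_le_one x
  have hs : BddLip sin := .of_bound lipschitzWith_sin (B := 1) fun x => abs_sin_le_one x
  have hr : BddLip S.r := .of_bound S.lip_r S.bound_r
  have hm : BddLip S.m := .of_bound S.lip_m S.bound_m
  have hk : BddLip S.k := .of_bound S.lip_k S.bound_k
  have f1 : LipschitzWith 1 (Prod.fst : R3 × ℝ → R3) := LipschitzWith.prod_fst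
  have f2 : LipschitzWith 1 (Prod.snd : R3 × ℝ → ℝ) := LipschitzWith.prod_snd
  exact ((hr.comp f1).smul (((hc.comp f2).smul (hX.comp f1)).add
      ((hs.comp f2).smul (hY.comp f1)))).prodMk
    ((hr.comp f1).smul (((hc.comp f2).smul (hm.comp f1)).add ((hs.comp f2).smul (hk.comp f1))))

theorem exists_flow : ∃ Φ, IsFlow S.rot Φ := by
  obtain ⟨K, L, h1, h2⟩ := S.bddLip_rot
  exact exists_isFlow h1 h2

/-- The flow of the rotating field with initial angle offset `β`. -/
def spin (β t : ℝ) (p : R3 × ℝ) : R3 × ℝ := turn (-β) (S.exists_flow.choose t (turn β p))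

theorem isFlow_spin (β : ℝ) : IsFlow (fun p => S.rot (turn β p)) (S.spin β) where
  zero p := by simp [spin, S.exists_flow.choose_spec.zero, turn_turn]
  deriv p t := by
    have := hasDerivAt_turn (S.exists_flow.choose_spec.deriv (turn β p) t) (-β)
    simpa only [spin, turn_turn, neg_add_cancel, turn_zero] using this

theorem spin_turn (β γ t : ℝ) (p : R3 × ℝ) : S.spin β t (turn γ p) = turn γ (S.spin (γ + β) t p) := by
  simp [spin, turn_turn]

theorem bddLip_rot_turn (β : ℝ) : BddLip fun p => S.rot (turn β p) :=
  S.bddLip_rot.comp (lipschitzWith_turn β)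

theorem q_spin (β t : ℝ) (p : R3 × ℝ) : S.q (S.spin β t p).1 = S.q p.1 := by
  have h : ∀ t, HasDerivAt (fun s => S.q (S.spin β s p).1) 0 t := fun t => by
    have := (S.differentiable_q (S.spin β t p).1).hasFDerivAt.comp_hasDerivAt t
      ((ContinuousLinearMap.fst ℝ R3 ℝ).hasFDerivAt.comp_hasDerivAt t ((S.isFlow_spin β).deriv p t))
    refine this.congr_deriv ?_
    simp [rot, vec, turn, S.dqX, S.dqY]
  have := is_const_of_deriv_eq_zero (fun t => (h t).differentiableAt) (fun t => (h t).deriv) t 0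
  rwa [(S.isFlow_spin β).zero] at this

theorem spin_mem {p : R3 × ℝ} (hp : p.1 ∈ S.Λ) (β t : ℝ) : (S.spin β t p).1 ∈ S.Λ :=
  S.mem_of_curve (γ := fun t => (S.spin β t p).1) ((S.isFlow_spin β).continuous_time p).fst
    (by rwa [(S.isFlow_spin β).zero]) (fun t => (S.q_spin β t p).trans (S.q_eq_zero hp)) t

/-- The derivative of `vec` with moving coefficients along a direction `vec c' s'`. -/
def dvec (c s c₁ s₁ c' s' : ℝ) (z : R3) : R3 × ℝ :=
  let r₁ := S.r z * c' * (S.r z * (S.k z + dv S.X z)) + S.r z * s' * (S.r z * (dv S.Y z - S.m z))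
  let e := S.r z * (c' * S.m z + s' * S.k z)
  (r₁ • (c • S.X z + s • S.Y z) +
    S.r z • ((e * c₁) • S.X z + c • fderiv ℝ S.X z (S.r z • (c' • S.X z + s' • S.Y z)) +
      ((e * s₁) • S.Y z + s • fderiv ℝ S.Y z (S.r z • (c' • S.X z + s' • S.Y z)))),
   r₁ * (c * S.m z + s * S.k z) +
    S.r z * (e * c₁ * S.m z + c * (S.r z * c' * S.m1 z + S.r z * s' * S.m2 z) +
      (e * s₁ * S.k z + s * (S.r z * c' * S.k1 z + S.r z * s' * S.k2 z))))

theorem hasDerivAt_vec {p : ℝ → R3 × ℝ} {c s : ℝ → ℝ} {c₁ s₁ c' s' t : ℝ} (hp : ∀ τ, (p τ).1 ∈ S.Λ)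
    (h : HasDerivAt p (S.vec c' s' (p t).1) t) (hc : HasDerivAt c c₁ (p t).2)
    (hs : HasDerivAt s s₁ (p t).2) :
    HasDerivAt (fun τ => S.vec (c (p τ).2) (s (p τ).2) (p τ).1)
      (S.dvec (c (p t).2) (s (p t).2) c₁ s₁ c' s' (p t).1) t := by
  set z := (p t).1 with hz
  have h1 : HasDerivAt (fun τ => (p τ).1) (S.r z • (c' • S.X z + s' • S.Y z)) t :=
    (ContinuousLinearMap.fst ℝ R3 ℝ).hasFDerivAt.comp_hasDerivAt t h
  have h2 : HasDerivAt (fun τ => (p τ).2) (S.r z * (c' * S.m z + s' * S.k z)) t :=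
    (ContinuousLinearMap.snd ℝ R3 ℝ).hasFDerivAt.comp_hasDerivAt t h
  have h1' : HasDerivAt (fun τ => (p τ).1) ((S.r z * c') • S.X z + (S.r z * s') • S.Y z) t := by
    simpa only [smul_add, smul_smul] using h1
  have hr := S.diff_r.hasDerivAt_comp hp h1'
  have hm := S.diff_m.hasDerivAt_comp hp h1'
  have hk := S.diff_k.hasDerivAt_comp hp h1'
  have hX := (S.smooth_X.differentiable (by simp) z).hasFDerivAt.comp_hasDerivAt t h1
  have hY := (S.smooth_Y.differentiable (by simp) z).hasFDerivAt.comp_hasDerivAt t h1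
  have hc' := hc.comp t h2
  have hs' := hs.comp t h2
  refine HasDerivAt.prodMk ((hr.smul ((hc'.smul hX).add (hs'.smul hY))).congr_deriv ?_)
    ((hr.mul ((hc'.mul hm).add (hs'.mul hk))).congr_deriv ?_)
  · simp only [smul_eq_mul, Function.comp_apply, Pi.add_apply, Pi.smul_apply', ← hz]
    module
  · simp only [smul_eq_mul, Function.comp_apply, Pi.add_apply, Pi.mul_apply, ← hz]
    ring

theorem dvec_symm (c s : ℝ) {z : R3} (hz : z ∈ S.Λ) :
    S.dvec (-s) c (-c) (-s) c s z = S.dvec c s (-s) c (-s) c z := by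
  have hb := S.bracket (S.Λ_subset_O hz)
  have hf := S.flat z hz
  refine Prod.ext ?_ ?_
  · simp only [dvec, map_smul, map_add]
    rw [sub_eq_iff_eq_add] at hb
    rw [hb]
    match_scalars <;> ring
  · simp only [dvec]
    have hk : S.k1 z = S.m2 z + dv S.Y z * S.m z - dv S.X z * S.k z := by linarith
    rw [hk]
    ring

theorem vec_rotate (c s c' s' : ℝ) (z : R3) :
    S.vec (c * c' - s * s') (s * c' + c * s') z = c' • S.vec c s z + s' • S.vec (-s) c z := by
  refine Prod.ext ?_ ?_
  · simp only [vec, Prod.fst_add, Prod.smul_fst]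
    module
  · simp only [vec, Prod.snd_add, Prod.smul_snd, smul_eq_mul]
    ring

theorem rot_turn (β : ℝ) (p : R3 × ℝ) : S.rot (turn β p) =
    cos β • S.rot p + sin β • S.vec (-sin p.2) (cos p.2) p.1 := by
  rw [rot, rot, ← vec_rotate, turn]
  simp only [cos_add, sin_add]

theorem rot_turn_pi_div_two (p : R3 × ℝ) :
    S.rot (turn (π / 2) p) = S.vec (-sin p.2) (cos p.2) p.1 := by
  rw [rot_turn]
  simp

theorem spin_zero_deriv (p : R3 × ℝ) (t : ℝ) : HasDerivAt (fun s => S.spin 0 s p)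
    (S.vec (cos (S.spin 0 t p).2) (sin (S.spin 0 t p).2) (S.spin 0 t p).1) t := by
  have := (S.isFlow_spin 0).deriv p t
  simp only [turn_zero] at this
  exact this

theorem spin_pi_div_two_deriv (p : R3 × ℝ) (t : ℝ) : HasDerivAt (fun s => S.spin (π / 2) s p)
    (S.vec (-sin (S.spin (π / 2) t p).2) (cos (S.spin (π / 2) t p).2) (S.spin (π / 2) t p).1) t := by
  simpa only [rot_turn_pi_div_two] using (S.isFlow_spin (π / 2)).deriv p t

theorem uniformContinuousOn_dvec : UniformContinuousOn
    (fun p : R3 × ℝ => S.dvec (-sin p.2) (cos p.2) (-cos p.2) (-sin p.2) (cos p.2) (sin p.2) p.1)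
    (S.Λ ×ˢ univ) := by
  set A : Set (R3 × ℝ × ℝ) := S.Λ ×ˢ (Icc (-1) 1 ×ˢ Icc (-1) 1) with hA
  have hcont : ContinuousOn (fun p : R3 × ℝ × ℝ =>
      S.dvec (-p.2.2) p.2.1 (-p.2.1) (-p.2.2) p.2.1 p.2.2 p.1) A := by
    have e : ∀ {f : R3 → ℝ}, ContinuousOn f S.Λ → ContinuousOn (fun p : R3 × ℝ × ℝ => f p.1) A :=
      fun hf => hf.comp continuousOn_fst fun p hp => hp.1
    have e' : ∀ {G : Type} [TopologicalSpace G] {f : R3 → G}, Continuous f →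
        ContinuousOn (fun p : R3 × ℝ × ℝ => f p.1) A := fun hf =>
      (hf.comp continuous_fst).continuousOn
    have hr := e S.lip_r.continuous.continuousOn
    have hm := e S.lip_m.continuous.continuousOn
    have hk := e S.lip_k.continuous.continuousOn
    have hm1 := e S.diff_m.continuous_fst
    have hm2 := e S.diff_m.continuous_snd
    have hk1 := e S.diff_k.continuous_fst
    have hk2 := e S.diff_k.continuous_snd
    have hdX := e (contDiff_dv S.smooth_X).continuous.continuousOn
    have hdY := e (contDiff_dv S.smooth_Y).continuous.continuousOn
    have hX := e' S.smooth_X.continuous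
    have hY := e' S.smooth_Y.continuous
    have hDX := e' (S.smooth_X.continuous_fderiv (by simp))
    have hDY := e' (S.smooth_Y.continuous_fderiv (by simp))
    have hc : ContinuousOn (fun p : R3 × ℝ × ℝ => p.2.1) A := by fun_prop
    have hs : ContinuousOn (fun p : R3 × ℝ × ℝ => p.2.2) A := by fun_prop
    have hv := hr.smul ((hc.smul hX).add (hs.smul hY))
    have he := hr.mul ((hc.mul hm).add (hs.mul hk))
    have hr1 := ((hr.mul hc).mul (hr.mul (hk.add hdX))).add ((hr.mul hs).mul (hr.mul (hdY.sub hm)))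
    exact ((hr1.smul ((hs.neg.smul hX).add (hc.smul hY))).add (hr.smul
      ((((he.mul hc.neg).smul hX).add (hs.neg.smul (hDX.clm_apply hv))).add
        (((he.mul hs.neg).smul hY).add (hc.smul (hDY.clm_apply hv)))))).prodMk
      ((hr1.mul ((hs.neg.mul hm).add (hc.mul hk))).add (hr.mul
        ((((he.mul hc.neg).mul hm).add (hs.neg.mul (((hr.mul hc).mul hm1).add ((hr.mul hs).mul hm2)))).add
          (((he.mul hs.neg).mul hk).add
            (hc.mul (((hr.mul hc).mul hk1).add ((hr.mul hs).mul hk2)))))))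
  have huc := ((S.isCompact_Λ.prod (isCompact_Icc.prod isCompact_Icc))).uniformContinuousOn_of_continuous
    hcont
  exact huc.comp_trig

theorem spin_comm {p : R3 × ℝ} (hp : p.1 ∈ S.Λ) (s t : ℝ) :
    S.spin (π / 2) t (S.spin 0 s p) = S.spin 0 s (S.spin (π / 2) t p) := by
  obtain ⟨K₁, L₁, h1, h2⟩ := S.bddLip_rot_turn 0
  obtain ⟨K₂, L₂, h3, h4⟩ := S.bddLip_rot_turn (π / 2)
  refine commute_of_derivs_eq (N := S.Λ ×ˢ univ) (L := max L₁ L₂) (S.isFlow_spin 0)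
    (S.isFlow_spin (π / 2)) (h1.weaken (le_max_left K₁ K₂)) (h3.weaken (le_max_right K₁ K₂))
    (fun x => (h2 x).trans (le_max_left _ _)) (fun x => (h4 x).trans (le_max_right _ _))
    (fun x hx t => ⟨S.spin_mem hx.1 _ _, trivial⟩) (fun x hx t => ⟨S.spin_mem hx.1 _ _, trivial⟩)
    S.uniformContinuousOn_dvec (fun x hx t => ?_) (fun x hx t => ?_) ⟨hp, trivial⟩ s t
  · simp only [rot_turn_pi_div_two]
    exact S.hasDerivAt_vec (fun τ => S.spin_mem hx.1 _ _) (S.spin_zero_deriv x t)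
      (c := fun θ => -sin θ) (s := cos) (hasDerivAt_sin _).neg (hasDerivAt_cos _)
  · simp only [turn_zero]
    rw [S.dvec_symm _ _ (S.spin_mem hx.1 _ _)]
    exact S.hasDerivAt_vec (fun τ => S.spin_mem hx.1 _ _) (S.spin_pi_div_two_deriv x t)
      (c := cos) (s := sin) (hasDerivAt_cos _) (hasDerivAt_sin _)

/-- The joint flow of the two commuting rotating fields. -/
def act (w : ℂ) (p : R3 × ℝ) : R3 × ℝ := S.spin 0 w.re (S.spin (π / 2) w.im p)

theorem act_mem {p : R3 × ℝ} (hp : p.1 ∈ S.Λ) (w : ℂ) : (S.act w p).1 ∈ S.Λ :=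
  S.spin_mem (S.spin_mem hp _ _) _ _

theorem act_zero (p : R3 × ℝ) : S.act 0 p = p := by
  simp [act, (S.isFlow_spin _).zero]

theorem spin_add (β s t : ℝ) (p : R3 × ℝ) : S.spin β (s + t) p = S.spin β s (S.spin β t p) := by
  obtain ⟨K, L, h1, -⟩ := S.bddLip_rot_turn β
  exact (S.isFlow_spin β).add h1 s t p

theorem continuous_spin (β : ℝ) : Continuous fun q : ℝ × (R3 × ℝ) => S.spin β q.1 q.2 := by
  obtain ⟨K, L, h1, -⟩ := S.bddLip_rot_turn β
  exact (S.isFlow_spin β).continuous h1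

theorem continuous_act (p : R3 × ℝ) : Continuous fun w => S.act w p :=
  (S.continuous_spin 0).comp (Complex.continuous_re.prodMk
    ((S.continuous_spin (π / 2)).comp (Complex.continuous_im.prodMk continuous_const)))

theorem act_add {p : R3 × ℝ} (hp : p.1 ∈ S.Λ) (w w' : ℂ) :
    S.act (w + w') p = S.act w (S.act w' p) := by
  simp only [act, Complex.add_re, Complex.add_im, spin_add]
  rw [S.spin_comm (S.spin_mem hp _ _)]

theorem hasStrictFDerivAt_spin (β : ℝ) (p : R3 × ℝ) :
    HasStrictFDerivAt (fun q : ℝ × (R3 × ℝ) => S.spin β q.1 q.2)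
      ((ContinuousLinearMap.fst ℝ ℝ (R3 × ℝ)).smulRight (S.rot (turn β p)) +
        ContinuousLinearMap.snd ℝ ℝ (R3 × ℝ)) (0, p) := by
  obtain ⟨K, L, h1, -⟩ := S.bddLip_rot_turn β
  exact (S.isFlow_spin β).hasStrictFDerivAt h1 p

theorem hasDerivAt_act_zero (w : ℂ) (p : R3 × ℝ) : HasDerivAt (fun ρ : ℝ => S.act (ρ * w) p)
    (w.re • S.rot p + w.im • S.rot (turn (π / 2) p)) 0 := by
  have h1 : HasDerivAt (fun ρ : ℝ => S.spin (π / 2) (ρ * w.im) p)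
      (w.im • S.rot (turn (π / 2) p)) 0 := by
    have h := (S.isFlow_spin (π / 2)).deriv p (0 * w.im)
    have := h.scomp (0 : ℝ) ((hasDerivAt_id (0 : ℝ)).mul_const w.im)
    simpa [(S.isFlow_spin _).zero, Function.comp_def] using this
  have h2 : HasDerivAt (fun ρ : ℝ => ρ * w.re) w.re 0 := by
    simpa using (hasDerivAt_id (0 : ℝ)).mul_const w.re
  have h3 := (S.hasStrictFDerivAt_spin 0 p).hasFDerivAt
  have h4 : ((0 : ℝ) * w.re, S.spin (π / 2) (0 * w.im) p) = (0, p) := by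
    simp [(S.isFlow_spin _).zero]
  rw [← h4] at h3
  have := h3.comp_hasDerivAt (0 : ℝ) (h2.prodMk h1)
  simpa [act, Function.comp_def] using this

theorem hasDerivAt_act (w : ℂ) {p : R3 × ℝ} (hp : p.1 ∈ S.Λ) (t : ℝ) :
    HasDerivAt (fun ρ : ℝ => S.act (ρ * w) p)
      (w.re • S.rot (S.act (t * w) p) + w.im • S.rot (turn (π / 2) (S.act (t * w) p))) t := by
  have h := S.hasDerivAt_act_zero w (S.act (t * w) p)
  rw [← sub_self t] at h
  have := h.comp_sub_const t t
  refine this.congr_of_eventuallyEq (Eventually.of_forall fun ρ => ?_)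
  beta_reduce
  rw [← S.act_add hp]
  push_cast
  ring_nf

theorem act_polar {p : R3 × ℝ} (hp : p.1 ∈ S.Λ) (ρ β : ℝ) :
    S.act (ρ * Complex.exp (β * Complex.I)) p = S.spin β ρ p := by
  obtain ⟨K, L, h1, -⟩ := S.bddLip_rot_turn β
  have := (S.isFlow_spin β).eq_of_hasDerivAt h1
    (γ := fun ρ : ℝ => S.act (ρ * Complex.exp (β * Complex.I)) p) (fun t => by
      have := S.hasDerivAt_act (Complex.exp (β * Complex.I)) hp t
      rwa [Complex.exp_ofReal_mul_I_re, Complex.exp_ofReal_mul_I_im, rot_turn_pi_div_two,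
        ← rot_turn] at this) ρ
  simpa [act_zero] using this

theorem act_turn {p : R3 × ℝ} (hp : p.1 ∈ S.Λ) (w : ℂ) (γ : ℝ) :
    S.act w (turn γ p) = turn γ (S.act (Complex.exp (γ * Complex.I) * w) p) := by
  have h1 := S.act_polar (p := turn γ p) hp ‖w‖ w.arg
  have h2 := S.act_polar hp ‖w‖ (γ + w.arg)
  rw [Complex.norm_mul_exp_arg_mul_I] at h1
  rw [h1, spin_turn, ← h2]
  congr 2
  conv_rhs => rw [← Complex.norm_mul_exp_arg_mul_I w]
  push_cast
  rw [add_mul, Complex.exp_add]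
  ring

end FlatFrame

end RotatingFields

section RotatingLocal

open Set Filter Topology Metric Real
open scoped NNReal

namespace FlatFrame

variable (S : FlatFrame)

/-- Joint flow coordinates, together with a transversal displacement. -/
def coords (p : R3 × ℝ) (c : ℝ × ℝ × ℝ) : R3 :=
  (S.spin 0 c.1 (S.spin (π / 2) c.2.1 (p.1 + c.2.2 • S.n p.1, p.2))).1

theorem coords_act (p : R3 × ℝ) (w : ℂ) : S.coords p (w.re, w.im, 0) = (S.act w p).1 := by
  simp [coords, act]

theorem q_coords (p : R3 × ℝ) (c : ℝ × ℝ × ℝ) :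
    S.q (S.coords p c) = S.q (p.1 + c.2.2 • S.n p.1) := by
  simp only [coords, q_spin]

theorem coords_zero (p : R3 × ℝ) : S.coords p 0 = p.1 := by
  simp [coords, (S.isFlow_spin _).zero]

theorem exists_hasStrictFDerivAt_coords {p : R3 × ℝ} (hp : p.1 ∈ S.Λ) :
    ∃ L : (ℝ × ℝ × ℝ) ≃L[ℝ] R3, HasStrictFDerivAt (S.coords p) (L : (ℝ × ℝ × ℝ) →L[ℝ] R3) 0 := by
  obtain ⟨A, hA⟩ := S.exists_frame_equiv (S.Λ_subset_O hp)
  have hr := S.r_ne _ hp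
  set n := S.n p.1 with hn
  set r := S.r p.1 with hrdef
  let π₁ := ContinuousLinearMap.fst ℝ ℝ (ℝ × ℝ)
  let π₂ := (ContinuousLinearMap.fst ℝ ℝ ℝ).comp (ContinuousLinearMap.snd ℝ ℝ (ℝ × ℝ))
  let π₃ := (ContinuousLinearMap.snd ℝ ℝ ℝ).comp (ContinuousLinearMap.snd ℝ ℝ (ℝ × ℝ))
  let R : (ℝ × ℝ × ℝ) →L[ℝ] ℝ × ℝ × ℝ :=
    ((r * cos p.2) • π₁ - (r * sin p.2) • π₂).prod
      (((r * sin p.2) • π₁ + (r * cos p.2) • π₂).prod π₃)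
  have hR : ∀ c, R c = (r * cos p.2 * c.1 - r * sin p.2 * c.2.1,
    r * sin p.2 * c.1 + r * cos p.2 * c.2.1, c.2.2) := fun c => rfl
  have hinj : Function.Injective (R : (ℝ × ℝ × ℝ) →ₗ[ℝ] ℝ × ℝ × ℝ) := by
    rw [← LinearMap.ker_eq_bot, LinearMap.ker_eq_bot']
    rintro ⟨s, t, ρ⟩ h
    have h' : R (s, t, ρ) = 0 := h
    rw [hR] at h'
    simp only [Prod.mk_eq_zero] at h' ⊢
    obtain ⟨e1, e2, e3⟩ := h'
    have hs : r * s = 0 := by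
      linear_combination cos p.2 * e1 + sin p.2 * e2 - r * s * sin_sq_add_cos_sq p.2
    have ht : r * t = 0 := by
      linear_combination cos p.2 * e2 - sin p.2 * e1 - r * t * sin_sq_add_cos_sq p.2
    exact ⟨(mul_eq_zero.1 hs).resolve_left hr, (mul_eq_zero.1 ht).resolve_left hr, e3⟩
  let R' : (ℝ × ℝ × ℝ) ≃L[ℝ] ℝ × ℝ × ℝ :=
    (LinearEquiv.ofInjectiveEndo (R : (ℝ × ℝ × ℝ) →ₗ[ℝ] ℝ × ℝ × ℝ) hinj).toContinuousLinearEquiv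
  refine ⟨R'.trans A, ?_⟩
  have h1 : HasStrictFDerivAt (fun c : ℝ × ℝ × ℝ => (p.1 + c.2.2 • n, p.2))
      ((π₃.smulRight n).prod 0) 0 :=
    ((π₃.smulRight n).hasStrictFDerivAt.const_add p.1).prodMk (hasStrictFDerivAt_const _ _)
  have h2 : HasStrictFDerivAt (fun c : ℝ × ℝ × ℝ => (c.2.1, (p.1 + c.2.2 • n, p.2))) _ 0 :=
    π₂.hasStrictFDerivAt.prodMk h1
  have e0 : ((fun c : ℝ × ℝ × ℝ => (c.2.1, (p.1 + c.2.2 • n, p.2))) 0) = (0, p) := by simp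
  have h3 := (e0 ▸ S.hasStrictFDerivAt_spin (π / 2) p).comp 0 h2
  have h4 := π₁.hasStrictFDerivAt.prodMk h3
  have e1 : ((π₁ (0 : ℝ × ℝ × ℝ), ((fun q : ℝ × (R3 × ℝ) => S.spin (π / 2) q.1 q.2) ∘
      fun c : ℝ × ℝ × ℝ => (c.2.1, (p.1 + c.2.2 • n, p.2))) 0) : ℝ × (R3 × ℝ)) = (0, p) := by
    simp [(S.isFlow_spin _).zero]
  have h5 := (e1 ▸ S.hasStrictFDerivAt_spin 0 p).comp 0 h4
  refine (h5.fst).congr_fderiv ?_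
  refine ContinuousLinearMap.ext fun c => ?_
  change c.1 • (S.rot (turn 0 p)).1 + (c.2.1 • (S.rot (turn (π / 2) p)).1 + c.2.2 • n) = A (R c)
  rw [hA, hR, turn_zero, rot_turn_pi_div_two]
  simp only [rot, vec, ← hrdef]
  module

theorem exists_injOn_act {p : R3 × ℝ} (hp : p.1 ∈ S.Λ) :
    ∃ ε > 0, InjOn (fun w => (S.act w p).1) (ball 0 ε) := by
  obtain ⟨L, hL⟩ := S.exists_hasStrictFDerivAt_coords hp
  set e := hL.toOpenPartialHomeomorph (S.coords p)
  have hU : e.source ∈ 𝓝 (0 : ℝ × ℝ × ℝ) :=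
    e.open_source.mem_nhds hL.mem_toOpenPartialHomeomorph_source
  have hc : Continuous fun w : ℂ => ((w.re, w.im, 0) : ℝ × ℝ × ℝ) := by fun_prop
  obtain ⟨ε, hε, h⟩ := Metric.mem_nhds_iff.1 (hc.continuousAt.preimage_mem_nhds
    (x := 0) (by exact hU))
  refine ⟨ε, hε, fun w hw w' hw' hww => ?_⟩
  have : ((w.re, w.im, 0) : ℝ × ℝ × ℝ) = (w'.re, w'.im, 0) :=
    e.injOn (h hw) (h hw') (by
      change S.coords p _ = S.coords p _
      rw [coords_act, coords_act]
      exact hww)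
  simp only [Prod.mk.injEq] at this
  exact Complex.ext this.1 this.2.1

theorem image_act_mem_nhdsWithin {p : R3 × ℝ} (hp : p.1 ∈ S.Λ) {U : Set ℂ} (hU : U ∈ 𝓝 0) :
    (fun w => (S.act w p).1) '' U ∈ 𝓝[S.Λ] p.1 := by
  obtain ⟨L, hL⟩ := S.exists_hasStrictFDerivAt_coords hp
  obtain ⟨r, κ, C, hr, -, -, hC, h⟩ := S.exists_chart (S.Λ_subset_O hp) one_pos
  have hV : {c : ℝ × ℝ × ℝ | (⟨c.1, c.2.1⟩ : ℂ) ∈ U ∧ |c.2.2| < r} ∈ 𝓝 (0 : ℝ × ℝ × ℝ) := by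
    refine inter_mem ?_ ?_
    · have hc : Continuous fun c : ℝ × ℝ × ℝ => (⟨c.1, c.2.1⟩ : ℂ) :=
        Complex.equivRealProdCLM.symm.continuous.comp
          (by fun_prop : Continuous fun c : ℝ × ℝ × ℝ => (c.1, c.2.1))
      exact hc.continuousAt.preimage_mem_nhds hU
    · have hc : Continuous fun c : ℝ × ℝ × ℝ => |c.2.2| := by fun_prop
      exact hc.continuousAt.preimage_mem_nhds (Iio_mem_nhds (by simpa using hr))
  have hI := hL.map_nhds_eq_of_equiv ▸ image_mem_map (m := S.coords p) hV
  rw [coords_zero] at hI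
  filter_upwards [mem_nhdsWithin_of_mem_nhds hI, self_mem_nhdsWithin] with z hz hzΛ
  obtain ⟨c, ⟨hcU, hcr⟩, rfl⟩ := hz
  have hq := (S.q_coords p c).symm.trans (S.q_eq_zero hzΛ)
  have h0 := ((h p.1 (mem_ball_self hr)).2.2 c.2.2 0 hcr (by simpa using hr)).1
  rw [hq, zero_smul, add_zero, S.q_eq_zero hp, sub_zero, sub_zero, abs_zero, mul_zero] at h0
  have hc0 : c.2.2 = 0 := abs_nonpos_iff.1 h0
  refine ⟨⟨c.1, c.2.1⟩, hcU, ?_⟩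
  beta_reduce
  rw [← coords_act, ← hc0]

end FlatFrame

end RotatingLocal

section PeriodLattice

open Set Filter Topology Metric Module

variable {E M : Type*} [NormedAddCommGroup E] [NormedSpace ℝ E] [FiniteDimensional ℝ E]
  [TopologicalSpace M] [CompactSpace M]

/-- The period group of an open surjection onto a compact space spans. -/
theorem span_periods_eq_top {F : E → M} (hF : IsOpenMap F) (hs : Function.Surjective F)
    {Γ : Submodule ℤ E} (hΓ : ∀ s t, F s = F t → t - s ∈ Γ) :
    Submodule.span ℝ (Γ : Set E) = ⊤ := by
  by_contra hne
  obtain ⟨f, hf0, hf⟩ := Submodule.exists_le_ker_of_lt_top _ (lt_top_iff_ne_top.2 hne)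
  obtain ⟨x, hx⟩ : ∃ x, f x ≠ 0 := by
    by_contra! h
    exact hf0 (LinearMap.ext h)
  let f' : E →L[ℝ] ℝ := f.toContinuousLinearMap
  obtain ⟨n, hn⟩ := isCompact_univ.elim_directed_cover (fun n : ℕ => F '' ball 0 n)
    (fun n => hF _ isOpen_ball) (fun y _ => by
      obtain ⟨w, rfl⟩ := hs y
      obtain ⟨n, hn⟩ := exists_nat_gt ‖w‖
      exact mem_iUnion.2 ⟨n, w, by simpa using hn, rfl⟩)
    (directed_of_isDirected_le fun m n h => image_mono (ball_subset_ball (by exact_mod_cast h)))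
  obtain ⟨k, hk⟩ := exists_nat_gt (‖f'‖ * n / |f x|)
  obtain ⟨y, hy, hxy⟩ := hn (mem_univ (F ((k : ℝ) • x)))
  have h0 := hf (Submodule.subset_span (hΓ _ _ hxy))
  rw [LinearMap.mem_ker, map_sub, map_smul, sub_eq_zero, smul_eq_mul] at h0
  have h1 : ‖f' y‖ ≤ ‖f'‖ * n := (f'.le_opNorm y).trans (by
    gcongr
    exact (mem_ball_zero_iff.1 hy).le)
  have h2 : f' y = k * f x := h0.symm
  rw [h2, norm_mul, Real.norm_natCast, Real.norm_eq_abs] at h1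
  rw [div_lt_iff₀ (abs_pos.2 hx)] at hk
  linarith

theorem nonempty_homeomorph_torus [T2Space M] (hE : finrank ℝ E = 2) {F : E → M}
    (hFc : Continuous F) (hF : IsOpenMap F) (hs : Function.Surjective F)
    {ε : ℝ} (hε : 0 < ε) (hinj : InjOn F (ball 0 ε))
    (Γ : Submodule ℤ E) (hΓ : ∀ s t, F s = F t ↔ t - s ∈ Γ) :
    Nonempty (M ≃ₜ AddCircle (1 : ℝ) × AddCircle (1 : ℝ)) := by
  have : DiscreteTopology Γ := by
    refine discreteTopology_of_isOpen_singleton_zero ?_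
    have : ({0} : Set Γ) = (fun γ : Γ => (γ : E)) ⁻¹' ball 0 ε := by
      ext γ
      refine ⟨fun h => by simp [mem_singleton_iff.1 h, hε], fun h => ?_⟩
      have h1 : F 0 = F γ := (hΓ _ _).2 (by simp)
      exact Subtype.ext (hinj (mem_ball_self hε) h h1).symm
    rw [this]
    exact isOpen_ball.preimage continuous_subtype_val
  have : IsZLattice ℝ Γ := ⟨span_periods_eq_top hF hs fun s t => (hΓ s t).1⟩
  have := ZLattice.module_finite ℝ Γ
  have := ZLattice.module_free ℝ Γ
  let b := (finBasisOfFinrankEq ℤ Γ ((ZLattice.rank ℝ Γ).trans hE)).ofZLatticeBasis ℝ Γ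
  have hb : ∀ v, v ∈ Γ ↔ ∀ i, b.repr v i ∈ range (algebraMap ℤ ℝ) := fun v => by
    rw [← b.mem_span_iff_repr_mem ℤ, Basis.ofZLatticeBasis_span]
  let T : ℝ × ℝ → M := fun x => F (x.1 • b 0 + x.2 • b 1)
  have hT : Continuous T := by fun_prop
  have hmk : IsOpenQuotientMap ((↑) : ℝ → AddCircle (1 : ℝ)) := QuotientAddGroup.isOpenQuotientMap_mk
  let π : C(ℝ × ℝ, AddCircle (1 : ℝ) × AddCircle (1 : ℝ)) :=
    ⟨Prod.map (↑) (↑), (hmk.prodMap hmk).continuous⟩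
  have hπ : IsQuotientMap π := (hmk.prodMap hmk).isQuotientMap
  have hTπ : ∀ x y, T x = T y ↔ π x = π y := fun x y => by
    have e1 : y.1 • b 0 + y.2 • b 1 - (x.1 • b 0 + x.2 • b 1) =
      (y.1 - x.1) • b 0 + (y.2 - x.2) • b 1 := by module
    have e2 : ∀ u v : ℝ, (u : AddCircle (1 : ℝ)) = v ↔ v - u ∈ range (algebraMap ℤ ℝ) := by
      intro u v
      rw [eq_comm, ← sub_eq_zero, ← AddCircle.coe_sub, AddCircle.coe_eq_zero_iff]
      simp
    rw [hΓ, e1, hb, Fin.forall_fin_two, Prod.ext_iff]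
    simp [π, e2]
  have hg : ∀ x y, π x = π y → T x = T y := fun x y => (hTπ x y).2
  let g := hπ.lift ⟨T, hT⟩ hg
  have hgπ : ∀ x, g (π x) = T x := fun x => congrArg (· x) (hπ.lift_comp ⟨T, hT⟩ hg)
  have hbij : Function.Bijective g := by
    refine ⟨fun u v h => ?_, fun y => ?_⟩
    · obtain ⟨x, rfl⟩ := hπ.surjective u
      obtain ⟨y, rfl⟩ := hπ.surjective v
      rw [hgπ, hgπ] at h
      exact (hTπ _ _).1 h
    · obtain ⟨w, rfl⟩ := hs y
      refine ⟨π (b.repr w 0, b.repr w 1), ?_⟩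
      rw [hgπ]
      change F _ = _
      congr 1
      conv_rhs => rw [← b.sum_repr w, Fin.sum_univ_two]
  exact ⟨(Continuous.homeoOfEquivCompactToT2 (f := Equiv.ofBijective g hbij) g.continuous).symm⟩

end PeriodLattice

section Unrolling

open Set Filter Topology Metric Real

namespace FlatFrame

variable (S : FlatFrame)

/-- The developing map based at a point of the surface. -/
def unroll (z : S.Λ) (w : ℂ) : S.Λ := ⟨(S.act w (z, 0)).1, S.act_mem z.2 w⟩

theorem unroll_zero (z : S.Λ) : S.unroll z 0 = z := Subtype.ext (congrArg Prod.fst (S.act_zero (z, 0)))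

theorem continuous_unroll (z : S.Λ) : Continuous (S.unroll z) :=
  (continuous_fst.comp (S.continuous_act _)).subtype_mk _

theorem exists_act_eq {p p' : R3 × ℝ} (hp : p'.1 ∈ S.Λ) (h : p.1 = p'.1) :
    ∃ a : ℂ, ‖a‖ = 1 ∧ ∀ v, (S.act v p).1 = (S.act (a * v) p').1 := by
  refine ⟨Complex.exp ((p.2 - p'.2 : ℝ) * Complex.I), Complex.norm_exp_ofReal_mul_I _, fun v => ?_⟩
  have : p = turn (p.2 - p'.2) p' := by simp [turn, Prod.ext_iff, h]
  conv_lhs => rw [this, act_turn S hp]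
  rfl

theorem unroll_add_of_eq {z z' : S.Λ} {w w' : ℂ} (h : S.unroll z w = S.unroll z' w') :
    ∃ a : ℂ, ‖a‖ = 1 ∧ ∀ v, S.unroll z (v + w) = S.unroll z' (a * v + w') := by
  obtain ⟨a, ha, h⟩ := S.exists_act_eq (S.act_mem z'.2 w') (Subtype.ext_iff.1 h)
  refine ⟨a, ha, fun v => Subtype.ext ?_⟩
  change (S.act _ _).1 = (S.act _ _).1
  rw [act_add S z.2, act_add S z'.2, h]

theorem exists_injOn_unroll (z : S.Λ) (w : ℂ) :
    ∃ ε > 0, InjOn (fun v => S.unroll z (v + w)) (ball 0 ε) := by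
  obtain ⟨ε, hε, h⟩ := S.exists_injOn_act (S.act_mem (p := (z, 0)) z.2 w)
  refine ⟨ε, hε, fun v hv v' hv' e => h hv hv' ?_⟩
  beta_reduce
  rw [← act_add S z.2, ← act_add S z.2]
  exact Subtype.ext_iff.1 e

theorem isOpenMap_unroll (z : S.Λ) : IsOpenMap (S.unroll z) := by
  rw [isOpenMap_iff_nhds_le]
  intro w V hV
  have hV' : (fun v => v + w) ⁻¹' (S.unroll z ⁻¹' V) ∈ 𝓝 (0 : ℂ) :=
    (continuous_add_const w).continuousAt.preimage_mem_nhds (by rwa [zero_add])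
  have := S.image_act_mem_nhdsWithin (S.act_mem (p := (z, 0)) z.2 w) hV'
  rw [mem_nhds_subtype_iff_nhdsWithin]
  refine mem_of_superset this ?_
  rintro _ ⟨v, hv, rfl⟩
  exact ⟨_, hv, congrArg Prod.fst (S.act_add (p := (z, 0)) z.2 v w)⟩

theorem surjective_unroll (z : S.Λ) : Function.Surjective (S.unroll z) := by
  have hclopen : IsClopen (range (S.unroll z)) := by
    refine ⟨⟨?_⟩, (S.isOpenMap_unroll z).isOpen_range⟩
    rw [isOpen_iff_mem_nhds]
    intro y hy
    refine mem_of_superset ((S.isOpenMap_unroll y).isOpen_range.mem_nhds ⟨0, S.unroll_zero y⟩) ?_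
    rintro _ ⟨v, rfl⟩ ⟨w, hw⟩
    obtain ⟨a, -, ha⟩ := S.unroll_add_of_eq hw.symm
    refine hy ⟨_, (ha (-v)).symm.trans ?_⟩
    rw [neg_add_cancel, unroll_zero]
  exact range_eq_univ.1 (hclopen.eq_univ (range_nonempty _))

theorem unroll_add_periodic {z : S.Λ} {w w' : ℂ} (h : S.unroll z w = S.unroll z w') (v : ℂ) :
    S.unroll z (v + w) = S.unroll z (v + w') := by
  obtain ⟨a, ha, hv⟩ := S.unroll_add_of_eq h
  by_cases h1 : a = 1
  · simpa [h1] using hv v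
  have h1' : 1 - a ≠ 0 := sub_ne_zero.2 (Ne.symm h1)
  -- A nontrivial rotation would fix a point, contradicting injectivity nearby.
  obtain ⟨ε, hε, hinj⟩ := S.exists_injOn_unroll z ((w' - a * w) / (1 - a))
  have hu : ‖((ε / 2 : ℝ) : ℂ)‖ < ε := by
    rw [Complex.norm_real, norm_of_nonneg (by positivity)]
    linarith
  have := hinj (x₁ := ((ε / 2 : ℝ) : ℂ)) (x₂ := a * ((ε / 2 : ℝ) : ℂ)) (mem_ball_zero_iff.2 hu)
    (by rw [mem_ball_zero_iff, norm_mul, ha, one_mul]; exact hu) (by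
      have := hv (((ε / 2 : ℝ) : ℂ) + (w' - a * w) / (1 - a) - w)
      beta_reduce
      rw [sub_add_cancel] at this
      rw [this]
      congr 1
      field_simp
      ring)
  refine absurd (mul_right_cancel₀ (b := ((ε / 2 : ℝ) : ℂ)) ?_ (this.symm.trans (one_mul _).symm)) h1
  exact Complex.ofReal_ne_zero.2 (by positivity)

/-- The periods of the developing map. -/
def periods (z : S.Λ) : AddSubgroup ℂ where
  carrier := {γ | ∀ s, S.unroll z (s + γ) = S.unroll z s}
  zero_mem' s := by rw [add_zero]
  add_mem' {γ δ} hγ hδ s := by rw [← add_assoc, hδ, hγ]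
  neg_mem' {γ} hγ s := by rw [← hγ (s + -γ), neg_add_cancel_right]

theorem unroll_eq_iff (z : S.Λ) (s t : ℂ) :
    S.unroll z s = S.unroll z t ↔ t - s ∈ S.periods z := by
  refine ⟨fun h v => ?_, fun h => ?_⟩
  · have := S.unroll_add_periodic h (v - s)
    rw [sub_add_cancel] at this
    rw [this]
    congr 1
    ring
  · rw [← h s, add_sub_cancel]

theorem nonempty_homeomorph_torus : Nonempty (S.Λ ≃ₜ AddCircle (1 : ℝ) × AddCircle (1 : ℝ)) := by
  obtain ⟨z⟩ : Nonempty S.Λ := inferInstance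
  obtain ⟨ε, hε, hinj⟩ := S.exists_injOn_unroll z 0
  simp only [add_zero] at hinj
  exact _root_.nonempty_homeomorph_torus Complex.finrank_real_complex (S.continuous_unroll z)
    (S.isOpenMap_unroll z) (S.surjective_unroll z) hε hinj (S.periods z).toIntSubmodule
    (S.unroll_eq_iff z)

end FlatFrame

end Unrolling

/-- **Regular flux surfaces are tori**: a compact connected component of a regular
level set of `p`, to which a nowhere-vanishing smooth field `B` is tangent, is
homeomorphic to the two-torus `(ℝ/ℤ) × (ℝ/ℤ)`. -/
theorem regular_flux_surface_is_torus
    (U : Set R3) (hU : IsOpen U)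
    (p : R3 → ℝ) (hp : ContDiffOn ℝ (⊤ : ℕ∞) p U)
    (c : ℝ) (Λ : Set R3) (z₀ : R3) (hz₀ : z₀ ∈ Λ)
    (hΛ : Λ = connectedComponentIn {z | z ∈ U ∧ p z = c} z₀)
    (hΛc : IsCompact Λ)
    (hreg : ∀ z ∈ Λ, gradient p z ≠ 0)
    (B : R3 → R3) (hB : ContDiffOn ℝ (⊤ : ℕ∞) B U)
    (hBne : ∀ z ∈ Λ, B z ≠ 0)
    (htan : ∀ z ∈ Λ, ⟪B z, gradient p z⟫ = 0) :
    Nonempty (Λ ≃ₜ (AddCircle (1 : ℝ) × AddCircle (1 : ℝ))) := by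
  have hΛU : Λ ⊆ U := fun z hz => (connectedComponentIn_subset _ _ (hΛ ▸ hz)).1
  obtain ⟨S, hO, hOU, hq⟩ := exists_levelFrame hU hp c hΛU hΛc hreg hB hBne htan
  obtain ⟨S, rfl⟩ := S.exists_flowFrame
  obtain ⟨S, rfl⟩ := S.exists_framedSurface hz₀ hΛ hΛc hO hOU hq
  obtain ⟨S, rfl⟩ := S.exists_flatFrame
  exact S.nonempty_homeomorph_torus
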